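/- Let n ≥ 3 and 0 < μ < n, and set 2_μ^* = (2n − μ)/(n − 2) and 2^* = 2n/(n − 2). Define: S = inf over nonzero u ∈ C_c^∞(ℝ^n) of ( ∫_{ℝ^n} ‖∇u‖² dx ) / ( ∫_{ℝ^n} |u|^{2^*} dx )^{2/2^*} (the best Sobolev constant); S_{H,L} = inf over nonzero u ∈ C_c^∞(ℝ^n) of ( ∫_{ℝ^n} ‖∇u‖² dx ) / ( ∫_{ℝ^n} ∫_{ℝ^n} |u(x)|^{2_μ^*} |u(y)|^{2_μ^*} / ‖x − y‖^μ dx dy )^{(n−2)/(2n−μ)}; and C(n, μ) = sup over nonzero f ∈ L^{2n/(2n−μ)}(ℝ^n) of ( ∫_{ℝ^n} ∫_{ℝ^n} |f(x)| |f(y)| / ‖x − y‖^μ dx dy ) / ‖f‖_{L^{2n/(2n−μ)}}². Then S = C(n, μ)^{(n−2)/(2n−μ)} · S_{H,L}. -/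

import Mathlib

open MeasureTheory ENNReal

namespace HLS
open EuclideanGeometry Set Filter Topology

abbrev EE (n : ℕ) := EuclideanSpace ℝ (Fin n)

variable {n : ℕ}

noncomputable def jj (a : EE n) (r : ℝ) (x : EE n) : ℝ := r ^ 2 / ‖x - a‖ ^ 2
noncomputable def ww (x : EE n) : ℝ := (1 + ‖x‖ ^ 2)⁻¹
noncomputable def DD (a : EE n) (r : ℝ) (x y : EE n) : ℝ :=
  r ^ 2 - 2 * inner ℝ (x - a) (y - a) + ‖x - a‖ ^ 2 * ‖y - a‖ ^ 2 / r ^ 2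

theorem ww_pos (x : EE n) : 0 < ww x := by unfold ww; positivity
theorem ww_le_one (x : EE n) : ww x ≤ 1 := by
  unfold ww; apply inv_le_one_of_one_le₀; nlinarith [sq_nonneg ‖x‖]
theorem jj_pos {a : EE n} {r : ℝ} (hr : r ≠ 0) {x : EE n} (hx : x ≠ a) : 0 < jj a r x := by
  have : 0 < ‖x - a‖ := norm_pos_iff.2 (sub_ne_zero.2 hx)
  unfold jj; positivity

theorem inv_eq (a : EE n) (r : ℝ) (x : EE n) :
    inversion a r x = a + (r ^ 2 / ‖x - a‖ ^ 2) • (x - a) := by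
  simp [inversion, dist_eq_norm, div_pow, add_comm]

theorem inv_sub (a : EE n) (r : ℝ) (x : EE n) :
    inversion a r x - a = (jj a r x) • (x - a) := by
  simp [inv_eq, jj]

theorem norm_inv_sub_sq {a : EE n} {r : ℝ} {x : EE n} (hx : x ≠ a) :
    ‖inversion a r x - a‖ ^ 2 = r ^ 4 / ‖x - a‖ ^ 2 := by
  have : 0 < ‖x - a‖ := norm_pos_iff.2 (sub_ne_zero.2 hx)
  rw [inv_sub, norm_smul, mul_pow, Real.norm_eq_abs, sq_abs, jj]
  field_simp

theorem jj_inv {a : EE n} {r : ℝ} (hr : r ≠ 0) {x : EE n} (hx : x ≠ a) :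
    jj a r (inversion a r x) = (jj a r x)⁻¹ := by
  have : 0 < ‖x - a‖ := norm_pos_iff.2 (sub_ne_zero.2 hx)
  rw [jj, norm_inv_sub_sq hx, jj]
  field_simp

theorem inv_ne {a : EE n} {r : ℝ} (hr : r ≠ 0) {x : EE n} (hx : x ≠ a) :
    inversion a r x ≠ a := by
  rwa [Ne, inversion_eq_center hr]

theorem DD_symm (a : EE n) (r : ℝ) (x y : EE n) : DD a r x y = DD a r y x := by
  unfold DD; rw [real_inner_comm]; ring

/-- distance to reflected point -/
theorem norm_sub_inv {a : EE n} {r : ℝ} (hr : r ≠ 0) (x : EE n) {y : EE n} (hy : y ≠ a) :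
    ‖x - inversion a r y‖ ^ 2 / jj a r y = DD a r x y := by
  have h0 : 0 < ‖y - a‖ := norm_pos_iff.2 (sub_ne_zero.2 hy)
  have : x - inversion a r y = (x - a) - (jj a r y) • (y - a) := by
    rw [← inv_sub]; abel
  rw [this, norm_sub_sq_real, norm_smul, inner_smul_right, DD, Real.norm_eq_abs, mul_pow, sq_abs, jj]
  field_simp
  ring

theorem DD_inv {a : EE n} {r : ℝ} (hr : r ≠ 0) (x : EE n) {y : EE n} (hy : y ≠ a) :
    DD a r x (inversion a r y) / jj a r y = ‖x - y‖ ^ 2 := by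
  have h0 : 0 < ‖y - a‖ := norm_pos_iff.2 (sub_ne_zero.2 hy)
  have : x - y = (x - a) - (y - a) := by abel
  rw [this, norm_sub_sq_real, DD, norm_inv_sub_sq hy, inv_sub, inner_smul_right, jj]
  field_simp
  ring

theorem DD_sub {a : EE n} {r : ℝ} (hr : r ≠ 0) (x y : EE n) :
    DD a r x y - ‖x - y‖ ^ 2 = (‖x - a‖ ^ 2 - r ^ 2) * (‖y - a‖ ^ 2 - r ^ 2) / r ^ 2 := by
  have : x - y = (x - a) - (y - a) := by abel
  rw [this, norm_sub_sq_real, DD]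
  field_simp
  ring

/-- the ratio of the weights -/
theorem ww_inv {a : EE n} {r : ℝ} (hr : r ≠ 0) {x : EE n} (hx : x ≠ a) :
    (ww (inversion a r x) * jj a r x)⁻¹ = (ww x)⁻¹ +
      (‖x - a‖ ^ 2 - r ^ 2) * (1 + ‖a‖ ^ 2 - r ^ 2) / r ^ 2 := by
  have h0 : 0 < ‖x - a‖ := norm_pos_iff.2 (sub_ne_zero.2 hx)
  have h1 : ‖x‖ ^ 2 = ‖a‖ ^ 2 + 2 * inner ℝ a (x - a) + ‖x - a‖ ^ 2 := by
    rw [← norm_add_sq_real]; simp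
  have h2 : ‖inversion a r x‖ ^ 2 =
      ‖a‖ ^ 2 + 2 * (jj a r x * inner ℝ a (x - a)) + r ^ 4 / ‖x - a‖ ^ 2 := by
    rw [← inner_smul_right, ← inv_sub, ← norm_inv_sub_sq hx, ← norm_add_sq_real]; simp
  rw [mul_inv, ww, ww, inv_inv, inv_inv, h1, h2, jj]
  field_simp
  ring

theorem measurable_inv (a : EE n) (r : ℝ) : Measurable (inversion a r) := by
  have : inversion a r = fun x => a + (r ^ 2 / ‖x - a‖ ^ 2) • (x - a) := funext (inv_eq a r)
  rw [this]; fun_prop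

theorem measurable_jj (a : EE n) (r : ℝ) : Measurable (jj a r) := by
  unfold jj; fun_prop

theorem measurable_ww : Measurable (ww (n := n)) := by
  unfold ww; fun_prop

theorem measurable_DD (a : EE n) (r : ℝ) : Measurable (fun q : EE n × EE n => DD a r q.1 q.2) := by
  unfold DD; fun_prop

theorem ae_ne [NeZero n] (a : EE n) : ∀ᵐ x : EE n, x ≠ a := by
  have : Nonempty (Fin n) := ⟨0⟩
  have : Nontrivial (EE n) := inferInstance
  simp [ae_iff]

theorem lintegral_inv [NeZero n] (a : EE n) {r : ℝ} (hr : r ≠ 0) (g : EE n → ℝ≥0∞) :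
    ∫⁻ x, g x = ∫⁻ x, ENNReal.ofReal (jj a r x) ^ (n : ℝ) * g (inversion a r x) := by
  have : Nonempty (Fin n) := ⟨0⟩
  have : Nontrivial (EE n) := inferInstance
  have h := lintegral_image_eq_lintegral_abs_det_fderiv_mul (volume : Measure (EE n))
    (s := {a}ᶜ) (f := inversion a r) (measurableSet_singleton a).compl
    (fun x hx => (hasFDerivAt_inversion (R := r) (by simpa using hx)).hasFDerivWithinAt)
    (inversion_injective a hr).injOn g
  have him : inversion a r '' {a}ᶜ = {a}ᶜ := by
    rw [image_compl_eq (inversion_bijective a hr)]; simp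
  have hres : (volume : Measure (EE n)).restrict {a}ᶜ = volume := by
    rw [Measure.restrict_eq_self_of_ae_mem]
    exact ae_ne a
  rw [him, hres] at h
  rw [h]
  refine lintegral_congr_ae ?_
  filter_upwards [ae_ne a] with x hx
  congr 1
  have hd : ((r / dist x a) ^ 2 • ((ℝ ∙ (x - a))ᗮ.reflection : EE n →L[ℝ] EE n)).det
    = ((r / dist x a) ^ 2) ^ n * (-1) ^ (Module.finrank ℝ (ℝ ∙ (x - a))ᗮᗮ) := by
    rw [← Submodule.det_reflection, ContinuousLinearMap.det]
    simp only [ContinuousLinearMap.toLinearMap_smul, LinearMap.det_smul, finrank_euclideanSpace_fin]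
    rfl
  rw [hd, abs_mul, abs_neg_one_pow, mul_one, abs_of_nonneg (by positivity),
    ENNReal.ofReal_pow (by positivity), ENNReal.rpow_natCast, jj, dist_eq_norm, div_pow]

end HLS

namespace HLS
open EuclideanGeometry Set Filter Topology
variable {n : ℕ}

noncomputable def kap (μ : ℝ) (x y : EE n) : ℝ≥0∞ := ENNReal.ofReal (‖x - y‖ ^ 2) ^ (-(μ / 2))
noncomputable def kap' (μ : ℝ) (a : EE n) (r : ℝ) (x y : EE n) : ℝ≥0∞ :=
  ENNReal.ofReal (DD a r x y) ^ (-(μ / 2))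
noncomputable def tr (μ : ℝ) (a : EE n) (r : ℝ) (f : EE n → ℝ≥0∞) (x : EE n) : ℝ≥0∞ :=
  ENNReal.ofReal (jj a r x) ^ (n - μ / 2 : ℝ) * f (inversion a r x)
def HH (a : EE n) (r : ℝ) : Set (EE n) :=
  {x | 0 < (‖x - a‖ ^ 2 - r ^ 2) * (1 + ‖a‖ ^ 2 - r ^ 2)}
theorem mem_HH {a : EE n} {r : ℝ} {x : EE n} :
    x ∈ HH a r ↔ 0 < (‖x - a‖ ^ 2 - r ^ 2) * (1 + ‖a‖ ^ 2 - r ^ 2) := Iff.rfl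
theorem nmem_HH {a : EE n} {r : ℝ} {x : EE n} :
    x ∉ HH a r ↔ (‖x - a‖ ^ 2 - r ^ 2) * (1 + ‖a‖ ^ 2 - r ^ 2) ≤ 0 := by
  rw [mem_HH, not_lt]
theorem rpow_anti {A B : ℝ≥0∞} {c : ℝ} (hc : 0 ≤ c) (h : A ≤ B) : B ^ (-c) ≤ A ^ (-c) := by
  rw [ENNReal.rpow_neg, ENNReal.rpow_neg]
  exact ENNReal.inv_le_inv.2 (ENNReal.rpow_le_rpow h hc)
open Classical in
noncomputable def pol (μ : ℝ) (a : EE n) (r : ℝ) (f : EE n → ℝ≥0∞) (x : EE n) : ℝ≥0∞ :=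
  if x ∈ HH a r then max (f x) (tr μ a r f x) else min (f x) (tr μ a r f x)
noncomputable def QQ (μ : ℝ) (f g : EE n → ℝ≥0∞) : ℝ≥0∞ := ∫⁻ x, ∫⁻ y, f x * g y * kap μ x y
noncomputable def QQ' (μ : ℝ) (a : EE n) (r : ℝ) (f g : EE n → ℝ≥0∞) : ℝ≥0∞ :=
  ∫⁻ x, ∫⁻ y, f x * g y * kap' μ a r x y
noncomputable def om (μ : ℝ) (x : EE n) : ℝ≥0∞ := ENNReal.ofReal (ww x) ^ (μ / 2)
noncomputable def om' (μ : ℝ) (a : EE n) (r : ℝ) (x : EE n) : ℝ≥0∞ :=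
  ENNReal.ofReal (ww (inversion a r x) * jj a r x) ^ (μ / 2)
noncomputable def LL (μ : ℝ) (f : EE n → ℝ≥0∞) : ℝ≥0∞ := ∫⁻ x, f x * om μ x

@[fun_prop] theorem measurable_kap (μ : ℝ) : Measurable (fun q : EE n × EE n => kap μ q.1 q.2) := by
  unfold kap; fun_prop
@[fun_prop] theorem measurable_kap' (μ : ℝ) (a : EE n) (r : ℝ) :
    Measurable (fun q : EE n × EE n => kap' μ a r q.1 q.2) := by
  unfold kap'; have := measurable_DD a r; fun_prop
@[fun_prop] theorem measurable_tr (μ : ℝ) (a : EE n) (r : ℝ) {f : EE n → ℝ≥0∞} (hf : Measurable f) :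
    Measurable (tr μ a r f) := by
  unfold tr; have := measurable_jj a r; have := measurable_inv a r; fun_prop
theorem measurableSet_HH (a : EE n) (r : ℝ) : MeasurableSet (HH a r) := by
  unfold HH; apply measurableSet_lt <;> fun_prop
@[fun_prop] theorem measurable_pol (μ : ℝ) (a : EE n) (r : ℝ) {f : EE n → ℝ≥0∞} (hf : Measurable f) :
    Measurable (pol μ a r f) := by
  unfold pol
  exact Measurable.ite (measurableSet_HH a r) (by fun_prop) (by fun_prop)
@[fun_prop] theorem measurable_om (μ : ℝ) : Measurable (om μ : EE n → ℝ≥0∞) := by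
  unfold om; have := measurable_ww (n := n); fun_prop
@[fun_prop] theorem measurable_om' (μ : ℝ) (a : EE n) (r : ℝ) : Measurable (om' μ a r) := by
  unfold om'; have := measurable_ww (n := n); have := measurable_jj a r; have := measurable_inv a r
  fun_prop

theorem ofReal_rpow_mul_neg {A B c : ℝ} (hA : 0 < A) (_ : 0 < c) (_ : 0 ≤ B) :
    ENNReal.ofReal A ^ c * ENNReal.ofReal B ^ (-c) = ENNReal.ofReal (B / A) ^ (-c) := by
  rw [div_eq_inv_mul, ENNReal.ofReal_mul (by positivity), ENNReal.mul_rpow_of_ne_top (by simp) (by simp),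
    ENNReal.ofReal_inv_of_pos hA, ENNReal.inv_rpow, ENNReal.rpow_neg (ENNReal.ofReal A) c, inv_inv]

theorem ofReal_rpow_add {A c d : ℝ} (hA : 0 < A) :
    ENNReal.ofReal A ^ (c + d) = ENNReal.ofReal A ^ c * ENNReal.ofReal A ^ d :=
  ENNReal.rpow_add _ _ (by simpa using hA) (by simp)

theorem DD_nonneg {a : EE n} {r : ℝ} (hr : r ≠ 0) (x : EE n) {y : EE n} (hy : y ≠ a) :
    0 ≤ DD a r x y := by
  rw [← norm_sub_inv hr x hy]; have := jj_pos hr hy; positivity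

theorem int_kap [NeZero n] {μ : ℝ} (hμ : 0 < μ) (a : EE n) {r : ℝ} (hr : r ≠ 0) (f : EE n → ℝ≥0∞)
    (x : EE n) : ∫⁻ y, f y * kap μ x y = ∫⁻ y, tr μ a r f y * kap' μ a r x y := by
  rw [lintegral_inv a hr]
  refine lintegral_congr_ae ?_
  filter_upwards [ae_ne a] with y hy
  have hj := jj_pos hr hy
  rw [tr, kap, kap', ← norm_sub_inv hr x hy, ← ofReal_rpow_mul_neg hj (by positivity) (by positivity)]
  rw [show (n : ℝ) = (n - μ / 2) + μ / 2 by ring, ofReal_rpow_add hj]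
  ring_nf

theorem int_kap' [NeZero n] {μ : ℝ} (hμ : 0 < μ) (a : EE n) {r : ℝ} (hr : r ≠ 0) (f : EE n → ℝ≥0∞)
    (x : EE n) : ∫⁻ y, f y * kap' μ a r x y = ∫⁻ y, tr μ a r f y * kap μ x y := by
  rw [lintegral_inv a hr]
  refine lintegral_congr_ae ?_
  filter_upwards [ae_ne a] with y hy
  have hj := jj_pos hr hy
  rw [tr, kap, kap', ← DD_inv hr x hy, ← ofReal_rpow_mul_neg hj (by positivity)
    (DD_nonneg hr _ (inv_ne hr hy))]
  rw [show (n : ℝ) = (n - μ / 2) + μ / 2 by ring, ofReal_rpow_add hj]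
  ring_nf

theorem lin_pull {f : ℝ≥0∞} {g : EE n → ℝ≥0∞} {k : EE n → ℝ≥0∞} (hg : Measurable g)
    (hk : Measurable k) : ∫⁻ y, f * g y * k y = f * ∫⁻ y, g y * k y := by
  rw [← lintegral_const_mul _ (by fun_prop)]
  simp_rw [mul_assoc]

theorem mk1 (μ : ℝ) (x : EE n) : Measurable (kap μ x) := by
  change Measurable (fun y => kap μ x y)
  unfold kap; fun_prop
theorem mk1' (μ : ℝ) (a : EE n) (r : ℝ) (x : EE n) : Measurable (kap' μ a r x) := by
  change Measurable (fun y => kap' μ a r x y)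
  unfold kap' DD; fun_prop

theorem QQ_eq1 [NeZero n] {μ : ℝ} (hμ : 0 < μ) (a : EE n) {r : ℝ} (hr : r ≠ 0) {f g : EE n → ℝ≥0∞}
    (hg : Measurable g) : QQ μ f g = QQ' μ a r f (tr μ a r g) := by
  unfold QQ QQ'
  refine lintegral_congr fun x => ?_
  rw [lin_pull hg (mk1 μ x), lin_pull (measurable_tr μ a r hg) (mk1' μ a r x), int_kap hμ a hr]

theorem QQ_eq2 [NeZero n] {μ : ℝ} (hμ : 0 < μ) (a : EE n) {r : ℝ} (hr : r ≠ 0) {f g : EE n → ℝ≥0∞}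
    (hg : Measurable g) : QQ' μ a r f g = QQ μ f (tr μ a r g) := by
  unfold QQ QQ'
  refine lintegral_congr fun x => ?_
  rw [lin_pull hg (mk1' μ a r x), lin_pull (measurable_tr μ a r hg) (mk1 μ x), int_kap' hμ a hr]

theorem QQ'_symm (μ : ℝ) (a : EE n) (r : ℝ) {f g : EE n → ℝ≥0∞} (hf : Measurable f)
    (hg : Measurable g) : QQ' μ a r f g = QQ' μ a r g f := by
  unfold QQ'
  rw [lintegral_lintegral_swap]
  · refine lintegral_congr fun x => lintegral_congr fun y => ?_
    rw [mul_comm (g x), kap', kap', DD_symm]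
  · have := measurable_kap' μ a r
    exact Measurable.aemeasurable (by fun_prop)

theorem QQ_four [NeZero n] {μ : ℝ} (hμ : 0 < μ) (a : EE n) {r : ℝ} (hr : r ≠ 0) {f : EE n → ℝ≥0∞}
    (hf : Measurable f) : 4 * QQ μ f f = ∫⁻ x, ∫⁻ y,
      ((f x * f y + tr μ a r f x * tr μ a r f y) * kap μ x y +
       (f x * tr μ a r f y + tr μ a r f x * f y) * kap' μ a r x y) := by
  have hk := measurable_kap (n := n) μ
  have hk' := measurable_kap' μ a r
  have ht := measurable_tr μ a r hf
  have h1 := QQ_eq1 hμ a hr (f := f) hf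
  have h2 := QQ'_symm μ a r hf ht
  have h3 := QQ_eq2 hμ a hr (f := tr μ a r f) hf
  have e : ∀ x, ∫⁻ y,
      ((f x * f y + tr μ a r f x * tr μ a r f y) * kap μ x y +
       (f x * tr μ a r f y + tr μ a r f x * f y) * kap' μ a r x y) =
      ((∫⁻ y, f x * f y * kap μ x y) + ∫⁻ y, tr μ a r f x * tr μ a r f y * kap μ x y) +
      ((∫⁻ y, f x * tr μ a r f y * kap' μ a r x y) + ∫⁻ y, tr μ a r f x * f y * kap' μ a r x y) := by
    intro x
    have := mk1 (n := n) μ x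
    have := mk1' μ a r x
    simp_rw [add_mul]
    rw [lintegral_add_left (by fun_prop), lintegral_add_left (by fun_prop),
      lintegral_add_left (by fun_prop)]
  simp_rw [e]
  have m1 : ∀ (p q : EE n → ℝ≥0∞), Measurable p → Measurable q →
      Measurable fun x => ∫⁻ y, p x * q y * kap μ x y := by
    intro p q hp hq
    apply Measurable.lintegral_prod_right' (f := fun z : EE n × EE n => p z.1 * q z.2 * kap μ z.1 z.2)
    fun_prop
  have m2 : ∀ (p q : EE n → ℝ≥0∞), Measurable p → Measurable q →
      Measurable fun x => ∫⁻ y, p x * q y * kap' μ a r x y := by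
    intro p q hp hq
    apply Measurable.lintegral_prod_right'
      (f := fun z : EE n × EE n => p z.1 * q z.2 * kap' μ a r z.1 z.2)
    fun_prop
  rw [lintegral_add_left (Measurable.fun_add (m1 _ _ hf hf) (m1 _ _ ht ht)), lintegral_add_left (m1 _ _ hf hf),
    lintegral_add_left (m2 _ _ hf ht)]
  change _ = QQ μ f f + QQ μ (tr μ a r f) (tr μ a r f) +
    (QQ' μ a r f (tr μ a r f) + QQ' μ a r (tr μ a r f) f)
  rw [← h3, ← h2, ← h1]
  ring

theorem exch {X Y k k' : ℝ≥0∞} (h : X ≤ Y) (hk : k' ≤ k) : X * k + Y * k' ≤ Y * k + X * k' := by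
  obtain ⟨e, rfl⟩ := exists_add_of_le h
  obtain ⟨d, rfl⟩ := exists_add_of_le hk
  have : (X + e) * (k' + d) + X * k' = X * (k' + d) + (X + e) * k' + e * d := by ring
  rw [this]; exact le_self_add

theorem exch2 {A A' B B' : ℝ≥0∞} (h : A ≤ A') (h' : B ≤ B') : A * B' + A' * B ≤ A * B + A' * B' := by
  have := exch h h'
  calc _ = _ := by ring
    _ ≤ _ := this
    _ = _ := by ring

/-- sorted version -/
theorem pw {A A' B B' k k' : ℝ≥0∞} (hk : k' ≤ k) :
    (A * B + A' * B') * k + (A * B' + A' * B) * k' ≤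
    (max A A' * max B B' + min A A' * min B B') * k +
    (max A A' * min B B' + min A A' * max B B') * k' := by
  rcases le_total A A' with h | h <;> rcases le_total B B' with h' | h'
  · simp only [max_eq_right h, max_eq_right h', min_eq_left h, min_eq_left h']
    apply le_of_eq; ring
  · simp only [max_eq_right h, max_eq_left h', min_eq_left h, min_eq_right h']
    have := exch (exch2 h h') hk
    calc _ = (A * B + A' * B') * k + (A * B' + A' * B) * k' := by ring
      _ ≤ _ := this
      _ = _ := by ring
  · simp only [max_eq_left h, max_eq_right h', min_eq_right h, min_eq_left h']
    have := exch (exch2 h h') hk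
    calc _ = (A' * B' + A * B) * k + (A' * B + A * B') * k' := by ring
      _ ≤ _ := this
      _ = _ := by ring
  · simp only [max_eq_left h, max_eq_left h', min_eq_right h, min_eq_right h']
    apply le_of_eq; ring

theorem tr_tr {μ : ℝ} {a : EE n} {r : ℝ} (hr : r ≠ 0) {f : EE n → ℝ≥0∞} {x : EE n} (hx : x ≠ a) :
    tr μ a r (tr μ a r f) x = f x := by
  have hj := jj_pos hr hx
  have h0 : ENNReal.ofReal (jj a r x) ≠ 0 := by simpa using hj
  have h2 : ENNReal.ofReal (jj a r x) ^ (n - μ / 2 : ℝ) ≠ 0 := by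
    simp [ENNReal.rpow_eq_zero_iff, h0]
  have h3 : ENNReal.ofReal (jj a r x) ^ (n - μ / 2 : ℝ) ≠ ⊤ := by
    simp [ENNReal.rpow_eq_top_iff, h0]
  rw [tr, tr, inversion_inversion a hr, jj_inv hr hx, ENNReal.ofReal_inv_of_pos hj, ENNReal.inv_rpow,
    ← mul_assoc, ENNReal.mul_inv_cancel h2 h3, one_mul]

theorem mem_HH_inv {a : EE n} {r : ℝ} (hr : r ≠ 0) {x : EE n} (hx : x ≠ a) :
    inversion a r x ∈ HH a r ↔ (‖x - a‖ ^ 2 - r ^ 2) * (1 + ‖a‖ ^ 2 - r ^ 2) < 0 := by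
  have h0 : 0 < ‖x - a‖ := norm_pos_iff.2 (sub_ne_zero.2 hx)
  rw [HH, mem_ofPred_eq, norm_inv_sub_sq hx]
  have : (r ^ 4 / ‖x - a‖ ^ 2 - r ^ 2) * (1 + ‖a‖ ^ 2 - r ^ 2) =
    (r ^ 2 / ‖x - a‖ ^ 2) * -((‖x - a‖ ^ 2 - r ^ 2) * (1 + ‖a‖ ^ 2 - r ^ 2)) := by
    field_simp; ring
  rw [this, mul_pos_iff_of_pos_left (by positivity)]
  constructor <;> intro h <;> linarith

theorem tr_pol {μ : ℝ} {a : EE n} {r : ℝ} (hr : r ≠ 0) (hs : 1 + ‖a‖ ^ 2 ≠ r ^ 2)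
    {f : EE n → ℝ≥0∞} {x : EE n} (hx : x ≠ a) :
    (x ∈ HH a r → tr μ a r (pol μ a r f) x = min (f x) (tr μ a r f x)) ∧
    (x ∉ HH a r → tr μ a r (pol μ a r f) x = max (f x) (tr μ a r f x)) := by
  have hm : ∀ c A B : ℝ≥0∞, c * min A B = min (c * A) (c * B) := fun c A B =>
    (mul_right_mono (a := c)).map_min
  have hm' : ∀ c A B : ℝ≥0∞, c * max A B = max (c * A) (c * B) := fun c A B =>
    (mul_right_mono (a := c)).map_max
  have h2 : ENNReal.ofReal (jj a r x) ^ (n - μ / 2 : ℝ) * tr μ a r f (inversion a r x) = f x :=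
    tr_tr (μ := μ) hr hx
  constructor
  · intro h
    have : inversion a r x ∉ HH a r := by
      rw [mem_HH_inv hr hx]; exact not_lt.2 (le_of_lt h)
    rw [tr, pol, if_neg this, hm, h2, min_comm]; rfl
  · intro h
    rcases (nmem_HH.1 h).lt_or_eq with h' | h'
    · have : inversion a r x ∈ HH a r := by rwa [mem_HH_inv hr hx]
      rw [tr, pol, if_pos this, hm', h2, max_comm]; rfl
    · have h5 : ‖x - a‖ ^ 2 = r ^ 2 := by
        rcases mul_eq_zero.1 h' with h | h
        · linarith
        · exact absurd (by linarith) hs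
      have h6 : jj a r x = 1 := by rw [jj, h5]; field_simp
      have h7 : inversion a r x = x := by
        have := inv_sub a r x
        rw [h6, one_smul] at this
        exact sub_left_injective this
      have h8 : ∀ g : EE n → ℝ≥0∞, tr μ a r g x = g x := by
        intro g; simp [tr, h6, h7]
      rw [h8, h8, pol, if_neg h, h8]; simp

theorem QQ_pol [NeZero n] {μ : ℝ} (hμ : 0 < μ) (a : EE n) {r : ℝ} (hr : r ≠ 0)
    (hs : 1 + ‖a‖ ^ 2 ≠ r ^ 2) {f : EE n → ℝ≥0∞} (hf : Measurable f) :
    QQ μ f f ≤ QQ μ (pol μ a r f) (pol μ a r f) := by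
  have h4 : (4 : ℝ≥0∞) * QQ μ f f ≤ 4 * QQ μ (pol μ a r f) (pol μ a r f) := by
    rw [QQ_four hμ a hr hf, QQ_four hμ a hr (measurable_pol μ a r hf)]
    refine lintegral_mono_ae ?_
    filter_upwards [ae_ne a] with x hx
    refine lintegral_mono_ae ?_
    filter_upwards [ae_ne a] with y hy
    obtain ⟨x1, x2⟩ := tr_pol (μ := μ) hr hs (f := f) hx
    obtain ⟨y1, y2⟩ := tr_pol (μ := μ) hr hs (f := f) hy
    have hsub := DD_sub (a := a) hr x y
    have hr2 : 0 < r ^ 2 := by positivity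
    have key1 : 0 ≤ (‖x - a‖ ^ 2 - r ^ 2) * (‖y - a‖ ^ 2 - r ^ 2) → kap' μ a r x y ≤ kap μ x y := by
      intro h
      apply rpow_anti (by positivity)
      apply ENNReal.ofReal_le_ofReal
      have : 0 ≤ (‖x - a‖ ^ 2 - r ^ 2) * (‖y - a‖ ^ 2 - r ^ 2) / r ^ 2 := by positivity
      linarith
    have key2 : (‖x - a‖ ^ 2 - r ^ 2) * (‖y - a‖ ^ 2 - r ^ 2) ≤ 0 → kap μ x y ≤ kap' μ a r x y := by
      intro h
      apply rpow_anti (by positivity)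
      apply ENNReal.ofReal_le_ofReal
      have : (‖x - a‖ ^ 2 - r ^ 2) * (‖y - a‖ ^ 2 - r ^ 2) / r ^ 2 ≤ 0 :=
        div_nonpos_of_nonpos_of_nonneg h hr2.le
      linarith
    have hs2 : 0 < (1 + ‖a‖ ^ 2 - r ^ 2) ^ 2 := by
      have : 1 + ‖a‖ ^ 2 - r ^ 2 ≠ 0 := sub_ne_zero.2 hs
      positivity
    set X := ‖x - a‖ ^ 2 - r ^ 2
    set Y := ‖y - a‖ ^ 2 - r ^ 2
    set s := 1 + ‖a‖ ^ 2 - r ^ 2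
    have hXY : X * Y * s ^ 2 = (X * s) * (Y * s) := by ring
    by_cases hxH : x ∈ HH a r <;> by_cases hyH : y ∈ HH a r
    · have hk := key1 (by
        have := mul_pos (mem_HH.1 hxH) (mem_HH.1 hyH)
        by_contra hc
        nlinarith)
      rw [x1 hxH, y1 hyH, pol, if_pos hxH, pol, if_pos hyH]
      exact pw hk
    · have hk := key2 (by
        have h1 : 0 < X * s := mem_HH.1 hxH
        have h2 : Y * s ≤ 0 := nmem_HH.1 hyH
        have := mul_nonpos_of_nonneg_of_nonpos h1.le h2
        by_contra hc
        nlinarith)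
      rw [x1 hxH, y2 hyH, pol, if_pos hxH, pol, if_neg hyH, add_comm, add_comm
        ((max (f x) (tr μ a r f x) * _ + _) * kap μ x y)]
      have := pw (A := f x) (A' := tr μ a r f x) (B := tr μ a r f y) (B' := f y) hk
      rwa [max_comm (tr μ a r f y), min_comm (tr μ a r f y)] at this
    · have hk := key2 (by
        have h1 : 0 < Y * s := mem_HH.1 hyH
        have h2 : X * s ≤ 0 := nmem_HH.1 hxH
        have := mul_nonpos_of_nonneg_of_nonpos h1.le h2
        by_contra hc
        nlinarith)
      rw [x2 hxH, y1 hyH, pol, if_neg hxH, pol, if_pos hyH]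
      have := pw (A := f x) (A' := tr μ a r f x) (B := tr μ a r f y) (B' := f y) hk
      rw [max_comm (tr μ a r f y), min_comm (tr μ a r f y)] at this
      calc _ = _ := by ring
        _ ≤ _ := this
        _ = _ := by ring
    · have hk := key1 (by
        have h1 : Y * s ≤ 0 := nmem_HH.1 hyH
        have h2 : X * s ≤ 0 := nmem_HH.1 hxH
        have := mul_nonneg_of_nonpos_of_nonpos h2 h1
        by_contra hc
        nlinarith)
      rw [x2 hxH, y2 hyH, pol, if_neg hxH, pol, if_neg hyH]
      calc _ ≤ _ := pw hk
        _ = _ := by ring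
  exact (ENNReal.mul_le_mul_iff_right (by norm_num) (by norm_num)).1 h4

end HLS

namespace HLS
open EuclideanGeometry Set Filter Topology
variable {n : ℕ}

noncomputable def hh (μ : ℝ) (x : EE n) : ℝ≥0∞ := ENNReal.ofReal (ww x) ^ (n - μ / 2 : ℝ)

@[fun_prop] theorem measurable_hh (μ : ℝ) : Measurable (hh μ : EE n → ℝ≥0∞) := by
  unfold hh; have := measurable_ww (n := n); fun_prop

theorem rat_lt {a : EE n} {r : ℝ} (hr : r ≠ 0) {x : EE n} (hx : x ≠ a) (h : x ∈ HH a r) :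
    ww (inversion a r x) * jj a r x < ww x := by
  have h1 := ww_inv hr hx
  have h2 : 0 < (‖x - a‖ ^ 2 - r ^ 2) * (1 + ‖a‖ ^ 2 - r ^ 2) / r ^ 2 := by
    have := mem_HH.1 h; positivity
  have h3 : 0 < ww (inversion a r x) * jj a r x := mul_pos (ww_pos _) (jj_pos hr hx)
  rw [← inv_lt_inv₀ (ww_pos x) h3]; linarith

theorem rat_ge {a : EE n} {r : ℝ} (hr : r ≠ 0) {x : EE n} (hx : x ≠ a) (h : x ∉ HH a r) :
    ww x ≤ ww (inversion a r x) * jj a r x := by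
  have h1 := ww_inv hr hx
  have h2 : (‖x - a‖ ^ 2 - r ^ 2) * (1 + ‖a‖ ^ 2 - r ^ 2) / r ^ 2 ≤ 0 :=
    div_nonpos_of_nonpos_of_nonneg (nmem_HH.1 h) (by positivity)
  have h3 : 0 < ww (inversion a r x) * jj a r x := mul_pos (ww_pos _) (jj_pos hr hx)
  rw [← inv_le_inv₀ h3 (ww_pos x)]; linarith

theorem rat_eq {a : EE n} {r : ℝ} (hr : r ≠ 0) (hs : 1 + ‖a‖ ^ 2 = r ^ 2) {x : EE n} (hx : x ≠ a) :
    ww (inversion a r x) * jj a r x = ww x := by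
  have h1 := ww_inv hr hx
  rw [hs, sub_self, mul_zero, zero_div, add_zero] at h1
  exact inv_injective h1

theorem om'_lt {μ : ℝ} (hμ : 0 < μ) {a : EE n} {r : ℝ} (hr : r ≠ 0) {x : EE n} (hx : x ≠ a)
    (h : x ∈ HH a r) : om' μ a r x < om μ x := by
  apply ENNReal.rpow_lt_rpow _ (by positivity)
  exact (ENNReal.ofReal_lt_ofReal_iff (ww_pos x)).2 (rat_lt hr hx h)

theorem om'_ge {μ : ℝ} (hμ : 0 < μ) {a : EE n} {r : ℝ} (hr : r ≠ 0) {x : EE n} (hx : x ≠ a)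
    (h : x ∉ HH a r) : om μ x ≤ om' μ a r x := by
  apply ENNReal.rpow_le_rpow _ (by positivity)
  exact ENNReal.ofReal_le_ofReal (rat_ge hr hx h)

theorem om_ne_top (μ : ℝ) (x : EE n) : om μ x ≠ ⊤ := by
  have := ww_pos x
  simp [om, ENNReal.rpow_eq_top_iff, this]

theorem hh_ne_top (μ : ℝ) (x : EE n) : hh μ x ≠ ⊤ := by
  have := ww_pos x
  simp [hh, ENNReal.rpow_eq_top_iff, this]

theorem tr_self (μ : ℝ) (hμn : μ / 2 < n) (a : EE n) (r : ℝ) (f : EE n → ℝ≥0∞) : tr μ a r f a = 0 := by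
  simp [tr, jj, hμn]

theorem tr_le {μ : ℝ} (hμn : μ / 2 < n) {a : EE n} {r : ℝ} (hr : r ≠ 0)
    {M : ℝ≥0∞} {f : EE n → ℝ≥0∞} (hf : ∀ x, f x ≤ M * hh μ x) {x : EE n} (h : x ∈ HH a r) :
    tr μ a r f x ≤ M * hh μ x := by
  by_cases hx : x = a
  · rw [hx, tr_self μ hμn]; exact bot_le
  have hj := jj_pos hr hx
  calc tr μ a r f x ≤ ENNReal.ofReal (jj a r x) ^ (n - μ / 2 : ℝ) * (M * hh μ (inversion a r x)) := by
        unfold tr; gcongr; exact hf _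
    _ = M * (ENNReal.ofReal (ww (inversion a r x) * jj a r x) ^ (n - μ / 2 : ℝ)) := by
        rw [ENNReal.ofReal_mul (ww_pos _).le, ENNReal.mul_rpow_of_nonneg _ _ (by linarith), hh]; ring
    _ ≤ _ := by
        unfold hh; gcongr
        exact (rat_lt hr hx h).le

theorem pol_le {μ : ℝ} (hμn : μ / 2 < n) {a : EE n} {r : ℝ} (hr : r ≠ 0)
    {M : ℝ≥0∞} {f : EE n → ℝ≥0∞} (hf : ∀ x, f x ≤ M * hh μ x) (x : EE n) :
    pol μ a r f x ≤ M * hh μ x := by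
  by_cases h : x ∈ HH a r
  · rw [pol, if_pos h]; exact max_le (hf x) (tr_le hμn hr hf h)
  · rw [pol, if_neg h]; exact (min_le_left _ _).trans (hf x)

theorem lint_tr [NeZero n] {μ p : ℝ} (hp : 0 < p) (hpα : (n - μ / 2) * p = n) (a : EE n) {r : ℝ}
    (hr : r ≠ 0) (f : EE n → ℝ≥0∞) : ∫⁻ x, tr μ a r f x ^ p = ∫⁻ x, f x ^ p := by
  rw [lintegral_inv a hr (fun x => f x ^ p)]
  refine lintegral_congr fun x => ?_
  rw [tr, ENNReal.mul_rpow_of_nonneg _ _ hp.le, ← ENNReal.rpow_mul, hpα]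

theorem lint_pol [NeZero n] {μ p : ℝ} (hp : 0 < p) (hpα : (n - μ / 2) * p = n) (a : EE n) {r : ℝ}
    (hr : r ≠ 0) (hs : 1 + ‖a‖ ^ 2 ≠ r ^ 2) {f : EE n → ℝ≥0∞} (hf : Measurable f) :
    ∫⁻ x, pol μ a r f x ^ p = ∫⁻ x, f x ^ p := by
  have h2 : 2 * ∫⁻ x, pol μ a r f x ^ p = 2 * ∫⁻ x, f x ^ p := by
    rw [two_mul, two_mul]
    nth_rewrite 2 [← lint_tr hp hpα a hr]
    nth_rewrite 4 [← lint_tr hp hpα a hr]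
    rw [← lintegral_add_left (by fun_prop), ← lintegral_add_left (by fun_prop)]
    refine lintegral_congr_ae ?_
    filter_upwards [ae_ne a] with x hx
    obtain ⟨x1, x2⟩ := tr_pol (μ := μ) hr hs (f := f) hx
    by_cases h : x ∈ HH a r
    · rw [x1 h, pol, if_pos h]
      rcases le_total (f x) (tr μ a r f x) with h' | h' <;> simp [h', add_comm]
    · rw [x2 h, pol, if_neg h]
      rcases le_total (f x) (tr μ a r f x) with h' | h' <;> simp [h', add_comm]
  exact (ENNReal.mul_right_inj (by norm_num) (by norm_num)).1 h2

theorem lint_om [NeZero n] {μ : ℝ} (hμ : 0 < μ) (a : EE n) {r : ℝ} (hr : r ≠ 0)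
    (f g : EE n → ℝ≥0∞) :
    ∫⁻ x, f x * (g x * om μ x) = ∫⁻ x, tr μ a r f x * (g (inversion a r x) * om' μ a r x) := by
  rw [lintegral_inv a hr]
  refine lintegral_congr_ae ?_
  filter_upwards [ae_ne a] with x hx
  have hj := jj_pos hr hx
  rw [tr, om, om', ENNReal.ofReal_mul (ww_pos _).le, ENNReal.mul_rpow_of_nonneg _ _ (by positivity),
    show (n : ℝ) = (n - μ / 2) + μ / 2 by ring, ofReal_rpow_add hj]
  ring_nf

noncomputable def gap (μ : ℝ) (a : EE n) (r : ℝ) (f : EE n → ℝ≥0∞) : ℝ≥0∞ :=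
  ∫⁻ x in HH a r, (tr μ a r f x - f x) * (om μ x - om' μ a r x)

theorem LL_pol [NeZero n] {μ : ℝ} (hμ : 0 < μ) (a : EE n) {r : ℝ}
    (hr : r ≠ 0) (hs : 1 + ‖a‖ ^ 2 ≠ r ^ 2) {f : EE n → ℝ≥0∞} (hf : Measurable f) :
    2 * LL μ f + gap μ a r f ≤ 2 * LL μ (pol μ a r f) := by
  have e : ∀ g : EE n → ℝ≥0∞, Measurable g →
      2 * LL μ g = ∫⁻ x, (g x * om μ x + tr μ a r g x * om' μ a r x) := by
    intro g hg
    have := lint_om hμ a hr g (fun _ => 1)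
    simp only [one_mul] at this
    rw [lintegral_add_left (by fun_prop), ← this, two_mul]; rfl
  rw [e f hf, e _ (by fun_prop), gap, ← lintegral_indicator (measurableSet_HH a r),
    ← lintegral_add_left (by fun_prop)]
  refine lintegral_mono_ae ?_
  filter_upwards [ae_ne a] with x hx
  obtain ⟨x1, x2⟩ := tr_pol (μ := μ) hr hs (f := f) hx
  by_cases h : x ∈ HH a r
  · rw [indicator_of_mem h, x1 h, pol, if_pos h]
    have ho := (om'_lt hμ hr hx h).le
    rcases le_total (f x) (tr μ a r f x) with h' | h'
    · rw [max_eq_right h', min_eq_left h']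
      obtain ⟨e, he⟩ := exists_add_of_le h'
      obtain ⟨d, hd⟩ := exists_add_of_le ho
      rw [he, hd]
      calc _ ≤ f x * (om' μ a r x + d) + (f x + e) * om' μ a r x + e * d := by
            gcongr
            · exact tsub_le_iff_left.2 le_rfl
            · exact tsub_le_iff_left.2 le_rfl
        _ = _ := by ring
    · rw [max_eq_left h', min_eq_right h', tsub_eq_zero_of_le h']; simp
  · rw [indicator_of_notMem h, x2 h, pol, if_neg h, add_zero]
    have ho := (om'_ge hμ hr hx h)
    rcases le_total (f x) (tr μ a r f x) with h' | h'
    · rw [max_eq_right h', min_eq_left h']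
    · rw [max_eq_left h', min_eq_right h']
      have := exch h' ho
      calc _ = _ := add_comm _ _
        _ ≤ _ := this
        _ = _ := add_comm _ _

noncomputable def II (n : ℕ) : ℝ≥0∞ := ∫⁻ x : EE n, ENNReal.ofReal (ww x) ^ (n : ℝ)

theorem hh_om (μ : ℝ) (x : EE n) : hh μ x * om μ x = ENNReal.ofReal (ww x) ^ (n : ℝ) := by
  rw [hh, om, ← ofReal_rpow_add (ww_pos x)]; ring_nf

theorem ww_rpow_int {s : ℝ} (hs : n < 2 * s) :
    Integrable (fun x : EE n => ww x ^ s) := by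
  have := integrable_rpow_neg_one_add_norm_sq (E := EE n) (μ := volume) (r := 2 * s) (by simpa using hs)
  refine this.congr (Eventually.of_forall fun x => ?_)
  simp only [ww]
  rw [Real.inv_rpow (by positivity), ← Real.rpow_neg (by positivity)]
  ring_nf

theorem ww_rpow_lint {s : ℝ} (hs : n < 2 * s) :
    ∫⁻ x : EE n, ENNReal.ofReal (ww x) ^ s < ⊤ := by
  have := (ww_rpow_int hs).lintegral_lt_top
  convert this using 3 with x
  rw [ENNReal.ofReal_rpow_of_pos (ww_pos x)]

theorem II_lt_top [NeZero n] : II n < ⊤ := by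
  apply ww_rpow_lint
  have : (0:ℝ) < n := by exact_mod_cast Nat.pos_of_ne_zero (NeZero.ne n)
  linarith

/-- the gap controls bounded weights -/
theorem gap_weak [NeZero n] {μ : ℝ} (hμ : 0 < μ) (hμn : μ / 2 < n) {a : EE n} {r : ℝ}
    (hr : r ≠ 0) {M N : ℝ≥0∞} (hM : M ≠ ⊤) (hN : N ≠ ⊤) {f : ℕ → EE n → ℝ≥0∞}
    (hfm : ∀ k, Measurable (f k)) (hf : ∀ k x, f k x ≤ M * hh μ x)
    (hg : Tendsto (fun k => gap μ a r (f k)) atTop (𝓝 0))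
    {φ : EE n → ℝ≥0∞} (hφ : Measurable φ) (hφN : ∀ x, φ x ≤ N) :
    Tendsto (fun k => ∫⁻ x in HH a r, (tr μ a r (f k) x - f k x) * (φ x * om μ x)) atTop (𝓝 0) := by
  have hI := II_lt_top (n := n)
  -- the tail
  have htail : Tendsto (fun m : ℕ => ∫⁻ x in HH a r,
      M * hh μ x * (φ x * om μ x - m * (om μ x - om' μ a r x))) atTop (𝓝 0) := by
    have : Tendsto (fun m : ℕ => ∫⁻ x in HH a r,
      M * hh μ x * (φ x * om μ x - m * (om μ x - om' μ a r x))) atTop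
        (𝓝 (∫⁻ x in HH a r, 0)) := by
      refine tendsto_lintegral_of_dominated_convergence
        (fun x => M * N * (ENNReal.ofReal (ww x) ^ (n : ℝ))) (fun m => by fun_prop) ?_ ?_ ?_
      · intro m
        refine Eventually.of_forall fun x => ?_
        beta_reduce
        rw [← hh_om μ x]
        calc M * hh μ x * (φ x * om μ x - m * (om μ x - om' μ a r x)) ≤
            M * hh μ x * (N * om μ x) := by
              gcongr; exact tsub_le_self.trans (by gcongr; exact hφN x)
          _ = _ := by ring
      · rw [lintegral_const_mul' _ _ (ENNReal.mul_ne_top hM hN)]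
        refine ENNReal.mul_ne_top (ENNReal.mul_ne_top hM hN) (ne_top_of_le_ne_top hI.ne ?_)
        exact setLIntegral_le_lintegral _ _
      · rw [ae_restrict_iff' (measurableSet_HH a r)]
        filter_upwards [ae_ne a] with x hx hxH
        have hlt := om'_lt hμ hr hx hxH
        have hd : om μ x - om' μ a r x ≠ 0 := (tsub_pos_of_lt hlt).ne'
        obtain ⟨m0, hm0⟩ := ENNReal.exists_nat_mul_gt hd
          (ENNReal.mul_ne_top (ne_top_of_le_ne_top hN (hφN x)) (om_ne_top μ x))
        refine tendsto_const_nhds.congr' ?_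
        filter_upwards [eventually_ge_atTop m0] with m hm
        rw [tsub_eq_zero_of_le, mul_zero]
        refine hm0.le.trans ?_
        gcongr
    simpa using this
  rw [ENNReal.tendsto_nhds_zero] at htail ⊢
  intro ε hε
  have hε2 : 0 < ε / 2 := ENNReal.half_pos hε.ne'
  obtain ⟨m, hm⟩ := (htail _ hε2).exists
  have hg2 : Tendsto (fun k => (m : ℝ≥0∞) * gap μ a r (f k)) atTop (𝓝 0) := by
    have := ENNReal.Tendsto.const_mul hg (a := (m : ℝ≥0∞)) (Or.inr (by simp))
    simpa using this
  rw [ENNReal.tendsto_nhds_zero] at hg2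
  filter_upwards [hg2 _ hε2] with k hk
  calc ∫⁻ x in HH a r, (tr μ a r (f k) x - f k x) * (φ x * om μ x)
      ≤ ∫⁻ x in HH a r, (m * ((tr μ a r (f k) x - f k x) * (om μ x - om' μ a r x)) +
          M * hh μ x * (φ x * om μ x - m * (om μ x - om' μ a r x))) := by
        refine setLIntegral_mono (by fun_prop) fun x hxH => ?_
        set d := om μ x - om' μ a r x
        have h1 : φ x * om μ x ≤ m * d + (φ x * om μ x - m * d) := le_add_tsub
        calc _ ≤ (tr μ a r (f k) x - f k x) * (m * d + (φ x * om μ x - m * d)) := by gcongr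
          _ = m * ((tr μ a r (f k) x - f k x) * d) +
              (tr μ a r (f k) x - f k x) * (φ x * om μ x - m * d) := by ring
          _ ≤ _ := by
            gcongr
            exact tsub_le_self.trans (tr_le hμn hr (hf k) hxH)
    _ = m * gap μ a r (f k) + ∫⁻ x in HH a r,
          M * hh μ x * (φ x * om μ x - m * (om μ x - om' μ a r x)) := by
        rw [lintegral_add_left (by fun_prop), lintegral_const_mul _ (by fun_prop), gap]
    _ ≤ ε / 2 + ε / 2 := add_le_add hk hm
    _ = ε := ENNReal.add_halves ε

end HLS

namespace HLS
open EuclideanGeometry Set Filter Topology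
variable {n : ℕ}

theorem ww_cont : Continuous (ww (n := n)) := by
  unfold ww
  exact Continuous.inv₀ (by fun_prop) (fun x => by positivity)

theorem om'_zero {μ : ℝ} {a : EE n} {r : ℝ} (hr : r ≠ 0) (hs : 1 + ‖a‖ ^ 2 = r ^ 2) {x : EE n}
    (hx : x ≠ a) : om' μ a r x = om μ x := by
  rw [om', rat_eq hr hs hx, om]

theorem ae_sphere [NeZero n] (a : EE n) (s : ℝ) (hs : 0 < s) : ∀ᵐ x : EE n, ‖x - a‖ ^ 2 - s ≠ 0 := by
  have : volume (Metric.sphere a (√s)) = 0 := Measure.addHaar_sphere_of_ne_zero _ a (by positivity)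
  rw [ae_iff]
  refine measure_mono_null (fun x hx => ?_) this
  have hx : ‖x - a‖ ^ 2 - s = 0 := by simpa using hx
  rw [mem_sphere_iff_norm, show s = ‖x - a‖ ^ 2 by linarith, Real.sqrt_sq (norm_nonneg _)]

theorem gap_om {μ : ℝ} [NeZero n] (hμ : 0 < μ) (a : EE n) {r : ℝ} (hr : r ≠ 0)
    {f φ : EE n → ℝ≥0∞} (hf : Measurable f) (hφ : Measurable φ) :
    ∫⁻ x, f x * ((HH a r).indicator φ (inversion a r x) * om' μ a r x) ≤
      (∫⁻ x, f x * ((HH a r).indicator φ x * om μ x)) +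
      ∫⁻ x in HH a r, (tr μ a r f x - f x) * (φ x * om μ x) := by
  have h1 := lint_om hμ a hr (tr μ a r f) ((HH a r).indicator φ)
  have h2 : ∫⁻ x, tr μ a r (tr μ a r f) x * ((HH a r).indicator φ (inversion a r x) * om' μ a r x) =
      ∫⁻ x, f x * ((HH a r).indicator φ (inversion a r x) * om' μ a r x) := by
    refine lintegral_congr_ae ?_
    filter_upwards [ae_ne a] with x hx
    rw [tr_tr hr hx]
  have hi : Measurable ((HH a r).indicator φ) := hφ.indicator (measurableSet_HH a r)
  rw [← h2, ← h1, ← lintegral_indicator (measurableSet_HH a r), ← lintegral_add_left (by fun_prop)]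
  refine lintegral_mono fun x => ?_
  by_cases h : x ∈ HH a r
  · simp only [indicator_of_mem h]
    rw [← add_mul]; gcongr; exact le_add_tsub
  · simp [indicator_of_notMem h]

theorem hh_om_dom [NeZero n] {μ : ℝ} {M N : ℝ≥0∞} (hM : M ≠ ⊤) (hN : N ≠ ⊤) :
    ∫⁻ x : EE n, M * hh μ x * (N * om μ x) ≠ ⊤ := by
  have : ∀ x : EE n, M * hh μ x * (N * om μ x) = (M * N) * ENNReal.ofReal (ww x) ^ (n : ℝ) := by
    intro x; rw [← hh_om μ x]; ring
  simp_rw [this]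
  rw [lintegral_const_mul' _ _ (ENNReal.mul_ne_top hM hN)]
  exact ENNReal.mul_ne_top (ENNReal.mul_ne_top hM hN) II_lt_top.ne

theorem weak_c [NeZero n] {μ : ℝ} (hμ : 0 < μ) (hμn : μ / 2 < n) {a : EE n} {c : ℝ} (hc : c ^ 2 = 1)
    {M N : ℝ≥0∞} (hM : M ≠ ⊤) (hN : N ≠ ⊤) {f : ℕ → EE n → ℝ≥0∞}
    (hfm : ∀ k, Measurable (f k)) (hf : ∀ k x, f k x ≤ M * hh μ x)
    (hg : ∀ r : ℝ, r ≠ 0 → 1 + ‖a‖ ^ 2 ≠ r ^ 2 → Tendsto (fun k => gap μ a r (f k)) atTop (𝓝 0))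
    {φ : EE n → ℝ≥0∞} (hφ : Continuous φ) (hφN : ∀ x, φ x ≤ N) :
    Tendsto (fun k => (∫⁻ x, f k x * ({x | c * (‖x - a‖ ^ 2 - (1 + ‖a‖ ^ 2)) < 0}.indicator
        (fun x => φ (inversion a (√(1 + ‖a‖ ^ 2)) x) * om μ x) x)) -
        ∫⁻ x, f k x * ({x | 0 < c * (‖x - a‖ ^ 2 - (1 + ‖a‖ ^ 2))}.indicator φ x * om μ x))
      atTop (𝓝 0) := by
  set s := 1 + ‖a‖ ^ 2 with hs
  have hs0 : 0 < s := by positivity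
  set τ : ℕ → ℝ := fun m => s / (m + 2) with hτ
  have hτ0 : ∀ m, 0 < τ m := fun m => by simp only [hτ]; positivity
  have hτs : ∀ m, τ m < s := fun m => by
    simp only [hτ]; rw [div_lt_iff₀ (by positivity)]; nlinarith [(Nat.cast_nonneg m : (0:ℝ) ≤ m)]
  have hτlim : Tendsto τ atTop (𝓝 0) := by
    have h := tendsto_const_div_atTop_nhds_zero_nat s
    have h2 := h.comp (tendsto_add_atTop_nat 2)
    refine h2.congr fun m => ?_
    simp [hτ]
  have hcabs : |c| = 1 := by
    rw [← abs_one, ← sq_eq_sq_iff_abs_eq_abs]; simpa using hc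
  have hcτ : ∀ m, c * τ m < s := fun m => by
    have := le_abs_self c
    nlinarith [hτ0 m, hτs m]
  set r : ℕ → ℝ := fun m => √(s - c * τ m) with hr
  have hr2 : ∀ m, r m ^ 2 = s - c * τ m := fun m => Real.sq_sqrt (by linarith [hcτ m])
  have hr0 : ∀ m, r m ≠ 0 := fun m => (Real.sqrt_pos.2 (by linarith [hcτ m])).ne'
  have hc0 : c ≠ 0 := by rintro rfl; norm_num at hc
  have hrs : ∀ m, s ≠ r m ^ 2 := fun m => by
    rw [hr2]; have := mul_ne_zero hc0 (hτ0 m).ne'; intro h; apply this; linarith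
  have hrlim : Tendsto r atTop (𝓝 (√s)) := by
    have h1 : Tendsto (fun m => s - c * τ m) atTop (𝓝 (s - c * 0)) := (hτlim.const_mul c).const_sub s
    have := h1.sqrt
    simpa using this
  have key : ∀ m (X : ℝ), (X - r m ^ 2) * (s - r m ^ 2) = τ m * (c * (X - s) + τ m) := by
    intro m X; rw [hr2]; linear_combination (τ m) ^ 2 * hc
  -- limits of A, B
  set A0 : EE n → ℝ≥0∞ := {x | c * (‖x - a‖ ^ 2 - s) < 0}.indicator
        (fun x => φ (inversion a (√s) x) * om μ x) with hA0
  set A : ℕ → EE n → ℝ≥0∞ := fun m x =>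
    (HH a (r m)).indicator φ (inversion a (r m) x) * om' μ a (r m) x with hA
  set B0 : EE n → ℝ≥0∞ := fun x => {x | 0 < c * (‖x - a‖ ^ 2 - s)}.indicator φ x * om μ x with hB0
  set B : ℕ → EE n → ℝ≥0∞ := fun m x => (HH a (r m)).indicator φ x * om μ x with hB
  have mA0 : Measurable A0 := by
    refine Measurable.indicator ?_ (measurableSet_lt (by fun_prop) (by fun_prop))
    have := measurable_inv a (√s)
    have := hφ.measurable
    fun_prop
  have mA : ∀ m, Measurable (A m) := fun m => by
    have h1 : Measurable ((HH a (r m)).indicator φ) := hφ.measurable.indicator (measurableSet_HH a _)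
    have := measurable_inv a (r m)
    simp only [hA]; fun_prop
  have mB0 : Measurable B0 := by
    have h1 : Measurable ({x : EE n | 0 < c * (‖x - a‖ ^ 2 - s)}.indicator φ) :=
      hφ.measurable.indicator (measurableSet_lt (by fun_prop) (by fun_prop))
    simp only [hB0]; fun_prop
  have mB : ∀ m, Measurable (B m) := fun m => by
    have h1 : Measurable ((HH a (r m)).indicator φ) := hφ.measurable.indicator (measurableSet_HH a _)
    simp only [hB]; fun_prop
  have A0N : ∀ x, A0 x ≤ N * om μ x := fun x => by
    refine indicator_le_self _ _ _ |>.trans ?_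
    gcongr; exact hφN _
  have BN : ∀ m x, B m x ≤ N * om μ x := fun m x => by
    simp only [hB]
    gcongr
    exact (indicator_le_self _ _ _).trans (hφN _)
  have B0N : ∀ x, B0 x ≤ N * om μ x := fun x => by
    simp only [hB0]
    gcongr
    exact (indicator_le_self _ _ _).trans (hφN _)
  have limA : ∀ᵐ x, Tendsto (fun m => A m x) atTop (𝓝 (A0 x)) := by
    filter_upwards [ae_ne a, ae_sphere a s hs0] with x hx hsp
    have hne : c * (‖x - a‖ ^ 2 - s) ≠ 0 := mul_ne_zero hc0 hsp
    have hev : ∀ᶠ m in atTop, (inversion a (r m) x ∈ HH a (r m) ↔ c * (‖x - a‖ ^ 2 - s) < 0) := by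
      have h1 : Tendsto (fun m => c * (‖x - a‖ ^ 2 - s) + τ m) atTop (𝓝 (c * (‖x - a‖ ^ 2 - s) + 0)) :=
        hτlim.const_add _
      rw [add_zero] at h1
      rcases lt_or_gt_of_ne hne with h | h
      · filter_upwards [h1.eventually_lt_const h] with m hm
        rw [mem_HH_inv (hr0 m) hx, ← hs, key]
        simp only [h, iff_true]
        exact mul_neg_of_pos_of_neg (hτ0 m) hm
      · filter_upwards [h1.eventually_const_lt h] with m hm
        rw [mem_HH_inv (hr0 m) hx, ← hs, key]
        simp only [h.not_gt, iff_false, not_lt]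
        exact (mul_pos (hτ0 m) hm).le
    by_cases h : c * (‖x - a‖ ^ 2 - s) < 0
    · have e0 : A0 x = φ (inversion a (√s) x) * om μ x := indicator_of_mem (show x ∈ {x | c * (‖x - a‖ ^ 2 - s) < 0} from h) _
      have hsq : √s ≠ 0 := by positivity
      rw [e0, ← om'_zero (a := a) (r := √s) hsq (by rw [Real.sq_sqrt hs0.le]) hx]
      have hl : Tendsto (fun m => φ (inversion a (r m) x) * om' μ a (r m) x) atTop
          (𝓝 (φ (inversion a (√s) x) * om' μ a (√s) x)) := by
        have hinv : Continuous (fun ρ : ℝ => inversion a ρ x) := by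
          simp_rw [inv_eq]; fun_prop
        refine ENNReal.Tendsto.mul (((hφ.comp hinv).tendsto _).comp hrlim) (Or.inr ?_) ?_ (Or.inr ?_)
        · rw [om'_zero hsq (by rw [Real.sq_sqrt hs0.le]) hx]; exact om_ne_top _ _
        · have : Continuous (fun ρ : ℝ => om' μ a ρ x) := by
            unfold om' jj
            have := ww_cont (n := n)
            refine ENNReal.continuous_rpow_const.comp (ENNReal.continuous_ofReal.comp ?_)
            fun_prop
          exact (this.tendsto _).comp hrlim
        · exact ne_top_of_le_ne_top hN (hφN _)
      refine hl.congr' ?_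
      filter_upwards [hev] with m hm
      simp only [hA]; rw [indicator_of_mem (hm.2 h)]
    · have e0 : A0 x = 0 := indicator_of_notMem (show x ∉ {x | c * (‖x - a‖ ^ 2 - s) < 0} from h) _
      rw [e0]
      refine tendsto_const_nhds.congr' ?_
      filter_upwards [hev] with m hm
      simp only [hA]; rw [indicator_of_notMem (fun h' => h (hm.1 h')), zero_mul]
  have limB : ∀ᵐ x, Tendsto (fun m => B m x) atTop (𝓝 (B0 x)) := by
    filter_upwards [ae_sphere a s hs0] with x hsp
    have hne : c * (‖x - a‖ ^ 2 - s) ≠ 0 := mul_ne_zero hc0 hsp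
    have h1 : Tendsto (fun m => c * (‖x - a‖ ^ 2 - s) + τ m) atTop (𝓝 (c * (‖x - a‖ ^ 2 - s) + 0)) :=
      hτlim.const_add _
    rw [add_zero] at h1
    refine tendsto_const_nhds.congr' ?_
    rcases lt_or_gt_of_ne hne with h | h
    · filter_upwards [h1.eventually_lt_const h] with m hm
      have : x ∉ HH a (r m) := by
        rw [nmem_HH, ← hs, key]; exact (mul_neg_of_pos_of_neg (hτ0 m) hm).le
      simp only [hB, hB0]
      rw [indicator_of_notMem this, indicator_of_notMem (show x ∉ {x | 0 < c * (‖x - a‖ ^ 2 - s)} from h.not_gt)]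
    · filter_upwards [h1.eventually_const_lt h] with m hm
      have : x ∈ HH a (r m) := by
        rw [mem_HH, ← hs, key]; exact (mul_pos (hτ0 m) hm)
      simp only [hB, hB0]
      rw [indicator_of_mem this, indicator_of_mem (show x ∈ {x | 0 < c * (‖x - a‖ ^ 2 - s)} from h)]
  have gen : ∀ P R : ℕ → EE n → ℝ≥0∞, (∀ m, Measurable (P m)) → (∀ m, Measurable (R m)) →
      (∀ m x, P m x ≤ N * om μ x) → (∀ᵐ x, Tendsto (fun m => P m x - R m x) atTop (𝓝 0)) →
      Tendsto (fun m => ∫⁻ x, M * hh μ x * (P m x - R m x)) atTop (𝓝 0) := by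
    intro P R mP mR hP hlim
    have : Tendsto (fun m => ∫⁻ x, M * hh μ x * (P m x - R m x)) atTop (𝓝 (∫⁻ x : EE n, 0)) := by
      refine tendsto_lintegral_of_dominated_convergence (fun x => M * hh μ x * (N * om μ x))
        (fun m => by have := mP m; have := mR m; fun_prop) ?_ (hh_om_dom hM hN) ?_
      · intro m
        refine Eventually.of_forall fun x => ?_
        beta_reduce
        gcongr
        exact tsub_le_self.trans (hP m x)
      · filter_upwards [hlim] with x hx
        have := ENNReal.Tendsto.const_mul hx (a := M * hh μ x) (Or.inr (ENNReal.mul_ne_top hM (hh_ne_top _ _)))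
        simpa using this
    simpa using this
  have fin : ∀ {Y : ℝ≥0∞} {x : EE n}, Y ≤ N * om μ x → Y ≠ ⊤ := fun h =>
    ne_top_of_le_ne_top (ENNReal.mul_ne_top hN (om_ne_top _ _)) h
  have EA := gen (fun _ => A0) A (fun _ => mA0) mA (fun _ => A0N) (by
    filter_upwards [limA] with x hx
    have := ENNReal.Tendsto.sub (tendsto_const_nhds (x := A0 x)) hx (Or.inl (fin (A0N x)))
    simpa using this)
  have EB := gen B (fun _ => B0) mB (fun _ => mB0) BN (by
    filter_upwards [limB] with x hx
    have := ENNReal.Tendsto.sub hx (tendsto_const_nhds (x := B0 x)) (Or.inl (fin (B0N x)))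
    simpa using this)
  rw [ENNReal.tendsto_nhds_zero] at EA EB ⊢
  intro ε hε
  have hε3 : 0 < ε / 3 := ENNReal.div_pos hε.ne' (by norm_num)
  obtain ⟨m, hmA, hmB⟩ := ((EA _ hε3).and (EB _ hε3)).exists
  have hw := gap_weak hμ hμn (hr0 m) hM hN hfm hf (hg (r m) (hr0 m) (hrs m)) hφ.measurable hφN
  rw [ENNReal.tendsto_nhds_zero] at hw
  filter_upwards [hw _ hε3] with k hk
  rw [tsub_le_iff_left]
  have mfk := hfm k
  have mAm := mA m
  have mBm := mB m
  have step : ∀ P R : EE n → ℝ≥0∞, Measurable P → Measurable R →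
      ∫⁻ x, f k x * P x ≤ (∫⁻ x, f k x * R x) + ∫⁻ x, M * hh μ x * (P x - R x) := by
    intro P R mP mR
    rw [← lintegral_add_left (by fun_prop)]
    refine lintegral_mono fun x => ?_
    calc f k x * P x ≤ f k x * (R x + (P x - R x)) := by gcongr; exact le_add_tsub
      _ = f k x * R x + f k x * (P x - R x) := mul_add _ _ _
      _ ≤ _ := by gcongr; exact hf k x
  calc _ ≤ (∫⁻ x, f k x * A m x) + ε / 3 := (step A0 (A m) mA0 mAm).trans (by gcongr)
    _ ≤ ((∫⁻ x, f k x * B m x) + ε / 3) + ε / 3 := by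
        gcongr
        exact (gap_om hμ a (hr0 m) mfk hφ.measurable).trans (by gcongr)
    _ ≤ (((∫⁻ x, f k x * B0 x) + ε / 3) + ε / 3) + ε / 3 := by
        gcongr
        exact (step (B m) B0 mBm mB0).trans (by gcongr)
    _ = (∫⁻ x, f k x * B0 x) + ε := by
        rw [add_assoc, add_assoc, ← add_assoc (ε/3), ENNReal.add_thirds]

theorem weak_inv [NeZero n] {μ : ℝ} (hμ : 0 < μ) (hμn : μ / 2 < n) {a : EE n}
    {M N : ℝ≥0∞} (hM : M ≠ ⊤) (hN : N ≠ ⊤) {f : ℕ → EE n → ℝ≥0∞}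
    (hfm : ∀ k, Measurable (f k)) (hf : ∀ k x, f k x ≤ M * hh μ x)
    (hg : ∀ r : ℝ, r ≠ 0 → 1 + ‖a‖ ^ 2 ≠ r ^ 2 → Tendsto (fun k => gap μ a r (f k)) atTop (𝓝 0))
    {φ : EE n → ℝ≥0∞} (hφ : Continuous φ) (hφN : ∀ x, φ x ≤ N) :
    Tendsto (fun k => (∫⁻ x, f k x * (φ (inversion a (√(1 + ‖a‖ ^ 2)) x) * om μ x)) -
        ∫⁻ x, f k x * (φ x * om μ x)) atTop (𝓝 0) := by
  have h1 := weak_c hμ hμn (a := a) (c := 1) (by norm_num) hM hN hfm hf hg hφ hφN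
  have h2 := weak_c hμ hμn (a := a) (c := -1) (by norm_num) hM hN hfm hf hg hφ hφN
  have h3 := h1.add h2
  rw [add_zero] at h3
  refine tendsto_of_tendsto_of_tendsto_of_le_of_le tendsto_const_nhds h3 (fun _ => bot_le) ?_
  intro k
  set s := 1 + ‖a‖ ^ 2 with hs
  have hs0 : 0 < s := by positivity
  have hfk := hfm k
  have hφm := hφ.measurable
  have hi := measurable_inv a (√s)
  have e1 : ∫⁻ x, f k x * (φ (inversion a (√s) x) * om μ x) =
      (∫⁻ x, f k x * ({x | 1 * (‖x - a‖ ^ 2 - s) < 0}.indicator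
        (fun x => φ (inversion a (√s) x) * om μ x) x)) +
      ∫⁻ x, f k x * ({x | (-1) * (‖x - a‖ ^ 2 - s) < 0}.indicator
        (fun x => φ (inversion a (√s) x) * om μ x) x) := by
    rw [← lintegral_add_left]
    · refine lintegral_congr_ae ?_
      filter_upwards [ae_sphere a s hs0] with x hx
      rcases lt_or_gt_of_ne hx with h | h
      · rw [indicator_of_mem (show x ∈ {x | 1 * (‖x - a‖ ^ 2 - s) < 0} by rw [mem_ofPred_eq]; linarith),
          indicator_of_notMem (show x ∉ {x | (-1) * (‖x - a‖ ^ 2 - s) < 0} by rw [mem_ofPred_eq]; linarith)]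
        simp
      · rw [indicator_of_mem (show x ∈ {x | (-1) * (‖x - a‖ ^ 2 - s) < 0} by rw [mem_ofPred_eq]; linarith),
          indicator_of_notMem (show x ∉ {x | 1 * (‖x - a‖ ^ 2 - s) < 0} by rw [mem_ofPred_eq]; linarith)]
        simp
    · refine hfk.mul (Measurable.indicator (by fun_prop) (measurableSet_lt (by fun_prop) (by fun_prop)))
  have e2 : (∫⁻ x, f k x * ({x | 0 < 1 * (‖x - a‖ ^ 2 - s)}.indicator φ x * om μ x)) +
      (∫⁻ x, f k x * ({x | 0 < (-1) * (‖x - a‖ ^ 2 - s)}.indicator φ x * om μ x)) ≤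
      ∫⁻ x, f k x * (φ x * om μ x) := by
    rw [← lintegral_add_left]
    · refine lintegral_mono fun x => ?_
      by_cases h : 0 < ‖x - a‖ ^ 2 - s
      · rw [indicator_of_mem (show x ∈ {x | 0 < 1 * (‖x - a‖ ^ 2 - s)} by rw [mem_ofPred_eq]; linarith),
          indicator_of_notMem (show x ∉ {x | 0 < (-1) * (‖x - a‖ ^ 2 - s)} by rw [mem_ofPred_eq]; linarith)]
        simp
      · rw [indicator_of_notMem (show x ∉ {x | 0 < 1 * (‖x - a‖ ^ 2 - s)} by rw [mem_ofPred_eq]; linarith)]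
        simp only [zero_mul, mul_zero, zero_add]
        gcongr
        exact indicator_le_self _ _ _
    · refine hfk.mul (Measurable.mul (hφm.indicator (measurableSet_lt (by fun_prop) (by fun_prop))) (by fun_prop))
  rw [tsub_le_iff_left, e1]
  refine (add_le_add (le_add_tsub (b := ∫⁻ x, f k x * ({x | 0 < 1 * (‖x - a‖ ^ 2 - s)}.indicator φ x * om μ x)))
    (le_add_tsub (b := ∫⁻ x, f k x * ({x | 0 < (-1) * (‖x - a‖ ^ 2 - s)}.indicator φ x * om μ x)))).trans ?_
  rw [add_add_add_comm]
  gcongr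

end HLS

namespace HLS
open EuclideanGeometry Set Filter Topology
variable {n : ℕ}

noncomputable def KK (μ : ℝ) (x y : EE n) : ℝ≥0∞ :=
  ENNReal.ofReal (‖x - y‖ ^ 2 * (ww x * ww y)) ^ (-(μ / 2))
noncomputable def W (x : EE n) : ℝ≥0∞ := ENNReal.ofReal (ww x) ^ (n : ℝ)
noncomputable def ka (n : ℕ) (μ : ℝ) : ℝ≥0∞ := ∫⁻ y : EE n, W y * KK μ 0 y

@[fun_prop] theorem measurable_KK (μ : ℝ) : Measurable (fun q : EE n × EE n => KK μ q.1 q.2) := by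
  unfold KK; have := measurable_ww (n := n); fun_prop
@[fun_prop] theorem measurable_W : Measurable (W : EE n → ℝ≥0∞) := by
  unfold W; have := measurable_ww (n := n); fun_prop
theorem KK_symm (μ : ℝ) (x y : EE n) : KK μ x y = KK μ y x := by
  rw [KK, KK, norm_sub_rev, mul_comm (ww x)]
theorem cont_KK (μ : ℝ) (x : EE n) : Continuous (KK μ x) := by
  unfold KK
  have := ww_cont (n := n)
  exact ENNReal.continuous_rpow_const.comp (ENNReal.continuous_ofReal.comp (by fun_prop))
theorem lint_W : ∫⁻ x : EE n, W x = II n := rfl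
theorem W_eq (μ : ℝ) (x : EE n) : W x = hh μ x * om μ x := (hh_om μ x).symm

theorem kap_eq {μ : ℝ} (hμ : 0 < μ) (x y : EE n) : kap μ x y = om μ x * om μ y * KK μ x y := by
  have h1 := ww_pos x
  have h2 := ww_pos y
  rw [om, om, ← ENNReal.mul_rpow_of_nonneg _ _ (by positivity), ← ENNReal.ofReal_mul h1.le, KK,
    ofReal_rpow_mul_neg (by positivity) (by positivity) (by positivity), kap]
  congr 2
  field_simp

theorem chord {a : EE n} {r : ℝ} (hr : r ≠ 0) (hs : 1 + ‖a‖ ^ 2 = r ^ 2) {x y : EE n}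
    (hx : x ≠ a) (hy : y ≠ a) :
    ‖x - inversion a r y‖ ^ 2 * (ww x * ww (inversion a r y)) =
      ‖inversion a r x - y‖ ^ 2 * (ww (inversion a r x) * ww y) := by
  have h1 := norm_sub_inv hr x hy
  have h2 := norm_sub_inv hr y hx
  rw [DD_symm, ← h1] at h2
  have hjx := jj_pos hr hx
  have hjy := jj_pos hr hy
  rw [div_eq_div_iff hjx.ne' hjy.ne', norm_sub_rev] at h2
  rw [← rat_eq hr hs hx, ← rat_eq hr hs hy]
  linear_combination (-ww (inversion a r x) * ww (inversion a r y)) * h2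

theorem KK_inv {μ : ℝ} {a : EE n} {r : ℝ} (hr : r ≠ 0) (hs : 1 + ‖a‖ ^ 2 = r ^ 2) {x y : EE n}
    (hx : x ≠ a) (hy : y ≠ a) : KK μ x (inversion a r y) = KK μ (inversion a r x) y := by
  rw [KK, chord hr hs hx hy, KK]

theorem ex_inv {x x' : EE n} (h : ‖x‖ ≠ ‖x'‖) :
    ∃ a : EE n, x ≠ a ∧ inversion a (√(1 + ‖a‖ ^ 2)) x = x' := by
  have hd : ‖x‖ ^ 2 - ‖x'‖ ^ 2 ≠ 0 := by
    intro h'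
    exact h ((sq_eq_sq₀ (norm_nonneg _) (norm_nonneg _)).1 (by linarith))
  have hxx : x ≠ x' := fun h' => h (by rw [h'])
  set s := (1 + ‖x‖ ^ 2) / (‖x‖ ^ 2 - ‖x'‖ ^ 2) with hs
  have hs0 : s ≠ 0 := div_ne_zero (by positivity) hd
  have hs1 : s * (‖x‖ ^ 2 - ‖x'‖ ^ 2) = 1 + ‖x‖ ^ 2 := by rw [hs]; field_simp
  have hxa : x - (x + s • (x' - x)) = (-s) • (x' - x) := by rw [neg_smul]; abel
  have hv : 0 < ‖x' - x‖ := norm_pos_iff.2 (sub_ne_zero.2 hxx.symm)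
  refine ⟨x + s • (x' - x), ?_, ?_⟩
  · intro h'
    have : x - (x + s • (x' - x)) = 0 := by rw [← h']; simp
    rw [hxa] at this
    rcases smul_eq_zero.1 this with h1 | h1
    · exact hs0 (by linarith)
    · exact hv.ne' (by rw [h1, norm_zero])
  · rw [inv_eq, hxa, Real.sq_sqrt (by positivity), smul_smul]
    have e1 : ‖x + s • (x' - x)‖ ^ 2 = ‖x‖ ^ 2 + 2 * s * inner ℝ x (x' - x) + s ^ 2 * ‖x' - x‖ ^ 2 := by
      rw [norm_add_sq_real, inner_smul_right, norm_smul, mul_pow, Real.norm_eq_abs, sq_abs]; ring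
    have e2 : ‖x'‖ ^ 2 = ‖x‖ ^ 2 + 2 * inner ℝ x (x' - x) + ‖x' - x‖ ^ 2 := by
      rw [← norm_add_sq_real]; congr 2; abel
    have e3 : ‖(-s) • (x' - x)‖ ^ 2 = s ^ 2 * ‖x' - x‖ ^ 2 := by
      rw [norm_smul, mul_pow, Real.norm_eq_abs, sq_abs]; ring
    have e4 : 1 + ‖x + s • (x' - x)‖ ^ 2 = s * (s - 1) * ‖x' - x‖ ^ 2 := by
      rw [e1]
      rw [e2] at hs1
      linear_combination -hs1
    rw [e3, e4]
    have : s * (s - 1) * ‖x' - x‖ ^ 2 / (s ^ 2 * ‖x' - x‖ ^ 2) * -s = 1 - s := by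
      field_simp; ring
    rw [this, sub_smul, one_smul]; abel

theorem W_inv {a : EE n} {r : ℝ} (hr : r ≠ 0) (hs : 1 + ‖a‖ ^ 2 = r ^ 2) {y : EE n}
    (hy : y ≠ a) : ENNReal.ofReal (jj a r y) ^ (n : ℝ) * W (inversion a r y) = W y := by
  rw [W, W, ← ENNReal.mul_rpow_of_nonneg _ _ (by positivity), ← ENNReal.ofReal_mul (jj_pos hr hy).le,
    mul_comm, rat_eq hr hs hy]

theorem ka_const [NeZero n] (μ : ℝ) (x : EE n) : ∫⁻ y : EE n, W y * KK μ x y = ka n μ := by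
  by_cases hx : x = 0
  · rw [hx, ka]
  obtain ⟨a, ha, hax⟩ := ex_inv (x := (0 : EE n)) (x' := x) (by
    rw [norm_zero]; exact (norm_pos_iff.2 hx).ne)
  have hr : √(1 + ‖a‖ ^ 2) ≠ 0 := by positivity
  have hs : 1 + ‖a‖ ^ 2 = √(1 + ‖a‖ ^ 2) ^ 2 := by rw [Real.sq_sqrt (by positivity)]
  rw [ka, lintegral_inv a hr (fun y => W y * KK μ 0 y)]
  refine lintegral_congr_ae ?_
  filter_upwards [ae_ne a] with y hy
  rw [← mul_assoc, W_inv hr hs hy, KK_inv hr hs ha hy, hax]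

theorem ka_eq {μ : ℝ} : ka n μ = ∫⁻ y : EE n,
    ENNReal.ofReal (ww y) ^ (n - μ / 2 : ℝ) * ENNReal.ofReal (‖y‖ ^ 2) ^ (-(μ / 2)) := by
  refine lintegral_congr fun y => ?_
  rw [W, KK, zero_sub, norm_neg]
  have h0 : ww (0 : EE n) = 1 := by simp [ww]
  have := ww_pos y
  rw [h0, one_mul, ENNReal.ofReal_mul (by positivity), ENNReal.mul_rpow_of_ne_top (by simp) (by simp),
    sub_eq_add_neg, ofReal_rpow_add this]
  ring

theorem ka_lt_top [NeZero n] {μ : ℝ} (hμ : 0 < μ) (hμn : μ < n) : ka n μ < ⊤ := by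
  have hn0 : 0 < n := Nat.pos_of_ne_zero (NeZero.ne n)
  have : Nontrivial (EE n) := by
    have : Nonempty (Fin n) := ⟨⟨0, hn0⟩⟩
    infer_instance
  rw [ka_eq]
  have h1 : Integrable (fun y : EE n => (fun t : ℝ => ((1 + t ^ 2)⁻¹) ^ (n - μ / 2 : ℝ) * t ^ (-μ)) ‖y‖) := by
    refine (integrable_fun_norm_addHaar (μ := volume) (E := EE n)
      (f := fun t : ℝ => ((1 + t ^ 2)⁻¹) ^ (n - μ / 2 : ℝ) * t ^ (-μ))).2 ?_
    simp only [finrank_euclideanSpace, Fintype.card_fin, smul_eq_mul]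
    have hm : ∀ s : Set ℝ, AEStronglyMeasurable (fun t : ℝ => t ^ (n - 1) *
        (((1 + t ^ 2)⁻¹) ^ (n - μ / 2 : ℝ) * t ^ (-μ))) (volume.restrict s) := fun s => by
      apply Measurable.aestronglyMeasurable; fun_prop
    have e : ∀ t : ℝ, 0 < t → t ^ (n - 1) * t ^ (-μ) = t ^ (n - 1 - μ : ℝ) := fun t ht => by
      rw [← Real.rpow_natCast, ← Real.rpow_add ht, Nat.cast_sub (by omega)]; simp; ring_nf
    rw [show Ioi (0:ℝ) = Ioc 0 1 ∪ Ioi 1 by rw [Ioc_union_Ioi_eq_Ioi zero_le_one]]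
    refine IntegrableOn.union ?_ ?_
    · have h2 : IntegrableOn (fun t : ℝ => t ^ (n - 1 - μ : ℝ)) (Ioc 0 1) := by
        rw [← intervalIntegrable_iff_integrableOn_Ioc_of_le zero_le_one]
        exact intervalIntegral.intervalIntegrable_rpow' (by linarith)
      refine Integrable.mono' h2 (hm _) ?_
      filter_upwards [ae_restrict_mem measurableSet_Ioc] with t ht
      rw [← e t ht.1, Real.norm_eq_abs, abs_of_nonneg (by have := ht.1.le; positivity)]
      have h0 := ht.1
      have : ((1 + t ^ 2)⁻¹) ^ (n - μ / 2 : ℝ) ≤ 1 :=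
        Real.rpow_le_one (by positivity) (inv_le_one_of_one_le₀ (by nlinarith)) (by linarith)
      calc _ ≤ t ^ (n - 1) * (1 * t ^ (-μ)) := by gcongr
        _ = _ := by ring
    · have h2 : IntegrableOn (fun t : ℝ => t ^ (-(n : ℝ) - 1)) (Ioi 1) :=
        integrableOn_Ioi_rpow_of_lt (by have : (0:ℝ) < n := by exact_mod_cast hn0
                                        linarith) one_pos
      refine Integrable.mono' h2 (hm _) ?_
      filter_upwards [ae_restrict_mem measurableSet_Ioi] with t ht
      have h0 : 0 < t := one_pos.trans ht
      rw [Real.norm_eq_abs, abs_of_nonneg (by positivity)]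
      have : ((1 + t ^ 2)⁻¹) ^ (n - μ / 2 : ℝ) ≤ t ^ (-(2 * n - μ)) := by
        calc _ ≤ ((t ^ 2)⁻¹) ^ (n - μ / 2 : ℝ) := by
              apply Real.rpow_le_rpow (by positivity) _ (by linarith)
              apply inv_anti₀ (by positivity); linarith
          _ = _ := by
            rw [← Real.rpow_natCast, ← Real.rpow_neg h0.le, ← Real.rpow_mul h0.le]; congr 1; push_cast; ring
      calc _ ≤ t ^ (n - 1) * (t ^ (-(2 * n - μ)) * t ^ (-μ)) := by gcongr
        _ = t ^ (n - 1) * t ^ (-μ) * t ^ (-(2 * n - μ)) := by ring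
        _ = _ := by rw [e t h0, ← Real.rpow_add h0]; congr 1; ring
  refine lt_of_le_of_lt (le_of_eq ?_) h1.lintegral_lt_top
  refine lintegral_congr_ae ?_
  filter_upwards [ae_ne (0 : EE n)] with y hy
  have h0 : 0 < ‖y‖ := norm_pos_iff.2 hy
  have := ww_pos y
  rw [ENNReal.ofReal_rpow_of_pos this, ENNReal.ofReal_rpow_of_pos (by positivity),
    ← ENNReal.ofReal_mul (by positivity), ww]
  congr 2
  rw [← Real.rpow_natCast, ← Real.rpow_mul h0.le]; congr 1; push_cast; ring

theorem QQ_KK {μ : ℝ} (hμ : 0 < μ) {f : EE n → ℝ≥0∞} (hf : Measurable f) :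
    QQ μ f f = ∫⁻ x, f x * om μ x * ∫⁻ y, f y * (KK μ x y * om μ y) := by
  refine lintegral_congr fun x => ?_
  rw [← lintegral_const_mul _ (by
    have : Measurable (fun y => KK μ x y) := (cont_KK μ x).measurable
    fun_prop)]
  refine lintegral_congr fun y => ?_
  rw [kap_eq hμ]; ring

theorem QQ_hh [NeZero n] {μ : ℝ} (hμ : 0 < μ) : QQ μ (hh μ : EE n → ℝ≥0∞) (hh μ) = II n * ka n μ := by
  rw [QQ_KK hμ (by fun_prop)]
  have : ∀ x : EE n, ∫⁻ y, hh μ y * (KK μ x y * om μ y) = ka n μ := fun x => by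
    rw [← ka_const μ x]; refine lintegral_congr fun y => ?_; rw [W_eq μ]; ring
  simp_rw [this, ← W_eq]
  rw [lintegral_mul_const _ (by fun_prop), lint_W]

theorem hh_kap [NeZero n] {μ : ℝ} (hμ : 0 < μ) (x : EE n) :
    ∫⁻ y, hh μ y * kap μ x y = ka n μ * om μ x := by
  rw [← ka_const μ x, ← lintegral_mul_const]
  · refine lintegral_congr fun y => ?_; rw [W_eq μ, kap_eq hμ]; ring
  · have : Measurable (fun y => KK μ x y) := (cont_KK μ x).measurable
    fun_prop

theorem lint_hh {μ p : ℝ} (hpα : (n - μ / 2) * p = n) : ∫⁻ x : EE n, hh μ x ^ p = II n := by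
  refine lintegral_congr fun x => ?_
  rw [hh, ← ENNReal.rpow_mul, hpα]

theorem II_pos [NeZero n] : II n ≠ 0 := by
  intro h
  have h1 := (lintegral_eq_zero_iff (f := fun x : EE n => ENNReal.ofReal (ww x) ^ (n : ℝ)) measurable_W).1 h
  have h2 : ∀ᵐ x : EE n, False := by
    filter_upwards [h1] with x hx
    have := ww_pos x
    rw [Pi.zero_apply, ENNReal.rpow_eq_zero_iff] at hx
    simp at hx; linarith [hx.1]
  rw [ae_iff] at h2
  simp at h2

end HLS

namespace HLS
open EuclideanGeometry Set Filter Topology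
variable {n : ℕ}

noncomputable def VN (μ : ℝ) (N : ℝ≥0∞) (f : EE n → ℝ≥0∞) (x : EE n) : ℝ≥0∞ :=
  ∫⁻ y, f y * (min (KK μ x y) N * om μ y)

theorem measurable_VN (μ : ℝ) (N : ℝ≥0∞) {f : EE n → ℝ≥0∞} (hf : Measurable f) :
    Measurable (VN μ N f) := by
  unfold VN
  apply Measurable.lintegral_prod_right' (f := fun q : EE n × EE n => f q.2 * (min (KK μ q.1 q.2) N * om μ q.2))
  have := measurable_KK (n := n) μ
  fun_prop

theorem VN_le [NeZero n] {μ : ℝ} {M N : ℝ≥0∞} (hM : M ≠ ⊤) (hN : N ≠ ⊤) {f : EE n → ℝ≥0∞}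
    (hf : ∀ x, f x ≤ M * hh μ x) (x : EE n) : VN μ N f x ≤ M * N * II n := by
  rw [← lint_W, ← lintegral_const_mul' _ _ (ENNReal.mul_ne_top hM hN)]
  refine lintegral_mono fun y => ?_
  calc f y * (min (KK μ x y) N * om μ y) ≤ M * hh μ y * (N * om μ y) := by
        gcongr
        · exact hf y
        · exact min_le_right _ _
    _ = _ := by rw [W_eq μ]; ring

theorem VN_diff [NeZero n] {μ : ℝ} (hμ : 0 < μ) (hμn : μ / 2 < n)
    {M N : ℝ≥0∞} (hM : M ≠ ⊤) (hN : N ≠ ⊤) {f : ℕ → EE n → ℝ≥0∞}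
    (hfm : ∀ k, Measurable (f k)) (hf : ∀ k x, f k x ≤ M * hh μ x)
    (hg : ∀ (a : EE n) (r : ℝ), r ≠ 0 → 1 + ‖a‖ ^ 2 ≠ r ^ 2 → Tendsto (fun k => gap μ a r (f k)) atTop (𝓝 0))
    {x x' : EE n} (hx : ‖x‖ ≠ ‖x'‖) :
    Tendsto (fun k => VN μ N (f k) x' - VN μ N (f k) x) atTop (𝓝 0) := by
  obtain ⟨a, ha, hax⟩ := ex_inv hx
  have hr : √(1 + ‖a‖ ^ 2) ≠ 0 := by positivity
  have hs : 1 + ‖a‖ ^ 2 = √(1 + ‖a‖ ^ 2) ^ 2 := by rw [Real.sq_sqrt (by positivity)]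
  have := weak_inv hμ hμn (a := a) hM hN hfm hf (hg a) (φ := fun y => min (KK μ x y) N)
    ((cont_KK μ x).min continuous_const) (fun y => min_le_right _ _)
  refine this.congr fun k => ?_
  congr 1
  refine lintegral_congr_ae ?_
  filter_upwards [ae_ne a] with y hy
  rw [KK_inv hr hs ha hy, hax]

theorem err_lim [NeZero n] {μ : ℝ} (hμ : 0 < μ) (hμn : μ / 2 < n)
    {M N : ℝ≥0∞} (hM : M ≠ ⊤) (hN : N ≠ ⊤) {f : ℕ → EE n → ℝ≥0∞}
    (hfm : ∀ k, Measurable (f k)) (hf : ∀ k x, f k x ≤ M * hh μ x)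
    (hg : ∀ (a : EE n) (r : ℝ), r ≠ 0 → 1 + ‖a‖ ^ 2 ≠ r ^ 2 → Tendsto (fun k => gap μ a r (f k)) atTop (𝓝 0)) :
    Tendsto (fun k => ∫⁻ x, W x * ∫⁻ x', W x' * (VN μ N (f k) x' - VN μ N (f k) x)) atTop (𝓝 0) := by
  have hn0 : 0 < n := Nat.pos_of_ne_zero (NeZero.ne n)
  have : Nontrivial (EE n) := by
    have : Nonempty (Fin n) := ⟨⟨0, hn0⟩⟩
    infer_instance
  have hI := II_lt_top (n := n)
  have hC : M * N * II n ≠ ⊤ := ENNReal.mul_ne_top (ENNReal.mul_ne_top hM hN) hI.ne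
  have mV := fun k => measurable_VN μ N (hfm k)
  have hWt : ∀ x : EE n, W x ≠ ⊤ := fun x => by
    have := ww_pos x
    simp [W]
  have hb : ∀ k x x', W x' * (VN μ N (f k) x' - VN μ N (f k) x) ≤ (M * N * II n) * W x' := fun k x x' => by
    rw [mul_comm]; gcongr; exact tsub_le_self.trans (VN_le hM hN (hf k) x')
  have inner : ∀ x, Tendsto (fun k => ∫⁻ x', W x' * (VN μ N (f k) x' - VN μ N (f k) x)) atTop (𝓝 0) := by
    intro x
    have h1 : Tendsto (fun k => ∫⁻ x', W x' * (VN μ N (f k) x' - VN μ N (f k) x)) atTop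
        (𝓝 (∫⁻ x' : EE n, 0)) := by
      refine tendsto_lintegral_of_dominated_convergence (fun x' => (M * N * II n) * W x')
        (fun k => by have := mV k; fun_prop) (fun k => Eventually.of_forall (hb k x)) ?_ ?_
      · rw [lintegral_const_mul' _ _ hC]; exact ENNReal.mul_ne_top hC hI.ne
      · have hsp : ∀ᵐ x' : EE n, ‖x‖ ≠ ‖x'‖ := by
          rw [ae_iff]
          refine measure_mono_null (fun y hy => ?_) (Measure.addHaar_sphere volume (0 : EE n) ‖x‖)
          have : ‖x‖ = ‖y‖ := by simpa using hy
          simp [this]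
        filter_upwards [hsp] with x' hx'
        have := ENNReal.Tendsto.const_mul (VN_diff hμ hμn hM hN hfm hf hg hx') (a := W x') (Or.inr (hWt x'))
        simpa using this
    simpa using h1
  have h2 : Tendsto (fun k => ∫⁻ x, W x * ∫⁻ x', W x' * (VN μ N (f k) x' - VN μ N (f k) x)) atTop
        (𝓝 (∫⁻ x' : EE n, 0)) := by
    refine tendsto_lintegral_of_dominated_convergence (fun x => (M * N * II n * II n) * W x)
      (fun k => ?_) (fun k => Eventually.of_forall fun x => ?_) ?_ ?_
    · have := mV k
      refine Measurable.mul (by fun_prop) (Measurable.lintegral_prod_right'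
        (f := fun q : EE n × EE n => W q.2 * (VN μ N (f k) q.2 - VN μ N (f k) q.1)) (by fun_prop))
    · beta_reduce
      rw [mul_comm]; gcongr
      refine (lintegral_mono (hb k x)).trans ?_
      rw [lintegral_const_mul' _ _ hC, lint_W]
    · rw [lintegral_const_mul' _ _ (ENNReal.mul_ne_top hC hI.ne)]
      exact ENNReal.mul_ne_top (ENNReal.mul_ne_top hC hI.ne) hI.ne
    · refine Eventually.of_forall fun x => ?_
      have := ENNReal.Tendsto.const_mul (inner x) (a := W x) (Or.inr (hWt x))
      simpa using this
  simpa using h2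

noncomputable def tau (n : ℕ) (μ : ℝ) (N : ℕ) : ℝ≥0∞ :=
  ∫⁻ x : EE n, W x * ∫⁻ y : EE n, W y * (KK μ x y - min (KK μ x y) N)

theorem tau_lim [NeZero n] {μ : ℝ} (hμ : 0 < μ) (hμn : μ < n) : Tendsto (tau n μ) atTop (𝓝 0) := by
  have hI := II_lt_top (n := n)
  have hka := (ka_lt_top hμ hμn).ne
  have hWt : ∀ x : EE n, W x ≠ ⊤ := fun x => by
    have := ww_pos x
    simp [W]
  have mK := measurable_KK (n := n) μ
  have mKx : ∀ x : EE n, Measurable (KK μ x) := fun x => (cont_KK μ x).measurable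
  have hb : ∀ (N : ℕ) (x y : EE n), W y * (KK μ x y - min (KK μ x y) N) ≤ W y * KK μ x y := fun N x y => by
    gcongr; exact tsub_le_self
  have inner : ∀ x : EE n, Tendsto (fun N : ℕ => ∫⁻ y, W y * (KK μ x y - min (KK μ x y) N)) atTop (𝓝 0) := by
    intro x
    have h1 : Tendsto (fun N : ℕ => ∫⁻ y, W y * (KK μ x y - min (KK μ x y) N)) atTop
        (𝓝 (∫⁻ y : EE n, 0)) := by
      refine tendsto_lintegral_of_dominated_convergence (fun y => W y * KK μ x y)
        (fun k => by have := mKx x; fun_prop) (fun k => Eventually.of_forall (hb k x)) ?_ ?_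
      · rw [ka_const]; exact hka
      · filter_upwards [ae_ne x] with y hy
        have hfin : KK μ x y ≠ ⊤ := by
          have h1 := ww_pos x
          have h2 := ww_pos y
          have h3 : 0 < ‖x - y‖ := norm_pos_iff.2 (sub_ne_zero.2 hy.symm)
          have : 0 < ‖x - y‖ ^ 2 * (ww x * ww y) := by positivity
          rw [KK, ENNReal.ofReal_rpow_of_pos this]; exact ENNReal.ofReal_ne_top
        obtain ⟨m0, hm0⟩ := ENNReal.exists_nat_gt hfin
        refine tendsto_const_nhds.congr' ?_
        filter_upwards [eventually_ge_atTop m0] with m hm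
        rw [min_eq_left, tsub_self, mul_zero]
        exact hm0.le.trans (by exact_mod_cast hm)
    simpa using h1
  have h2 : Tendsto (tau n μ) atTop (𝓝 (∫⁻ x' : EE n, 0)) := by
    refine tendsto_lintegral_of_dominated_convergence (fun x => ka n μ * W x)
      (fun k => ?_) (fun k => Eventually.of_forall fun x => ?_) ?_ ?_
    · refine Measurable.mul (by fun_prop) (Measurable.lintegral_prod_right'
        (f := fun q : EE n × EE n => W q.2 * (KK μ q.1 q.2 - min (KK μ q.1 q.2) k)) (by fun_prop))
    · beta_reduce
      rw [mul_comm]; gcongr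
      refine (lintegral_mono (hb k x)).trans ?_
      rw [ka_const]
    · rw [lintegral_const_mul' _ _ hka]
      exact ENNReal.mul_ne_top hka hI.ne
    · refine Eventually.of_forall fun x => ?_
      have := ENNReal.Tendsto.const_mul (inner x) (a := W x) (Or.inr (hWt x))
      simpa using this
  simpa using h2

theorem W_VN_le [NeZero n] {μ : ℝ} {N : ℝ≥0∞} {f : EE n → ℝ≥0∞} (hf : Measurable f) :
    ∫⁻ x, W x * VN μ N f x ≤ ka n μ * LL μ f := by
  have mK := measurable_KK (n := n) μ
  calc ∫⁻ x, W x * VN μ N f x = ∫⁻ x, ∫⁻ y, W x * (f y * (min (KK μ x y) N * om μ y)) := by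
        refine lintegral_congr fun x => ?_
        rw [VN, lintegral_const_mul]
        have : Measurable (KK μ x) := (cont_KK μ x).measurable
        fun_prop
    _ = ∫⁻ y, ∫⁻ x, W x * (f y * (min (KK μ x y) N * om μ y)) := by
        rw [lintegral_lintegral_swap]
        apply Measurable.aemeasurable
        change Measurable (fun q : EE n × EE n => W q.1 * (f q.2 * (min (KK μ q.1 q.2) N * om μ q.2)))
        fun_prop
    _ ≤ ∫⁻ y, ka n μ * (f y * om μ y) := by
        refine lintegral_mono fun y => ?_
        beta_reduce
        have : Measurable (KK μ y) := (cont_KK μ y).measurable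
        rw [← ka_const μ y, ← lintegral_mul_const _ (by fun_prop)]
        refine lintegral_mono fun x => ?_
        rw [KK_symm μ y x]
        calc W x * (f y * (min (KK μ x y) N * om μ y)) ≤ W x * (f y * (KK μ x y * om μ y)) := by
              gcongr; exact min_le_left _ _
          _ = _ := by ring
    _ = _ := by rw [lintegral_const_mul _ (by fun_prop)]; rfl

theorem QQ_trunc [NeZero n] {μ : ℝ} (hμ : 0 < μ) {M : ℝ≥0∞} (hM : M ≠ ⊤) (N : ℕ)
    {f : EE n → ℝ≥0∞} (hf : Measurable f) (hfM : ∀ x, f x ≤ M * hh μ x) :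
    QQ μ f f ≤ (∫⁻ x, f x * om μ x * VN μ N f x) + M ^ 2 * tau n μ N := by
  rw [QQ_KK hμ hf, tau, ← lintegral_const_mul' _ _ (ENNReal.pow_ne_top hM)]
  have mV := measurable_VN μ N hf
  rw [← lintegral_add_left (by fun_prop)]
  refine lintegral_mono fun x => ?_
  have mKx : Measurable (KK μ x) := (cont_KK μ x).measurable
  calc f x * om μ x * ∫⁻ y, f y * (KK μ x y * om μ y)
      ≤ f x * om μ x * (VN μ N f x + ∫⁻ y, M * (W y * (KK μ x y - min (KK μ x y) N))) := by
        gcongr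
        rw [VN, ← lintegral_add_left (by fun_prop)]
        refine lintegral_mono fun y => ?_
        calc f y * (KK μ x y * om μ y) ≤ f y * ((min (KK μ x y) N + (KK μ x y - min (KK μ x y) N)) * om μ y) := by
              gcongr; exact le_add_tsub
          _ = f y * (min (KK μ x y) N * om μ y) + f y * ((KK μ x y - min (KK μ x y) N) * om μ y) := by ring
          _ ≤ f y * (min (KK μ x y) N * om μ y) + M * hh μ y * ((KK μ x y - min (KK μ x y) N) * om μ y) := by
              gcongr; exact hfM y
          _ = _ := by rw [W_eq μ]; ring
    _ = f x * om μ x * VN μ N f x + f x * om μ x * (M * ∫⁻ y, W y * (KK μ x y - min (KK μ x y) N)) := by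
        rw [lintegral_const_mul' _ _ hM, mul_add]
    _ ≤ f x * om μ x * VN μ N f x + M * hh μ x * om μ x * (M * ∫⁻ y, W y * (KK μ x y - min (KK μ x y) N)) := by
        gcongr; exact hfM x
    _ = _ := by rw [W_eq μ]; ring

theorem QN_bound [NeZero n] {μ : ℝ} {M N : ℝ≥0∞} (hM : M ≠ ⊤)
    {f : EE n → ℝ≥0∞} (hf : Measurable f) (hfM : ∀ x, f x ≤ M * hh μ x) :
    II n * (∫⁻ x, f x * om μ x * VN μ N f x) ≤ ka n μ * LL μ f ^ 2 +
      M * ∫⁻ x, W x * ∫⁻ x', W x' * (VN μ N f x' - VN μ N f x) := by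
  have mV := measurable_VN μ N hf
  have mE : Measurable (fun x => ∫⁻ x', W x' * (VN μ N f x' - VN μ N f x)) :=
    Measurable.lintegral_prod_right'
        (f := fun q : EE n × EE n => W q.2 * (VN μ N f q.2 - VN μ N f q.1)) (by fun_prop)
  calc II n * (∫⁻ x, f x * om μ x * VN μ N f x)
      = ∫⁻ x : EE n, W x * (∫⁻ x', f x' * om μ x' * VN μ N f x') := by
        rw [lintegral_mul_const _ (by fun_prop), lint_W]
    _ ≤ ∫⁻ x : EE n, (LL μ f * (W x * VN μ N f x) + M * (W x * ∫⁻ x', W x' * (VN μ N f x' - VN μ N f x))) := by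
        refine lintegral_mono fun x => ?_
        calc W x * (∫⁻ x', f x' * om μ x' * VN μ N f x')
            ≤ W x * (∫⁻ x', (f x' * om μ x' * VN μ N f x + M * (W x' * (VN μ N f x' - VN μ N f x)))) := by
              gcongr with x'
              calc f x' * om μ x' * VN μ N f x' ≤ f x' * om μ x' * (VN μ N f x + (VN μ N f x' - VN μ N f x)) := by
                    gcongr; exact le_add_tsub
                _ = f x' * om μ x' * VN μ N f x + f x' * om μ x' * (VN μ N f x' - VN μ N f x) := by ring
                _ ≤ f x' * om μ x' * VN μ N f x + M * hh μ x' * om μ x' * (VN μ N f x' - VN μ N f x) := by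
                    gcongr; exact hfM x'
                _ = _ := by rw [W_eq μ]; ring
          _ = _ := by
              rw [lintegral_add_left (by fun_prop), lintegral_mul_const _ (by fun_prop),
                lintegral_const_mul' _ _ hM, LL]; ring
    _ = LL μ f * (∫⁻ x : EE n, W x * VN μ N f x) + M * ∫⁻ x, W x * ∫⁻ x', W x' * (VN μ N f x' - VN μ N f x) := by
        rw [lintegral_add_left (by fun_prop), lintegral_const_mul _ (by fun_prop),
          lintegral_const_mul' _ _ hM]
    _ ≤ LL μ f * (ka n μ * LL μ f) + M * ∫⁻ x, W x * ∫⁻ x', W x' * (VN μ N f x' - VN μ N f x) := by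
        gcongr; exact W_VN_le hf
    _ = _ := by ring

theorem LL_holder [NeZero n] {μ p : ℝ} (hμ : 0 < μ) (hμn : μ < n) (hp : p = 2 * n / (2 * n - μ))
    {f : EE n → ℝ≥0∞} (hf : Measurable f) (hf1 : ∫⁻ x, f x ^ p ≤ 1) :
    LL μ f ≤ II n ^ (μ / (2 * n)) := by
  have hn0 : (0:ℝ) < n := by exact_mod_cast Nat.pos_of_ne_zero (NeZero.ne n)
  have hc : p.HolderConjugate (2 * n / μ) := by
    rw [Real.holderConjugate_iff]
    constructor
    · rw [hp, lt_div_iff₀ (by linarith)]; linarith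
    · rw [hp]; field_simp; ring
  calc LL μ f ≤ (∫⁻ x, f x ^ p) ^ (1 / p) * (∫⁻ x : EE n, om μ x ^ (2 * n / μ)) ^ (1 / (2 * n / μ)) :=
        ENNReal.lintegral_mul_le_Lp_mul_Lq volume hc hf.aemeasurable (by fun_prop)
    _ ≤ 1 ^ (1 / p) * (II n) ^ (1 / (2 * n / μ)) := by
        have := hc.pos
        refine mul_le_mul' (ENNReal.rpow_le_rpow hf1 (by positivity)) ?_
        · refine le_of_eq ?_
          congr 1
          refine lintegral_congr fun x => ?_
          rw [om, ← ENNReal.rpow_mul]; congr 1; field_simp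
    _ = _ := by rw [ENNReal.one_rpow, one_mul, one_div_div]

end HLS

namespace HLS
open EuclideanGeometry Set Filter Topology
variable {n : ℕ}

theorem hls_eps [NeZero n] {μ p : ℝ} (hμ : 0 < μ) (hμn : μ < n) (hp : p = 2 * n / (2 * n - μ))
    {M : ℝ≥0∞} (hM : M ≠ ⊤) {f : EE n → ℝ≥0∞} (hf : Measurable f) (hfM : ∀ x, f x ≤ M * hh μ x)
    (hf1 : ∫⁻ x, f x ^ p ≤ 1) {ε : ℝ≥0∞} (hε : ε ≠ 0) (hεt : ε ≠ ⊤) :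
    II n * QQ μ f f ≤ ka n μ * (II n ^ (μ / (2 * n))) ^ 2 + ε * (II n * II n ^ (μ / (2 * n))) := by
  have hn0 : (0:ℝ) < n := by exact_mod_cast Nat.pos_of_ne_zero (NeZero.ne n)
  have hI := II_lt_top (n := n)
  have hka := (ka_lt_top hμ hμn).ne
  have hp0 : 0 < p := by rw [hp]; apply div_pos <;> linarith
  have hpα : (n - μ / 2) * p = n := by
    have : 2 * (n:ℝ) - μ ≠ 0 := by linarith
    rw [hp, show (n:ℝ) - μ / 2 = (2 * n - μ) / 2 by ring]
    field_simp
  set P : (EE n → ℝ≥0∞) → Prop := fun g => Measurable g ∧ (∀ x, g x ≤ M * hh μ x) ∧ ∫⁻ x, g x ^ p ≤ 1 with hP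
  set J : (EE n → ℝ≥0∞) → ℝ≥0∞ := fun g => QQ μ g g + ε * LL μ g with hJ
  set S : Set ℝ≥0∞ := {t | ∃ g, P g ∧ t = J g} with hS
  have hne : S.Nonempty := ⟨J f, f, ⟨hf, hfM, hf1⟩, rfl⟩
  set m := sSup S with hm
  have hJm : ∀ g, P g → J g ≤ m := fun g hg => le_sSup ⟨g, hg, rfl⟩
  have hQf : ∀ g, P g → QQ μ g g ≤ M ^ 2 * (II n * ka n μ) := by
    intro g hg
    rw [← QQ_hh hμ, QQ, QQ, ← lintegral_const_mul' _ _ (ENNReal.pow_ne_top hM)]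
    refine lintegral_mono fun x => ?_
    rw [← lintegral_const_mul' _ _ (ENNReal.pow_ne_top hM)]
    refine lintegral_mono fun y => ?_
    calc g x * g y * kap μ x y ≤ (M * hh μ x) * (M * hh μ y) * kap μ x y := by
          gcongr
          · exact hg.2.1 x
          · exact hg.2.1 y
      _ = _ := by ring
  have hLf : ∀ g, P g → LL μ g ≤ II n ^ (μ / (2 * n)) := fun g hg => LL_holder hμ hμn hp hg.1 hg.2.2
  have hIp : II n ^ (μ / (2 * n)) ≠ ⊤ := ENNReal.rpow_ne_top_of_nonneg (by positivity) hI.ne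
  have hmt : m ≠ ⊤ := by
    refine ne_top_of_le_ne_top (b := M ^ 2 * (II n * ka n μ) + ε * II n ^ (μ / (2 * n))) ?_ ?_
    · exact ENNReal.add_ne_top.2 ⟨ENNReal.mul_ne_top (ENNReal.pow_ne_top hM) (ENNReal.mul_ne_top hI.ne hka),
        ENNReal.mul_ne_top hεt hIp⟩
    · refine sSup_le ?_
      rintro t ⟨g, hg, rfl⟩
      exact add_le_add (hQf g hg) (by gcongr; exact hLf g hg)
  obtain ⟨t, -, htl, htS⟩ := exists_seq_tendsto_sSup hne (OrderTop.bddAbove S)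
  choose F hFP hFt using htS
  have hJl : Tendsto (fun k => J (F k)) atTop (𝓝 m) := htl.congr hFt
  have hgap : ∀ (a : EE n) (r : ℝ), r ≠ 0 → 1 + ‖a‖ ^ 2 ≠ r ^ 2 →
      Tendsto (fun k => gap μ a r (F k)) atTop (𝓝 0) := by
    intro a r hr hs
    have h1 : ∀ k, ε * gap μ a r (F k) ≤ 2 * (m - J (F k)) := by
      intro k
      obtain ⟨g1, g2, g3⟩ := hFP k
      have hpol : P (pol μ a r (F k)) := ⟨by fun_prop, pol_le (by linarith) hr g2,
        by rw [lint_pol hp0 hpα a hr hs g1]; exact g3⟩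
      have h2 := hJm _ hpol
      have h3 := LL_pol hμ a hr hs g1
      have h4 := QQ_pol hμ a hr hs g1
      have hJt : J (F k) ≠ ⊤ := ne_top_of_le_ne_top hmt (hJm _ (hFP k))
      rw [ENNReal.mul_sub (by simp)]
      refine ENNReal.le_sub_of_add_le_left (ENNReal.mul_ne_top (by simp) hJt) ?_
      calc 2 * J (F k) + ε * gap μ a r (F k) = 2 * QQ μ (F k) (F k) + ε * (2 * LL μ (F k) + gap μ a r (F k)) := by
            simp only [hJ]; ring
        _ ≤ 2 * QQ μ (pol μ a r (F k)) (pol μ a r (F k)) + ε * (2 * LL μ (pol μ a r (F k))) := by gcongr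
        _ = 2 * J (pol μ a r (F k)) := by simp only [hJ]; ring
        _ ≤ 2 * m := by gcongr
    have h2 : Tendsto (fun k => ε⁻¹ * (2 * (m - J (F k)))) atTop (𝓝 0) := by
      have e1 := ENNReal.Tendsto.sub (tendsto_const_nhds (x := m)) hJl (Or.inl hmt)
      have e2 := ENNReal.Tendsto.const_mul (a := ε⁻¹) (ENNReal.Tendsto.const_mul (a := 2) e1
        (Or.inr (by simp))) (Or.inr (by simpa using hε))
      simpa using e2
    refine tendsto_of_tendsto_of_tendsto_of_le_of_le tendsto_const_nhds h2 (fun _ => bot_le) fun k => ?_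
    beta_reduce
    calc gap μ a r (F k) = ε⁻¹ * (ε * gap μ a r (F k)) := by
          rw [← mul_assoc, ENNReal.inv_mul_cancel hε hεt, one_mul]
      _ ≤ _ := mul_le_mul_right (h1 k) _
  set L := II n ^ (μ / (2 * n)) with hL
  have hN : ∀ N : ℕ, II n * m ≤ (ka n μ * L ^ 2 + ε * (II n * L)) + II n * (M ^ 2 * tau n μ N) := by
    intro N
    have hlim := err_lim hμ (by linarith : μ / 2 < n) hM (ENNReal.natCast_ne_top N) (fun k => (hFP k).1) (fun k => (hFP k).2.1) hgap
    have h5 : ∀ k, II n * J (F k) ≤ (ka n μ * L ^ 2 + ε * (II n * L)) + II n * (M ^ 2 * tau n μ N) +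
        M * ∫⁻ x, W x * ∫⁻ x', W x' * (VN μ N (F k) x' - VN μ N (F k) x) := by
      intro k
      have hq := QN_bound (N := (N : ℝ≥0∞)) hM (hFP k).1 (hFP k).2.1
      have ht := QQ_trunc hμ hM N (hFP k).1 (hFP k).2.1
      set T := ∫⁻ x, W x * ∫⁻ x', W x' * (VN μ N (F k) x' - VN μ N (F k) x)
      calc II n * J (F k) ≤ II n * ((∫⁻ x, F k x * om μ x * VN μ N (F k) x) + M ^ 2 * tau n μ N + ε * LL μ (F k)) := by
            simp only [hJ]; gcongr
        _ = II n * (∫⁻ x, F k x * om μ x * VN μ N (F k) x) + II n * (M ^ 2 * tau n μ N) + ε * (II n * LL μ (F k)) := by ring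
        _ ≤ (ka n μ * LL μ (F k) ^ 2 + M * T) + II n * (M ^ 2 * tau n μ N) + ε * (II n * LL μ (F k)) := by gcongr
        _ ≤ (ka n μ * L ^ 2 + M * T) + II n * (M ^ 2 * tau n μ N) + ε * (II n * L) := by
            gcongr
            · exact hLf _ (hFP k)
            · exact hLf _ (hFP k)
        _ = _ := by ring
    have l1 := ENNReal.Tendsto.const_mul (a := II n) hJl (Or.inr hI.ne)
    have l2 := (ENNReal.Tendsto.const_mul (a := M) hlim (Or.inr hM)).const_add
      ((ka n μ * L ^ 2 + ε * (II n * L)) + II n * (M ^ 2 * tau n μ N))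
    rw [mul_zero, add_zero] at l2
    exact le_of_tendsto_of_tendsto' l1 l2 h5
  have hfin : II n * m ≤ ka n μ * L ^ 2 + ε * (II n * L) := by
    have l2 := (ENNReal.Tendsto.const_mul (a := II n) (ENNReal.Tendsto.const_mul (a := M ^ 2) (tau_lim hμ hμn)
      (Or.inr (ENNReal.pow_ne_top hM))) (Or.inr hI.ne)).const_add (ka n μ * L ^ 2 + ε * (II n * L))
    rw [mul_zero, mul_zero, add_zero] at l2
    exact ge_of_tendsto' l2 hN
  refine le_trans ?_ hfin
  gcongr
  exact le_trans (by simp only [hJ]; exact le_self_add) (hJm f ⟨hf, hfM, hf1⟩)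

theorem hls_one [NeZero n] {μ p : ℝ} (hμ : 0 < μ) (hμn : μ < n) (hp : p = 2 * n / (2 * n - μ))
    {M : ℝ≥0∞} (hM : M ≠ ⊤) {f : EE n → ℝ≥0∞} (hf : Measurable f) (hfM : ∀ x, f x ≤ M * hh μ x)
    (hf1 : ∫⁻ x, f x ^ p ≤ 1) :
    II n * QQ μ f f ≤ ka n μ * II n ^ (μ / n) := by
  have hn0 : (0:ℝ) < n := by exact_mod_cast Nat.pos_of_ne_zero (NeZero.ne n)
  have hI := II_lt_top (n := n)
  have e : (II n ^ (μ / (2 * n))) ^ 2 = II n ^ (μ / n) := by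
    rw [← ENNReal.rpow_natCast, ← ENNReal.rpow_mul]; congr 1; push_cast; field_simp
  rw [← e]
  have hl : Tendsto (fun k : ℕ => ka n μ * (II n ^ (μ / (2 * n))) ^ 2 + (k : ℝ≥0∞)⁻¹ * (II n * II n ^ (μ / (2 * n)))) atTop
      (𝓝 (ka n μ * (II n ^ (μ / (2 * n))) ^ 2 + 0 * (II n * II n ^ (μ / (2 * n))))) := by
    refine (ENNReal.Tendsto.mul_const ENNReal.tendsto_inv_nat_nhds_zero (Or.inr ?_)).const_add _
    exact ENNReal.mul_ne_top hI.ne (ENNReal.rpow_ne_top_of_nonneg (by positivity) hI.ne)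
  rw [zero_mul, add_zero] at hl
  refine ge_of_tendsto hl ?_
  filter_upwards [eventually_gt_atTop 0] with k hk
  exact hls_eps hμ hμn hp hM hf hfM hf1 (by simp) (by simp; omega)

set_option maxHeartbeats 800000 in
theorem hls [NeZero n] {μ p : ℝ} (hμ : 0 < μ) (hμn : μ < n) (hp : p = 2 * n / (2 * n - μ))
    {f : EE n → ℝ≥0∞} (hf : Measurable f) (hf1 : ∫⁻ x, f x ^ p ≠ ⊤) :
    II n * QQ μ f f ≤ ka n μ * II n ^ (μ / n) * (∫⁻ x, f x ^ p) ^ (2 / p) := by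
  have hp0 : 0 < p := by rw [hp]; apply div_pos <;> linarith
  set F := ∫⁻ x, f x ^ p with hF
  by_cases hF0 : F = 0
  · have h0 : f =ᵐ[volume] 0 := by
      have := (lintegral_eq_zero_iff (by fun_prop)).1 hF0
      filter_upwards [this] with x hx
      simpa [hp0, hp0.le.not_gt] using hx
    have : QQ μ f f = 0 := by
      rw [QQ, lintegral_eq_zero_iff (Measurable.lintegral_prod_right'
        (f := fun q : EE n × EE n => f q.1 * f q.2 * kap μ q.1 q.2) (by fun_prop))]
      filter_upwards [h0] with x hx
      simp [hx]
    rw [this]; simp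
  have hFt := hf1
  -- truncations
  have step : ∀ M : ℕ, II n * QQ μ (fun x => min (f x) (M * hh μ x)) (fun x => min (f x) (M * hh μ x)) ≤
      ka n μ * II n ^ (μ / n) * F ^ (2 / p) := by
    intro M
    set c := F ^ (-(1 / p)) with hc
    have hct : c ≠ ⊤ := by
      rw [hc, ENNReal.rpow_neg]; simp [ENNReal.rpow_eq_zero_iff, hF0, hFt]
    have hcp : c ^ p = F⁻¹ := by
      rw [hc, ← ENNReal.rpow_mul, ← ENNReal.rpow_neg_one]; congr 1; field_simp
    have hc2 : c ^ 2 * F ^ (2 / p) = 1 := by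
      rw [hc, ← ENNReal.rpow_natCast, ← ENNReal.rpow_mul, ← ENNReal.rpow_add _ _ hF0 hFt]
      convert ENNReal.rpow_zero using 2; push_cast; ring
    have h1 := hls_one hμ hμn hp (M := c * M) (ENNReal.mul_ne_top hct (by simp))
      (f := fun x => c * min (f x) (M * hh μ x)) (by fun_prop)
      (fun x => by rw [mul_assoc]; gcongr; exact min_le_right _ _) (by
        calc ∫⁻ x, (c * min (f x) (M * hh μ x)) ^ p ≤ ∫⁻ x, c ^ p * f x ^ p := by
              refine lintegral_mono fun x => ?_
              rw [← ENNReal.mul_rpow_of_nonneg _ _ hp0.le]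
              gcongr; exact min_le_left _ _
          _ = F⁻¹ * F := by rw [lintegral_const_mul _ (by fun_prop), hcp]
          _ ≤ 1 := by rw [ENNReal.inv_mul_cancel hF0 hFt])
    have h2 : QQ μ (fun x => c * min (f x) (M * hh μ x)) (fun x => c * min (f x) (M * hh μ x)) =
        c ^ 2 * QQ μ (fun x => min (f x) (M * hh μ x)) (fun x => min (f x) (M * hh μ x)) := by
      rw [QQ, QQ, ← lintegral_const_mul' _ _ (ENNReal.pow_ne_top hct)]
      refine lintegral_congr fun x => ?_
      rw [← lintegral_const_mul' _ _ (ENNReal.pow_ne_top hct)]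
      refine lintegral_congr fun y => ?_
      ring
    rw [h2] at h1
    set Q := QQ μ (fun x => min (f x) (M * hh μ x)) (fun x => min (f x) (M * hh μ x))
    calc II n * Q = II n * (c ^ 2 * Q) * F ^ (2 / p) := by
          rw [show II n * (c ^ 2 * Q) * F ^ (2 / p) = II n * Q * (c ^ 2 * F ^ (2 / p)) by ring, hc2, mul_one]
      _ ≤ _ := by gcongr
  have mono : ∀ x, Monotone (fun M : ℕ => min (f x) (M * hh μ x)) := fun x M M' h => by
    beta_reduce; gcongr
  have lim1 : ∀ x, Tendsto (fun M : ℕ => min (f x) (M * hh μ x)) atTop (𝓝 (f x)) := by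
    intro x
    have hh0 : hh μ x ≠ 0 := by
      have := ww_pos x
      rw [hh, ENNReal.ofReal_rpow_of_pos this]; simp; positivity
    have : Tendsto (fun M : ℕ => (M : ℝ≥0∞) * hh μ x) atTop (𝓝 (⊤ * hh μ x)) :=
      ENNReal.Tendsto.mul_const ENNReal.tendsto_nat_nhds_top (Or.inl (by simp))
    rw [ENNReal.top_mul hh0] at this
    simpa using (tendsto_const_nhds (x := f x)).min this
  have kmono : ∀ x y, Monotone (fun M : ℕ => min (f x) (M * hh μ x) * min (f y) (M * hh μ y) * kap μ x y) :=
    fun x y M M' h => by beta_reduce; gcongr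
  have klim : ∀ x y, Tendsto (fun M : ℕ => min (f x) (M * hh μ x) * min (f y) (M * hh μ y) * kap μ x y) atTop
      (𝓝 (f x * f y * kap μ x y)) := by
    intro x y
    have hsup : ∀ z, ⨆ M : ℕ, min (f z) (M * hh μ z) = f z := fun z =>
      tendsto_nhds_unique (tendsto_atTop_iSup (mono z)) (lim1 z)
    have h1 := tendsto_atTop_iSup (kmono x y)
    convert h1 using 2
    rw [← ENNReal.iSup_mul]
    congr 1
    refine le_antisymm ?_ (iSup_le fun M => mul_le_mul' (min_le_left _ _) (min_le_left _ _))
    conv_lhs => rw [← hsup x, ← hsup y]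
    rw [ENNReal.iSup_mul]
    refine iSup_le fun i => ?_
    rw [ENNReal.mul_iSup]
    refine iSup_le fun j => ?_
    refine le_trans ?_ (le_iSup _ (max i j))
    exact mul_le_mul' (mono x (le_max_left i j)) (mono y (le_max_right i j))
  have hQ : Tendsto (fun M : ℕ => QQ μ (fun x => min (f x) (M * hh μ x)) (fun x => min (f x) (M * hh μ x))) atTop
      (𝓝 (QQ μ f f)) := by
    unfold QQ
    have mk : ∀ x : EE n, Measurable (fun y => kap μ x y) := fun x => by unfold kap; fun_prop
    refine lintegral_tendsto_of_tendsto_of_monotone (fun M => ?_) (Eventually.of_forall fun x => ?_)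
      (Eventually.of_forall fun x => ?_)
    · apply Measurable.aemeasurable
      exact Measurable.lintegral_prod_right' (f := fun q : EE n × EE n => min (f q.1) (M * hh μ q.1) *
        min (f q.2) (M * hh μ q.2) * kap μ q.1 q.2) (by fun_prop)
    · intro M M' h
      exact lintegral_mono fun y => kmono x y h
    · refine lintegral_tendsto_of_tendsto_of_monotone (fun M => ?_) (Eventually.of_forall fun y => kmono x y)
        (Eventually.of_forall fun y => klim x y)
      have := mk x
      fun_prop
  exact le_of_tendsto' (ENNReal.Tendsto.const_mul hQ (Or.inr II_lt_top.ne)) step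

end HLS

namespace HLS
open EuclideanGeometry Set Filter Topology
variable {n : ℕ}

noncomputable def Ph (β : ℝ) (x : EE n) (q : ℝ × EE n) : ℝ≥0∞ :=
  ENNReal.ofReal (q.1 ^ β * Real.exp (-(2 * q.1) * ‖x - q.2‖ ^ 2))

noncomputable def mm (n : ℕ) : Measure (ℝ × EE n) := (volume.restrict (Ioi (0:ℝ))).prod volume

instance : SFinite (mm n) := by unfold mm; infer_instance

theorem measurable_Ph (β : ℝ) : Measurable (fun q : EE n × (ℝ × EE n) => Ph β q.1 q.2) := by
  unfold Ph; fun_prop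

theorem gauss_lint (t : ℝ) (ht : 0 < t) (m : EE n) :
    ∫⁻ z : EE n, ENNReal.ofReal (Real.exp (-t * ‖z - m‖ ^ 2)) =
      ENNReal.ofReal ((Real.pi / t) ^ (n / 2 : ℝ)) := by
  have h := GaussianFourier.integral_rexp_neg_mul_sq_norm (V := EE n) ht
  rw [lintegral_sub_right_eq_self (fun z => ENNReal.ofReal (Real.exp (-t * ‖z‖ ^ 2))) m,
    ← ofReal_integral_eq_lintegral_ofReal, h]
  · simp
  · by_contra hc
    have := integral_undef hc
    rw [this] at h
    have : 0 < (Real.pi / t) ^ (Module.finrank ℝ (EE n) / 2 : ℝ) := by positivity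
    linarith
  · exact Eventually.of_forall fun z => (Real.exp_pos _).le

theorem Ph_int {μ : ℝ} (hμ : 0 < μ) : ∃ C : ℝ≥0∞, C ≠ 0 ∧ C ≠ ⊤ ∧ ∀ x y : EE n, x ≠ y →
    ∫⁻ q, Ph ((n / 2 + μ / 2 - 1) / 2) x q * Ph ((n / 2 + μ / 2 - 1) / 2) y q ∂(mm n) = C * kap μ x y := by
  refine ⟨ENNReal.ofReal ((Real.pi / 4) ^ (n / 2 : ℝ) * Real.Gamma (μ / 2)), ?_, ENNReal.ofReal_ne_top, ?_⟩
  · have := Real.Gamma_pos_of_pos (half_pos hμ)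
    simp; positivity
  intro x y hxy
  set β : ℝ := (n / 2 + μ / 2 - 1) / 2 with hβ
  have hd : 0 < ‖x - y‖ := norm_pos_iff.2 (sub_ne_zero.2 hxy)
  rw [mm, lintegral_prod _ (by
    have := measurable_Ph (n := n) β
    exact Measurable.aemeasurable (by fun_prop))]
  have inner : ∀ t ∈ Ioi (0:ℝ), ∫⁻ z, Ph β x (t, z) * Ph β y (t, z) =
      ENNReal.ofReal ((Real.pi / 4) ^ (n / 2 : ℝ) * (t ^ (μ / 2 - 1) * Real.exp (-(‖x - y‖ ^ 2 * t)))) := by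
    intro t ht
    have ht : 0 < t := ht
    have e : ∀ z : EE n, Ph β x (t, z) * Ph β y (t, z) =
        ENNReal.ofReal (t ^ (2 * β) * Real.exp (-(‖x - y‖ ^ 2 * t))) *
          ENNReal.ofReal (Real.exp (-(4 * t) * ‖z - (1 / 2 : ℝ) • (x + y)‖ ^ 2)) := by
      intro z
      have h2 : ‖z - (1 / 2 : ℝ) • (x + y)‖ ^ 2 = (‖x - z‖ ^ 2 + ‖y - z‖ ^ 2) / 2 - ‖x - y‖ ^ 2 / 4 := by
        have e1 : z - (1 / 2 : ℝ) • (x + y) = -((1 / 2 : ℝ) • ((x - z) + (y - z))) := by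
          module
        have e2 : x - y = (x - z) - (y - z) := by abel
        rw [e1, e2, norm_neg, norm_smul, mul_pow, norm_add_sq_real, norm_sub_sq_real (x - z) (y - z)]
        norm_num; ring
      unfold Ph
      rw [← ENNReal.ofReal_mul (by positivity), ← ENNReal.ofReal_mul (by positivity), h2]
      congr 1
      simp only
      rw [show t ^ (2 * β) = t ^ β * t ^ β by rw [← Real.rpow_add ht]; ring_nf]
      rw [mul_mul_mul_comm, mul_assoc (t ^ β * t ^ β), ← Real.exp_add, ← Real.exp_add]
      congr 2
      ring
    simp_rw [e]
    rw [lintegral_const_mul' _ _ ENNReal.ofReal_ne_top, gauss_lint _ (by positivity),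
      ← ENNReal.ofReal_mul (by positivity)]
    congr 1
    rw [show Real.pi / (4 * t) = (Real.pi / 4) * t⁻¹ by field_simp, Real.mul_rpow (by positivity) (by positivity),
      Real.inv_rpow ht.le, ← Real.rpow_neg ht.le,
      show μ / 2 - 1 = 2 * β + -(n / 2 : ℝ) by rw [hβ]; ring, Real.rpow_add ht]
    ring
  rw [setLIntegral_congr_fun measurableSet_Ioi inner]
  have hG := Real.integral_rpow_mul_exp_neg_mul_Ioi (half_pos hμ) (show 0 < ‖x - y‖ ^ 2 by positivity)
  have hGp := Real.Gamma_pos_of_pos (half_pos hμ)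
  have hval : 0 < (1 / ‖x - y‖ ^ 2) ^ (μ / 2) * Real.Gamma (μ / 2) := by positivity
  rw [← ofReal_integral_eq_lintegral_ofReal, integral_const_mul, hG, kap,
    ENNReal.ofReal_rpow_of_pos (by positivity), ← ENNReal.ofReal_mul (by positivity)]
  · congr 1
    rw [one_div, Real.inv_rpow (by positivity), ← Real.rpow_neg (by positivity)]; ring
  · refine Integrable.const_mul ?_ _
    by_contra hc
    rw [integral_undef hc] at hG
    linarith
  · filter_upwards [ae_restrict_mem measurableSet_Ioi] with t ht
    have ht : 0 < t := ht
    positivity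

theorem QQ_posdef [NeZero n] {μ : ℝ} (hμ : 0 < μ) {a b : EE n → ℝ≥0∞} (ha : Measurable a) (hb : Measurable b) :
    2 * QQ μ a b ≤ QQ μ a a + QQ μ b b := by
  obtain ⟨C, hC0, hCt, hC⟩ := Ph_int (n := n) hμ
  set β : ℝ := (n / 2 + μ / 2 - 1) / 2
  have mP := measurable_Ph (n := n) β
  have mPx : ∀ x, Measurable (fun q => Ph (n := n) β x q) := fun x => by unfold Ph; fun_prop
  have mPq : ∀ q, Measurable (fun x => Ph (n := n) β x q) := fun q => by unfold Ph; fun_prop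
  have rep : ∀ f g : EE n → ℝ≥0∞, Measurable f → Measurable g →
      C * QQ μ f g = ∫⁻ q, (∫⁻ x, f x * Ph β x q) * (∫⁻ y, g y * Ph β y q) ∂(mm n) := by
    intro f g hf hg
    have mG : Measurable (fun q => ∫⁻ y, g y * Ph β y q) :=
      Measurable.lintegral_prod_left' (f := fun q : EE n × (ℝ × EE n) => g q.1 * Ph β q.1 q.2) (by fun_prop)
    calc C * QQ μ f g = ∫⁻ x, ∫⁻ y, ∫⁻ q, f x * Ph β x q * (g y * Ph β y q) ∂(mm n) := by
          rw [QQ, ← lintegral_const_mul' _ _ hCt]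
          refine lintegral_congr fun x => ?_
          rw [← lintegral_const_mul' _ _ hCt]
          refine lintegral_congr_ae ?_
          filter_upwards [ae_ne x] with y hy
          have := mPx x
          have := mPx y
          calc C * (f x * g y * kap μ x y) = f x * g y * (C * kap μ x y) := by ring
            _ = _ := by
              rw [← hC x y hy.symm, ← lintegral_const_mul _ (by fun_prop)]
              refine lintegral_congr fun q => ?_
              ring
      _ = ∫⁻ x, ∫⁻ q, f x * Ph β x q * (∫⁻ y, g y * Ph β y q) ∂(mm n) := by
          refine lintegral_congr fun x => ?_
          have := mPx x
          rw [lintegral_lintegral_swap (Measurable.aemeasurable (by fun_prop))]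
          refine lintegral_congr fun q => ?_
          have := mPq q
          rw [lintegral_const_mul _ (by fun_prop)]
      _ = _ := by
          rw [lintegral_lintegral_swap (Measurable.aemeasurable (by fun_prop))]
          refine lintegral_congr fun q => ?_
          have := mPq q
          rw [lintegral_mul_const _ (by fun_prop)]
  have h : C * (2 * QQ μ a b) ≤ C * (QQ μ a a + QQ μ b b) := by
    rw [mul_add, rep a a ha ha, rep b b hb hb, mul_left_comm, rep a b ha hb]
    have mG : ∀ g : EE n → ℝ≥0∞, Measurable g → Measurable (fun q => ∫⁻ y, g y * Ph β y q) := fun g hg =>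
      Measurable.lintegral_prod_left' (f := fun q : EE n × (ℝ × EE n) => g q.1 * Ph β q.1 q.2) (by fun_prop)
    have := mG a ha
    have := mG b hb
    rw [← lintegral_const_mul _ (by fun_prop), ← lintegral_add_left (by fun_prop)]
    refine lintegral_mono fun q => ?_
    set A := ∫⁻ x, a x * Ph β x q
    set B := ∫⁻ x, b x * Ph β x q
    change 2 * (A * B) ≤ A * A + B * B
    rcases le_total A B with h | h
    · obtain ⟨d, hd⟩ : ∃ d, B = A + d := exists_add_of_le h
      rw [hd]
      calc 2 * (A * (A + d)) ≤ 2 * (A * (A + d)) + d * d := le_self_add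
        _ = _ := by ring
    · obtain ⟨d, hd⟩ : ∃ d, A = B + d := exists_add_of_le h
      rw [hd]
      calc 2 * ((B + d) * B) ≤ 2 * ((B + d) * B) + d * d := le_self_add
        _ = _ := by ring
  exact (ENNReal.mul_le_mul_iff_right hC0 hCt).1 h

end HLS

namespace HLS
open EuclideanGeometry Set Filter Topology
variable {n : ℕ}

noncomputable def kr (μ : ℝ) (x y : EE n) : ℝ := (kap μ x y).toReal

theorem kr_nonneg (μ : ℝ) (x y : EE n) : 0 ≤ kr μ x y := ENNReal.toReal_nonneg

theorem kr_symm (μ : ℝ) (x y : EE n) : kr μ x y = kr μ y x := by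
  unfold kr kap; rw [norm_sub_rev]

theorem kr_ofReal (μ : ℝ) {x y : EE n} (h : x ≠ y) : ENNReal.ofReal (kr μ x y) = kap μ x y := by
  have hd : 0 < ‖x - y‖ := norm_pos_iff.2 (sub_ne_zero.2 h)
  refine ENNReal.ofReal_toReal ?_
  unfold kap
  rw [ENNReal.ofReal_rpow_of_pos (by positivity)]
  exact ENNReal.ofReal_ne_top

theorem kr_le (μ : ℝ) (x y : EE n) : ENNReal.ofReal (kr μ x y) ≤ kap μ x y :=
  ENNReal.ofReal_toReal_le

theorem kr_eq (μ : ℝ) {x y : EE n} (h : x ≠ y) : kr μ x y = ‖x - y‖ ^ (-μ) := by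
  have hd : 0 < ‖x - y‖ := norm_pos_iff.2 (sub_ne_zero.2 h)
  unfold kr kap
  rw [ENNReal.ofReal_rpow_of_pos (by positivity), ENNReal.toReal_ofReal (by positivity),
    ← Real.rpow_natCast, ← Real.rpow_mul hd.le]
  congr 1; push_cast; ring

theorem measurable_kr (μ : ℝ) : Measurable (fun q : EE n × EE n => kr μ q.1 q.2) := by
  unfold kr
  exact (measurable_kap μ).ennreal_toReal

theorem bound_hh (μ : ℝ) {f : EE n → ℝ} (hf : Continuous f) (hc : HasCompactSupport f) :
    ∃ C : ℝ≥0∞, C ≠ ⊤ ∧ ∀ x, ENNReal.ofReal |f x| ≤ C * hh μ x := by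
  have hcont : Continuous (fun x : EE n => f x * (ww x ^ ((n:ℝ) - μ / 2))⁻¹) := by
    refine hf.mul (Continuous.inv₀ (ww_cont.rpow_const fun x => Or.inl (ww_pos x).ne') fun x => ?_)
    exact (Real.rpow_pos_of_pos (ww_pos x) _).ne'
  obtain ⟨C, hC⟩ := (hc.mul_right (f' := fun x : EE n => (ww x ^ ((n:ℝ) - μ / 2))⁻¹)).exists_bound_of_continuous hcont
  refine ⟨ENNReal.ofReal C, ENNReal.ofReal_ne_top, fun x => ?_⟩
  have hp := Real.rpow_pos_of_pos (ww_pos x) ((n:ℝ) - μ / 2)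
  unfold hh
  rw [ENNReal.ofReal_rpow_of_pos (ww_pos x), ← ENNReal.ofReal_mul' hp.le]
  refine ENNReal.ofReal_le_ofReal ?_
  have := hC x
  rw [Pi.mul_apply, norm_mul, norm_inv, Real.norm_eq_abs, Real.norm_of_nonneg hp.le, ← div_eq_mul_inv, div_le_iff₀ hp] at this
  exact this

theorem QQ_fin [NeZero n] {μ : ℝ} (hμ : 0 < μ) (hμn : μ < n) {f g : EE n → ℝ}
    (hf : Continuous f) (hfc : HasCompactSupport f) (hg : Continuous g) (hgc : HasCompactSupport g) :
    QQ μ (fun x => ENNReal.ofReal |f x|) (fun x => ENNReal.ofReal |g x|) < ⊤ := by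
  obtain ⟨C, hC, h1⟩ := bound_hh μ hf hfc
  obtain ⟨D, hD, h2⟩ := bound_hh μ hg hgc
  have : QQ μ (fun x => ENNReal.ofReal |f x|) (fun x => ENNReal.ofReal |g x|) ≤ C * D * QQ μ (hh (n := n) μ) (hh μ) := by
    unfold QQ
    rw [← lintegral_const_mul' _ _ (by finiteness)]
    refine lintegral_mono fun x => ?_
    beta_reduce
    rw [← lintegral_const_mul' _ _ (by finiteness)]
    refine lintegral_mono fun y => ?_
    beta_reduce
    calc ENNReal.ofReal |f x| * ENNReal.ofReal |g y| * kap μ x y ≤ (C * hh μ x) * (D * hh μ y) * kap μ x y := by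
          gcongr <;> simp only [h1, h2]
      _ = _ := by ring
  refine this.trans_lt ?_
  rw [QQ_hh hμ]
  have := ka_lt_top (n := n) hμ hμn
  have := II_lt_top (n := n)
  finiteness

noncomputable def Br (μ : ℝ) (f g : EE n → ℝ) : ℝ := ∫ q : EE n × EE n, f q.1 * g q.2 * kr μ q.1 q.2

theorem Br_lint [NeZero n] {μ : ℝ} {f g : EE n → ℝ} (hf : Measurable f) (hg : Measurable g) :
    ∫⁻ q : EE n × EE n, ENNReal.ofReal |f q.1 * g q.2 * kr μ q.1 q.2| =
      QQ μ (fun x => ENNReal.ofReal |f x|) (fun x => ENNReal.ofReal |g x|) := by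
  have := measurable_kr (n := n) μ
  rw [Measure.volume_eq_prod, lintegral_prod _ (by fun_prop), QQ]
  refine lintegral_congr fun x => lintegral_congr_ae ?_
  filter_upwards [ae_ne x] with y hy
  rw [← kr_ofReal μ hy.symm, abs_mul, abs_mul, ENNReal.ofReal_mul (by positivity), ENNReal.ofReal_mul (by positivity),
    abs_of_nonneg (kr_nonneg _ _ _)]

theorem Br_integrable [NeZero n] {μ : ℝ} (hμ : 0 < μ) (hμn : μ < n) {f g : EE n → ℝ}
    (hf : Continuous f) (hfc : HasCompactSupport f) (hg : Continuous g) (hgc : HasCompactSupport g) :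
    Integrable (fun q : EE n × EE n => f q.1 * g q.2 * kr μ q.1 q.2) := by
  have := measurable_kr (n := n) μ
  have hf' := hf.measurable
  have hg' := hg.measurable
  refine ⟨Measurable.aestronglyMeasurable (by fun_prop), ?_⟩
  rw [hasFiniteIntegral_iff_norm]
  simp only [Real.norm_eq_abs]
  rw [Br_lint hf.measurable hg.measurable]
  exact QQ_fin hμ hμn hf hfc hg hgc

theorem Br_of_nonneg [NeZero n] {μ : ℝ} {f g : EE n → ℝ}
    (hf : Continuous f) (hg : Continuous g) (hf0 : ∀ x, 0 ≤ f x) (hg0 : ∀ x, 0 ≤ g x) :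
    Br μ f g = (QQ μ (fun x => ENNReal.ofReal |f x|) (fun x => ENNReal.ofReal |g x|)).toReal := by
  have := measurable_kr (n := n) μ
  have hf' := hf.measurable
  have hg' := hg.measurable
  have hnn : ∀ q : EE n × EE n, 0 ≤ f q.1 * g q.2 * kr μ q.1 q.2 := fun q =>
    mul_nonneg (mul_nonneg (hf0 _) (hg0 _)) (kr_nonneg _ _ _)
  rw [← Br_lint hf.measurable hg.measurable, Br, integral_eq_lintegral_of_nonneg_ae (Eventually.of_forall hnn)
    (Measurable.aestronglyMeasurable (by fun_prop))]
  congr 1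
  refine lintegral_congr fun q => ?_
  rw [abs_of_nonneg (hnn q)]

theorem Br_symm {μ : ℝ} (f g : EE n → ℝ) : Br μ f g = Br μ g f := by
  unfold Br
  rw [Measure.volume_eq_prod, ← integral_prod_swap]
  refine integral_congr_ae (Eventually.of_forall fun q => ?_)
  simp only [Prod.fst_swap, Prod.snd_swap]
  rw [kr_symm]; ring

theorem Br_expand [NeZero n] {μ : ℝ} (hμ : 0 < μ) (hμn : μ < n) {f g : EE n → ℝ}
    (hf : Continuous f) (hfc : HasCompactSupport f) (hg : Continuous g) (hgc : HasCompactSupport g) (s : ℝ) :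
    Br μ (fun x => f x - s * g x) (fun x => f x - s * g x) = Br μ f f - 2 * s * Br μ f g + s ^ 2 * Br μ g g := by
  have i1 := Br_integrable hμ hμn hf hfc hf hfc
  have i2 := Br_integrable hμ hμn hf hfc hg hgc
  have i3 := Br_integrable hμ hμn hg hgc hf hfc
  have i4 := Br_integrable hμ hμn hg hgc hg hgc
  have : Br μ (fun x => f x - s * g x) (fun x => f x - s * g x) = Br μ f f - (s * Br μ f g + s * Br μ g f) + s ^ 2 * Br μ g g := by
    have k := integral_add' (i1.sub ((i2.const_mul s).add (i3.const_mul s))) (i4.const_mul (s ^ 2))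
    rw [integral_sub' i1 ((i2.const_mul s).add (i3.const_mul s)), integral_add' (i2.const_mul s) (i3.const_mul s),
      integral_const_mul, integral_const_mul, integral_const_mul] at k
    unfold Br
    rw [← k]
    refine integral_congr_ae (Eventually.of_forall fun q => ?_)
    simp only [Pi.add_apply, Pi.sub_apply]
    ring
  rw [this, Br_symm g f]; ring

theorem Br_nonneg [NeZero n] {μ : ℝ} (hμ : 0 < μ) (hμn : μ < n) {f : EE n → ℝ}
    (hf : Continuous f) (hfc : HasCompactSupport f) : 0 ≤ Br μ f f := by
  set p : EE n → ℝ := fun x => max (f x) 0 with hp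
  set m : EE n → ℝ := fun x => max (- f x) 0 with hm
  have hpc : Continuous p := hf.max continuous_const
  have hmc : Continuous m := hf.neg.max continuous_const
  have hps : HasCompactSupport p := hfc.comp_left (g := fun t => max t 0) (by simp)
  have hms : HasCompactSupport m := hfc.comp_left (g := fun t => max (-t) 0) (by simp)
  have hp0 : ∀ x, 0 ≤ p x := fun x => le_max_right _ _
  have hm0 : ∀ x, 0 ≤ m x := fun x => le_max_right _ _
  have e : f = fun x => p x - 1 * m x := by
    funext x; simp only [hp, hm, one_mul]
    rcases le_total (f x) 0 with h | h
    · rw [max_eq_right h, max_eq_left (by linarith)]; ring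
    · rw [max_eq_left h, max_eq_right (by linarith)]; ring
  rw [e, Br_expand hμ hμn hpc hps hmc hms, Br_of_nonneg hpc hpc hp0 hp0, Br_of_nonneg hpc hmc hp0 hm0,
    Br_of_nonneg hmc hmc hm0 hm0]
  have h := QQ_posdef hμ (a := fun x => ENNReal.ofReal |p x|) (b := fun x => ENNReal.ofReal |m x|)
    (by have := hpc.measurable; fun_prop) (by have := hmc.measurable; fun_prop)
  have h1 := QQ_fin hμ hμn hpc hps hpc hps
  have h3 := QQ_fin hμ hμn hmc hms hmc hms
  have h4 := ENNReal.toReal_mono (by finiteness) h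
  rw [ENNReal.toReal_add h1.ne h3.ne, ENNReal.toReal_mul] at h4
  simp only [ENNReal.toReal_ofNat] at h4
  linarith

theorem Br_cs [NeZero n] {μ : ℝ} (hμ : 0 < μ) (hμn : μ < n) {f g : EE n → ℝ}
    (hf : Continuous f) (hfc : HasCompactSupport f) (hg : Continuous g) (hgc : HasCompactSupport g) :
    Br μ f g ^ 2 ≤ Br μ f f * Br μ g g := by
  have h : ∀ s : ℝ, 0 ≤ Br μ g g * (s * s) + (-2 * Br μ f g) * s + Br μ f f := fun s => by
    have := Br_nonneg hμ hμn (f := fun x => f x - s * g x) (hf.sub (continuous_const.mul hg))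
      (hfc.sub (hgc.mul_left (f := fun _ => s)))
    rw [Br_expand hμ hμn hf hfc hg hgc] at this
    linarith
  have := discrim_le_zero h
  unfold discrim at this
  linarith

theorem Br_le_QQ [NeZero n] {μ : ℝ} (hμ : 0 < μ) (hμn : μ < n) {f : EE n → ℝ}
    (hf : Continuous f) (hfc : HasCompactSupport f) :
    ENNReal.ofReal (Br μ f f) ≤ QQ μ (fun x => ENNReal.ofReal |f x|) (fun x => ENNReal.ofReal |f x|) := by
  rw [← Br_lint hf.measurable hf.measurable]
  have := ofReal_integral_eq_lintegral_ofReal (Br_integrable hμ hμn hf hfc hf hfc).abs (Eventually.of_forall fun q => abs_nonneg _)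
  beta_reduce at this
  rw [← this]
  exact ENNReal.ofReal_le_ofReal ((le_abs_self _).trans abs_integral_le_integral_abs)

end HLS

namespace HLS
open EuclideanGeometry Set Filter Topology
variable {n : ℕ}

noncomputable def dd (i : Fin n) (u : EE n → ℝ) (x : EE n) : ℝ := fderiv ℝ u x (EuclideanSpace.single i 1)
noncomputable def lap (u : EE n → ℝ) (x : EE n) : ℝ := ∑ i, dd i (dd i u) x

theorem norm_sq_dual (L : StrongDual ℝ (EE n)) : ‖L‖ ^ 2 = ∑ i, (L (EuclideanSpace.single i 1)) ^ 2 := by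
  obtain ⟨v, rfl⟩ := (InnerProductSpace.toDual ℝ (EE n)).surjective L
  rw [LinearIsometryEquiv.norm_map, EuclideanSpace.norm_sq_eq]
  refine Finset.sum_congr rfl fun i _ => ?_
  rw [InnerProductSpace.toDual_apply_apply, EuclideanSpace.inner_single_right]
  simp

theorem dd_smooth (i : Fin n) {u : EE n → ℝ} (hu : ContDiff ℝ (⊤ : ℕ∞) u) : ContDiff ℝ (⊤ : ℕ∞) (dd i u) := by
  have h : ContDiff ℝ (⊤ : ℕ∞) (fderiv ℝ u) := hu.fderiv_right (by norm_cast)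
  exact h.clm_apply contDiff_const

theorem dd_supp (i : Fin n) {u : EE n → ℝ} (hu : HasCompactSupport u) : HasCompactSupport (dd i u) :=
  hu.fderiv_apply ℝ _

theorem lap_smooth {u : EE n → ℝ} (hu : ContDiff ℝ (⊤ : ℕ∞) u) : ContDiff ℝ (⊤ : ℕ∞) (lap u) := by
  unfold lap
  exact ContDiff.sum fun i _ => dd_smooth i (dd_smooth i hu)

theorem lap_supp {u : EE n → ℝ} (hu : HasCompactSupport u) : HasCompactSupport (lap u) := by
  have : lap u = ∑ i, dd i (dd i u) := by funext x; simp [lap]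
  rw [this]
  have H : ∀ s : Finset (Fin n), HasCompactSupport (∑ i ∈ s, dd i (dd i u)) := by
    intro s
    classical
    induction s using Finset.induction_on with
    | empty => simp [HasCompactSupport.zero]
    | insert a s ha ih => rw [Finset.sum_insert ha]; exact (dd_supp a (dd_supp a hu)).add ih
  exact H _

theorem int_cs {f g : EE n → ℝ} (hf : Continuous f) (hg : Continuous g) (hgc : HasCompactSupport g) :
    Integrable (fun x => f x * g x) :=
  (hf.mul hg).integrable_of_hasCompactSupport (hgc.mul_left)

theorem ibp (i : Fin n) {v u : EE n → ℝ} (hv : ContDiff ℝ (⊤ : ℕ∞) v) (hu : ContDiff ℝ (⊤ : ℕ∞) u)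
    (huc : HasCompactSupport u) : ∫ x, v x * dd i u x = - ∫ x, dd i v x * u x := by
  refine integral_mul_fderiv_eq_neg_fderiv_mul_of_integrable ?_ ?_ ?_ ?_ ?_
  · exact int_cs (dd_smooth i hv).continuous hu.continuous huc
  · exact int_cs hv.continuous (dd_smooth i hu).continuous (dd_supp i huc)
  · exact int_cs hv.continuous hu.continuous huc
  · exact fun x _ => hv.differentiable (by simp) x
  · exact fun x _ => hu.differentiable (by simp) x

theorem energy {u : EE n → ℝ} (hu : ContDiff ℝ (⊤ : ℕ∞) u) (huc : HasCompactSupport u) :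
    ∫ x, ‖fderiv ℝ u x‖ ^ 2 = - ∫ x, lap u x * u x := by
  have e : ∀ x, ‖fderiv ℝ u x‖ ^ 2 = ∑ i, dd i u x * dd i u x := fun x => by
    rw [norm_sq_dual]; simp only [dd, sq]
  simp_rw [e, lap, Finset.sum_mul]
  rw [integral_finsetSum, integral_finsetSum, ← Finset.sum_neg_distrib]
  · exact Finset.sum_congr rfl fun i _ => ibp i (dd_smooth i hu) hu huc
  · exact fun i _ => int_cs (dd_smooth i (dd_smooth i hu)).continuous hu.continuous huc
  · exact fun i _ => int_cs (dd_smooth i hu).continuous (dd_smooth i hu).continuous (dd_supp i huc)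

theorem green {v u : EE n → ℝ} (hv : ContDiff ℝ (⊤ : ℕ∞) v) (hu : ContDiff ℝ (⊤ : ℕ∞) u) (huc : HasCompactSupport u) :
    ∫ x, v x * lap u x = ∫ x, lap v x * u x := by
  simp_rw [lap, Finset.sum_mul, Finset.mul_sum]
  rw [integral_finsetSum, integral_finsetSum]
  · refine Finset.sum_congr rfl fun i _ => ?_
    rw [ibp i hv (dd_smooth i hu) (dd_supp i huc), ibp i (dd_smooth i hv) hu huc, neg_neg]
  · exact fun i _ => int_cs (dd_smooth i (dd_smooth i hv)).continuous hu.continuous huc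
  · exact fun i _ => int_cs hv.continuous (dd_smooth i (dd_smooth i hu)).continuous (dd_supp i (dd_supp i huc))

/-- regularised fundamental solution -/
noncomputable def vv (s ε : ℝ) (a x : EE n) : ℝ := (ε ^ 2 + ‖x - a‖ ^ 2) ^ s

theorem vv_base_pos {ε : ℝ} (hε : 0 < ε) (a x : EE n) : 0 < ε ^ 2 + ‖x - a‖ ^ 2 := by positivity

theorem vv_smooth (s : ℝ) {ε : ℝ} (hε : 0 < ε) (a : EE n) : ContDiff ℝ (⊤ : ℕ∞) (vv s ε a) := by
  unfold vv
  refine ContDiff.rpow_const_of_ne ?_ fun x => (vv_base_pos hε a x).ne'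
  exact contDiff_const.add ((contDiff_id.sub contDiff_const).norm_sq ℝ)

theorem vv_fderiv (s : ℝ) {ε : ℝ} (hε : 0 < ε) (a x : EE n) :
    HasFDerivAt (vv s ε a) ((s * vv (s - 1) ε a x) • (2 • innerSL ℝ (x - a))) x := by
  have h0 : HasFDerivAt (fun x : EE n => x - a) (ContinuousLinearMap.id ℝ (EE n)) x := (hasFDerivAt_id x).sub_const a
  have h1 := (h0.norm_sq.const_add (ε ^ 2)).rpow_const (p := s) (Or.inl (vv_base_pos hε a x).ne')
  exact h1

theorem dd_vv (i : Fin n) (s : ℝ) {ε : ℝ} (hε : 0 < ε) (a : EE n) :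
    dd i (vv s ε a) = fun x => 2 * s * (vv (s - 1) ε a x * (x i - a i)) := by
  funext x
  rw [dd, (vv_fderiv s hε a x).fderiv]
  simp [EuclideanSpace.inner_single_right]
  ring

theorem dd_dd_vv (i : Fin n) (s : ℝ) {ε : ℝ} (hε : 0 < ε) (a x : EE n) :
    dd i (dd i (vv s ε a)) x = 2 * s * vv (s - 1) ε a x + 4 * s * (s - 1) * vv (s - 2) ε a x * (x i - a i) ^ 2 := by
  rw [dd_vv i s hε a, dd]
  have hc : HasFDerivAt (fun x : EE n => x i - a i) (EuclideanSpace.proj i : EE n →L[ℝ] ℝ) x :=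
    ((EuclideanSpace.proj i : EE n →L[ℝ] ℝ).hasFDerivAt).sub_const (a i)
  have h := ((vv_fderiv (s - 1) hε a x).mul hc).const_mul (2 * s)
  have h' : HasFDerivAt (fun x => 2 * s * (vv (s - 1) ε a x * (x i - a i))) _ x := h
  rw [h'.fderiv]
  simp [EuclideanSpace.inner_single_right]
  rw [show s - 1 - 1 = s - 2 by ring]
  ring

theorem lap_vv {ε : ℝ} (hε : 0 < ε) (a x : EE n) :
    lap (vv (-((n - 2 : ℝ) / 2)) ε a) x = -(n * (n - 2) * ε ^ 2 * vv (-((n + 2 : ℝ) / 2)) ε a x) := by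
  simp only [lap, dd_dd_vv _ _ hε]
  rw [Finset.sum_add_distrib, ← Finset.mul_sum, ← Finset.mul_sum]
  have hn : ∑ i, (x i - a i) ^ 2 = ‖x - a‖ ^ 2 := by rw [EuclideanSpace.norm_sq_eq]; simp
  rw [hn]
  have hb := vv_base_pos hε a x
  have e : vv (-((n - 2 : ℝ) / 2) - 1) ε a x = vv (-((n + 2 : ℝ) / 2)) ε a x * (ε ^ 2 + ‖x - a‖ ^ 2) := by
    unfold vv
    rw [← Real.rpow_add_one hb.ne']; congr 1; ring
  have e2 : vv (-((n - 2 : ℝ) / 2) - 2) ε a x = vv (-((n + 2 : ℝ) / 2)) ε a x := by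
    unfold vv; congr 1; ring
  simp only [Finset.sum_const, Finset.card_univ, Fintype.card_fin, nsmul_eq_mul]
  rw [e, e2]; ring

end HLS

namespace HLS
open EuclideanGeometry Set Filter Topology
variable {n : ℕ}

theorem pot_integrable [NeZero n] {μ : ℝ} (hμ : 0 < μ) (hμn : μ < n) {g : EE n → ℝ}
    (hg : Continuous g) (hgc : HasCompactSupport g) (x : EE n) : Integrable (fun y => g y * kr μ x y) := by
  obtain ⟨D, hD, h2⟩ := bound_hh μ hg hgc
  have mk : Measurable (fun y => kr μ x y) := (mk1 μ x).ennreal_toReal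
  have := hg.measurable
  refine ⟨Measurable.aestronglyMeasurable (by fun_prop), ?_⟩
  rw [hasFiniteIntegral_iff_norm]
  have : ∫⁻ y, ENNReal.ofReal ‖g y * kr μ x y‖ ≤ D * ∫⁻ y, hh μ y * kap μ x y := by
    rw [← lintegral_const_mul' _ _ hD]
    refine lintegral_mono fun y => ?_
    beta_reduce
    rw [norm_mul, ENNReal.ofReal_mul (norm_nonneg _), Real.norm_eq_abs, Real.norm_of_nonneg (kr_nonneg _ _ _), ← mul_assoc]
    exact mul_le_mul' (h2 y) (kr_le μ x y)
  refine this.trans_lt ?_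
  rw [hh_kap hμ]
  exact ENNReal.mul_lt_top hD.lt_top (ENNReal.mul_lt_top (ka_lt_top hμ hμn) (om_ne_top μ x).lt_top)

noncomputable def AA (n : ℕ) : ℝ := ∫ x : EE n, ww x ^ ((n + 2 : ℝ) / 2)

theorem AA_int : Integrable (fun x : EE n => ww x ^ ((n + 2 : ℝ) / 2)) := ww_rpow_int (by linarith)

theorem AA_pos : 0 < AA n := by
  unfold AA
  rw [integral_pos_iff_support_of_nonneg (fun x => (Real.rpow_pos_of_pos (ww_pos x) _).le) AA_int]
  have : Function.support (fun x : EE n => ww x ^ ((n + 2 : ℝ) / 2)) = univ :=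
    eq_univ_of_forall fun x => (Real.rpow_pos_of_pos (ww_pos x) _).ne'
  rw [this]; exact Measure.measure_univ_pos.2 (NeZero.ne _)

theorem ka_AA [NeZero n] (hn : 3 ≤ n) : ka n (n - 2) = ENNReal.ofReal (AA n) := by
  have hn' : (3:ℝ) ≤ n := by exact_mod_cast hn
  rw [AA, ofReal_integral_eq_lintegral_ofReal AA_int (Eventually.of_forall fun x => (Real.rpow_pos_of_pos (ww_pos x) _).le)]
  rw [lintegral_inv (0 : EE n) one_ne_zero, ka_eq]
  refine lintegral_congr_ae ?_
  filter_upwards [ae_ne (0 : EE n)] with x hx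
  have hx' : 0 < ‖x‖ := norm_pos_iff.2 hx
  have hw : ww (inversion 0 1 x) = ‖x‖ ^ 2 * ww x := by
    have := norm_inv_sub_sq (a := (0 : EE n)) (r := 1) hx
    simp only [sub_zero] at this
    unfold ww
    rw [this]; field_simp; try ring
  have hj : jj 0 1 x = (‖x‖ ^ 2)⁻¹ := by simp [jj]
  have hwp := ww_pos x
  rw [hw, hj, ENNReal.ofReal_rpow_of_pos hwp, ENNReal.ofReal_rpow_of_pos (by positivity), ENNReal.ofReal_rpow_of_pos (by positivity),
    ← ENNReal.ofReal_mul (by positivity), ← ENNReal.ofReal_mul (by positivity)]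
  congr 1
  rw [Real.mul_rpow (by positivity) hwp.le, Real.inv_rpow (by positivity), ← Real.rpow_neg (by positivity), ← mul_assoc,
    ← Real.rpow_add (by positivity), mul_comm]
  congr 2 <;> ring

theorem green_rep [NeZero n] (hn : 3 ≤ n) {u : EE n → ℝ} (hu : ContDiff ℝ (⊤ : ℕ∞) u) (huc : HasCompactSupport u)
    (x : EE n) : ∫ y, lap u y * kr (n - 2) x y = -(n * (n - 2) * AA n * u x) := by
  have hn' : (3:ℝ) ≤ n := by exact_mod_cast hn
  set ε : ℕ → ℝ := fun k => 1 / ((k:ℝ) + 1) with hε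
  have hεp : ∀ k, 0 < ε k := fun k => by simp only [hε]; positivity
  have hε0 : Tendsto ε atTop (𝓝 0) := tendsto_one_div_add_atTop_nhds_zero_nat
  have hlc := (lap_smooth hu).continuous
  have T1 : Tendsto (fun k => ∫ y, vv (-((n - 2 : ℝ) / 2)) (ε k) x y * lap u y) atTop
      (𝓝 (∫ y, lap u y * kr (n - 2) x y)) := by
    refine tendsto_integral_of_dominated_convergence (fun y => ‖lap u y * kr (n - 2) x y‖) ?_ ?_ ?_ ?_
    · intro k
      exact ((vv_smooth _ (hεp k) x).continuous.mul hlc).aestronglyMeasurable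
    · exact (pot_integrable (by linarith) (by linarith) hlc (lap_supp huc) x).norm
    · intro k
      filter_upwards [ae_ne x] with y hy
      have hd : 0 < ‖y - x‖ := norm_pos_iff.2 (sub_ne_zero.2 hy)
      rw [norm_mul, norm_mul, mul_comm]
      refine mul_le_mul_of_nonneg_left ?_ (norm_nonneg _)
      rw [Real.norm_of_nonneg (kr_nonneg _ _ _), kr_eq _ hy.symm, norm_sub_rev, vv,
        Real.norm_of_nonneg (by positivity)]
      calc (ε k ^ 2 + ‖y - x‖ ^ 2) ^ (-((n - 2 : ℝ) / 2)) ≤ (‖y - x‖ ^ 2) ^ (-((n - 2 : ℝ) / 2)) :=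
            Real.rpow_le_rpow_of_nonpos (by positivity) (by have := sq_nonneg (ε k); linarith) (by linarith)
        _ = _ := by
            rw [← Real.rpow_natCast, ← Real.rpow_mul hd.le]; congr 1; push_cast; ring
    · filter_upwards [ae_ne x] with y hy
      have hd : 0 < ‖y - x‖ := norm_pos_iff.2 (sub_ne_zero.2 hy)
      rw [mul_comm]
      refine Tendsto.mul ?_ tendsto_const_nhds
      have h1 : Tendsto (fun k => ε k ^ 2 + ‖y - x‖ ^ 2) atTop (𝓝 (0 ^ 2 + ‖y - x‖ ^ 2)) := (hε0.pow 2).add_const _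
      have h2 := h1.rpow_const (p := -((n - 2 : ℝ) / 2)) (Or.inl (by positivity))
      have e : kr (n - 2) x y = (0 ^ 2 + ‖y - x‖ ^ 2) ^ (-((n - 2 : ℝ) / 2)) := by
        rw [kr_eq _ hy.symm, norm_sub_rev]
        rw [zero_pow two_ne_zero, zero_add, ← Real.rpow_natCast, ← Real.rpow_mul hd.le]; congr 1; push_cast; ring
      rw [e]; exact h2
  have E : ∀ k, ∫ y, vv (-((n - 2 : ℝ) / 2)) (ε k) x y * lap u y =
      -(n * (n - 2) * ∫ z : EE n, ww z ^ ((n + 2 : ℝ) / 2) * u (x + ε k • z)) := by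
    intro k
    have hk := hεp k
    rw [green (vv_smooth _ hk x) hu huc]
    simp_rw [lap_vv hk x]
    have e1 : ∀ y, -(n * (n - 2) * ε k ^ 2 * vv (-((n + 2 : ℝ) / 2)) (ε k) x y) * u y =
        (-(n * (n - 2)) * ε k ^ 2) * (vv (-((n + 2 : ℝ) / 2)) (ε k) x y * u y) := fun y => by ring
    simp_rw [e1]
    rw [integral_const_mul, ← integral_add_left_eq_self _ x]
    have e2 := Measure.integral_comp_smul (volume : Measure (EE n))
      (fun y => vv (-((n + 2 : ℝ) / 2)) (ε k) x (x + y) * u (x + y)) (ε k)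
    have e3 : ∀ z : EE n, vv (-((n + 2 : ℝ) / 2)) (ε k) x (x + ε k • z) * u (x + ε k • z) =
        (ε k ^ (n + 2))⁻¹ * (ww z ^ ((n + 2 : ℝ) / 2) * u (x + ε k • z)) := by
      intro z
      rw [← mul_assoc]
      congr 1
      unfold vv ww
      rw [add_sub_cancel_left, norm_smul, Real.norm_of_nonneg hk.le,
        show ε k ^ 2 + (ε k * ‖z‖) ^ 2 = ε k ^ 2 * (1 + ‖z‖ ^ 2) by ring, Real.mul_rpow (by positivity) (by positivity),
        Real.inv_rpow (by positivity), ← Real.rpow_neg (by positivity), ← Real.rpow_natCast (ε k) 2, ← Real.rpow_mul hk.le,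
        ← Real.rpow_natCast (ε k) (n + 2), ← Real.rpow_neg hk.le]
      congr 2; push_cast; ring
    simp_rw [e3] at e2
    rw [integral_const_mul, finrank_euclideanSpace_fin, smul_eq_mul, abs_of_pos (by positivity)] at e2
    have e4 : ∫ y, vv (-((n + 2 : ℝ) / 2)) (ε k) x (x + y) * u (x + y) =
        ε k ^ n * ((ε k ^ (n + 2))⁻¹ * ∫ z : EE n, ww z ^ ((n + 2 : ℝ) / 2) * u (x + ε k • z)) := by
      rw [e2]; field_simp
    rw [e4, pow_add]
    field_simp
  have T2 : Tendsto (fun k => ∫ z : EE n, ww z ^ ((n + 2 : ℝ) / 2) * u (x + ε k • z)) atTop (𝓝 (∫ z : EE n, ww z ^ ((n + 2 : ℝ) / 2) * u x)) := by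
    obtain ⟨C, hC⟩ := huc.exists_bound_of_continuous hu.continuous
    refine tendsto_integral_of_dominated_convergence (fun z => ww z ^ ((n + 2 : ℝ) / 2) * C) ?_ ?_ ?_ ?_
    · intro k
      have h1 : Continuous (fun z : EE n => ww z ^ ((n + 2 : ℝ) / 2)) := ww_cont.rpow_const fun z => Or.inl (ww_pos z).ne'
      have h2 := hu.continuous
      exact Continuous.aestronglyMeasurable (by fun_prop)
    · exact AA_int.mul_const C
    · intro k
      refine Eventually.of_forall fun z => ?_
      have := Real.rpow_pos_of_pos (ww_pos z) ((n + 2 : ℝ) / 2)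
      rw [norm_mul, Real.norm_of_nonneg this.le]
      exact mul_le_mul_of_nonneg_left (hC _) this.le
    · refine Eventually.of_forall fun z => ?_
      refine tendsto_const_nhds.mul ?_
      have h1 : Tendsto (fun k => x + ε k • z) atTop (𝓝 (x + (0:ℝ) • z)) := (hε0.smul_const z).const_add x
      rw [zero_smul, add_zero] at h1
      exact (hu.continuous.tendsto x).comp h1
  simp_rw [E] at T1
  have T3 := (T2.const_mul (n * (n - 2 : ℝ))).neg
  have := tendsto_nhds_unique T1 T3
  rw [this, integral_mul_const, AA]; ring

end HLS

namespace HLS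
open EuclideanGeometry Set Filter Topology
variable {n : ℕ}

theorem Br_lap [NeZero n] (hn : 3 ≤ n) {f u : EE n → ℝ} (hf : Continuous f) (hfc : HasCompactSupport f)
    (hu : ContDiff ℝ (⊤ : ℕ∞) u) (huc : HasCompactSupport u) :
    Br (n - 2) f (lap u) = -(n * (n - 2) * AA n * ∫ x, f x * u x) := by
  have hn' : (3:ℝ) ≤ n := by exact_mod_cast hn
  have hi := Br_integrable (μ := n - 2) (by linarith) (by linarith) hf hfc (lap_smooth hu).continuous (lap_supp huc)
  rw [Br, Measure.volume_eq_prod, integral_prod _ hi]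
  simp only [mul_assoc]
  simp_rw [integral_const_mul, green_rep hn hu huc]
  rw [← integral_const_mul, ← integral_const_mul, ← integral_const_mul, ← integral_neg]
  refine integral_congr_ae (Eventually.of_forall fun x => ?_)
  beta_reduce; ring

theorem rpow_cs {u : EE n → ℝ} (hu : Continuous u) (huc : HasCompactSupport u) {r : ℝ} (hr : 0 < r) :
    Continuous (fun x => |u x| ^ r) ∧ HasCompactSupport (fun x => |u x| ^ r) :=
  ⟨hu.abs.rpow_const fun x => Or.inr hr.le, huc.comp_left (g := fun t => |t| ^ r) (by simp [hr.ne'])⟩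

theorem rpow_lint {u : EE n → ℝ} (hu : Continuous u) (huc : HasCompactSupport u) {r : ℝ} (hr : 0 < r) :
    ∫⁻ x, ENNReal.ofReal (|u x| ^ r) = ENNReal.ofReal (∫ x, |u x| ^ r) := by
  obtain ⟨h1, h2⟩ := rpow_cs hu huc hr
  rw [ofReal_integral_eq_lintegral_ofReal (h1.integrable_of_hasCompactSupport h2)
    (Eventually.of_forall fun x => by positivity)]

theorem sob [NeZero n] (hn : 3 ≤ n) {u : EE n → ℝ}
    (hu : ContDiff ℝ (⊤ : ℕ∞) u) (huc : HasCompactSupport u) :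
    n * (n - 2) * (II n).toReal ^ (2 / n : ℝ) * (∫ x, |u x| ^ (2 * (n : ℝ) / ((n : ℝ) - 2))) ^ (((n : ℝ) - 2) / (n : ℝ))
      ≤ ∫ x, ‖fderiv ℝ u x‖ ^ 2 := by
  have hn' : (3:ℝ) ≤ n := by exact_mod_cast hn
  have hn2 : (0:ℝ) < n - 2 := by linarith
  have hn0 : (0:ℝ) < n := by linarith
  set P := ∫ x, |u x| ^ (2 * (n : ℝ) / ((n : ℝ) - 2)) with hP
  set En := ∫ x, ‖fderiv ℝ u x‖ ^ 2 with hEn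
  have hE0 : 0 ≤ En := integral_nonneg fun x => by positivity
  have hP0 : 0 ≤ P := integral_nonneg fun x => by positivity
  rcases hP0.eq_or_lt with hP1 | hP1
  · rw [← hP1, Real.zero_rpow (by positivity), mul_zero]; exact hE0
  set I := (II n).toReal with hI
  have hI0 : 0 < I := ENNReal.toReal_pos II_pos II_lt_top.ne
  set f : EE n → ℝ := fun x => |u x| ^ (4 / ((n : ℝ) - 2)) * u x with hf
  have hfc : Continuous f := (rpow_cs hu.continuous huc (by positivity)).1.mul hu.continuous
  have hfs : HasCompactSupport f := huc.mul_left
  have hgc := (lap_smooth hu).continuous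
  have hgs := lap_supp huc
  have hcs := Br_cs (μ := n - 2) hn2 (by linarith) hfc hfs hgc hgs
  rw [Br_lap hn hfc hfs hu huc, Br_lap hn hgc hgs hu huc] at hcs
  have habs : ∀ x, |f x| = |u x| ^ ((n + 2 : ℝ) / (n - 2)) := fun x => by
    simp only [hf]
    rw [abs_mul, abs_of_nonneg (by positivity)]
    rcases (abs_nonneg (u x)).eq_or_lt with h | h
    · rw [← h, mul_zero, Real.zero_rpow (by positivity)]
    · rw [← Real.rpow_add_one h.ne']; congr 1; field_simp; ring
  have h1 : ∫ x, f x * u x = P := by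
    refine integral_congr_ae (Eventually.of_forall fun x => ?_)
    simp only [hf]
    rcases (abs_nonneg (u x)).eq_or_lt with h | h
    · have : u x = 0 := abs_eq_zero.1 h.symm
      rw [this, mul_zero, abs_zero, Real.zero_rpow (by positivity)]
    · rw [mul_assoc, ← sq, ← sq_abs, ← Real.rpow_natCast, ← Real.rpow_add h]; congr 1; push_cast; field_simp; ring
  have h2 : ∫ x, lap u x * u x = -En := by rw [hEn, energy hu huc, neg_neg]
  rw [h1, h2] at hcs
  have hB := Br_le_QQ (μ := n - 2) hn2 (by linarith) hfc hfs
  have hpow : ∫⁻ x, ENNReal.ofReal |f x| ^ (2 * n / (2 * n - (n - 2)) : ℝ) = ENNReal.ofReal P := by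
    rw [← rpow_lint hu.continuous huc (by positivity)]
    refine lintegral_congr fun x => ?_
    rw [habs, ENNReal.ofReal_rpow_of_nonneg (by positivity) (by apply div_nonneg <;> linarith),
      ← Real.rpow_mul (abs_nonneg _)]
    congr 2
    have : (2 * n - (n - 2) : ℝ) = n + 2 := by ring
    rw [this]; field_simp
  have hH := hls (μ := n - 2) hn2 (by linarith) rfl (f := fun x => ENNReal.ofReal |f x|)
    (by have := hfc.measurable; fun_prop) (by rw [hpow]; exact ENNReal.ofReal_ne_top)
  rw [hpow, ka_AA hn] at hH
  have hA := AA_pos (n := n)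
  have hII : II n = ENNReal.ofReal I := (ENNReal.ofReal_toReal II_lt_top.ne).symm
  have hH2 : I * Br (n - 2) f f ≤ AA n * I ^ ((n - 2) / n : ℝ) * P ^ ((n + 2) / n : ℝ) := by
    have := (mul_le_mul_right hB (II n)).trans hH
    rw [hII, ENNReal.ofReal_rpow_of_pos hI0, ENNReal.ofReal_rpow_of_pos hP1, ← ENNReal.ofReal_mul (by positivity),
      ← ENNReal.ofReal_mul (by positivity), ← ENNReal.ofReal_mul (by positivity),
      ENNReal.ofReal_le_ofReal_iff (by positivity)] at this
    convert this using 3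
    have : (2 * n - (n - 2) : ℝ) = n + 2 := by ring
    rw [this]; field_simp
  have hBn : n * (n - 2) * AA n * P ^ 2 ≤ Br (n - 2) f f * En := by
    have hc : 0 < n * (n - 2) * AA n := by positivity
    refine le_of_mul_le_mul_left ?_ hc
    nlinarith [hcs]
  have e1 : I = I ^ ((n - 2) / n : ℝ) * I ^ (2 / n : ℝ) := by
    rw [← Real.rpow_add hI0, ← add_div, sub_add_cancel, div_self hn0.ne', Real.rpow_one]
  have e2 : P ^ 2 = P ^ ((n + 2) / n : ℝ) * P ^ ((n - 2) / n : ℝ) := by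
    rw [← Real.rpow_add hP1, ← add_div, ← Real.rpow_natCast]; congr 1; push_cast; field_simp; ring
  have key : (AA n * I ^ ((n - 2) / n : ℝ) * P ^ ((n + 2) / n : ℝ)) * (n * (n - 2) * I ^ (2 / n : ℝ) * P ^ ((n - 2) / n : ℝ)) ≤
      (AA n * I ^ ((n - 2) / n : ℝ) * P ^ ((n + 2) / n : ℝ)) * En := by
    calc _ = (I ^ ((n - 2) / n : ℝ) * I ^ (2 / n : ℝ)) * (n * (n - 2) * AA n * (P ^ ((n + 2) / n : ℝ) * P ^ ((n - 2) / n : ℝ))) := by ring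
      _ = I * (n * (n - 2) * AA n * P ^ 2) := by rw [← e1, ← e2]
      _ ≤ I * (Br (n - 2) f f * En) := mul_le_mul_of_nonneg_left hBn hI0.le
      _ = (I * Br (n - 2) f f) * En := by ring
      _ ≤ _ := mul_le_mul_of_nonneg_right hH2 hE0
  exact le_of_mul_le_mul_left key (by positivity)

end HLS

namespace HLS
open EuclideanGeometry Set Filter Topology
variable {n : ℕ}

noncomputable def UU (x : EE n) : ℝ := vv (-((n - 2 : ℝ) / 2)) 1 0 x

theorem UU_eq (x : EE n) : UU x = ww x ^ ((n - 2 : ℝ) / 2) := by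
  unfold UU vv ww
  rw [Real.inv_rpow (by positivity), ← Real.rpow_neg (by positivity)]; simp

theorem UU_pos (x : EE n) : 0 < UU x := by rw [UU_eq]; exact Real.rpow_pos_of_pos (ww_pos x) _

theorem UU_smooth : ContDiff ℝ (⊤ : ℕ∞) (UU (n := n)) := vv_smooth _ one_pos 0

theorem UU_lap (x : EE n) : lap UU x * UU x = -(n * (n - 2) * ww x ^ (n : ℝ)) := by
  have h : lap UU x = -(n * (n - 2) * ww x ^ ((n + 2 : ℝ) / 2)) := by
    have := lap_vv (n := n) one_pos 0 x
    have e : vv (-((n + 2 : ℝ) / 2)) 1 0 x = ww x ^ ((n + 2 : ℝ) / 2) := by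
      unfold vv ww
      rw [Real.inv_rpow (by positivity), ← Real.rpow_neg (by positivity)]; simp
    rw [e] at this
    simp only [one_pow, mul_one] at this
    exact this
  rw [h, UU_eq, neg_mul, mul_assoc, ← Real.rpow_add (ww_pos x)]
  congr 3; ring

theorem dd_mul (i : Fin n) {a b : EE n → ℝ} (ha : ContDiff ℝ (⊤ : ℕ∞) a) (hb : ContDiff ℝ (⊤ : ℕ∞) b) (x : EE n) :
    dd i (fun y => a y * b y) x = a x * dd i b x + dd i a x * b x := by
  unfold dd
  rw [fderiv_fun_mul (ha.differentiable (by simp) x) (hb.differentiable (by simp) x)]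
  simp; ring

theorem energy_cut {c : EE n → ℝ} (hc : ContDiff ℝ (⊤ : ℕ∞) c) (hcs : HasCompactSupport c) :
    ∫ x, ‖fderiv ℝ (fun y => c y * UU y) x‖ ^ 2 =
      n * (n - 2) * (∫ x, c x ^ 2 * ww x ^ (n : ℝ)) + ∫ x, UU x ^ 2 * ‖fderiv ℝ c x‖ ^ 2 := by
  have hU := UU_smooth (n := n)
  have hcU : ContDiff ℝ (⊤ : ℕ∞) (fun y => c y * UU y) := hc.mul hU
  have hccU : ContDiff ℝ (⊤ : ℕ∞) (fun y => c y * (c y * UU y)) := hc.mul hcU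
  have hccs : HasCompactSupport (fun y => c y * (c y * UU y)) := hcs.mul_right
  have e : ∀ x, ‖fderiv ℝ (fun y => c y * UU y) x‖ ^ 2 =
      (∑ i, dd i UU x * dd i (fun y => c y * (c y * UU y)) x) + UU x ^ 2 * ‖fderiv ℝ c x‖ ^ 2 := fun x => by
    rw [norm_sq_dual, norm_sq_dual, Finset.mul_sum, ← Finset.sum_add_distrib]
    refine Finset.sum_congr rfl fun i _ => ?_
    change (dd i (fun y => c y * UU y) x) ^ 2 = _ + UU x ^ 2 * (dd i c x) ^ 2
    rw [dd_mul i hc hcU, dd_mul i hc hU]; ring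
  have i1 : ∀ i, Integrable (fun x => dd i UU x * dd i (fun y => c y * (c y * UU y)) x) := fun i =>
    int_cs (dd_smooth i hU).continuous (dd_smooth i hccU).continuous (dd_supp i hccs)
  have i2 : Integrable (fun x => UU x ^ 2 * ‖fderiv ℝ c x‖ ^ 2) := by
    refine int_cs (hU.continuous.pow 2) ((hc.continuous_fderiv (by simp)).norm.pow 2) ?_
    exact (hcs.fderiv ℝ).comp_left (g := fun L => ‖L‖ ^ 2) (by simp)
  simp_rw [e]
  rw [integral_add (integrable_finsetSum _ fun i _ => i1 i) i2, integral_finsetSum _ fun i _ => i1 i]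
  congr 1
  have e2 : ∀ i, ∫ x, dd i UU x * dd i (fun y => c y * (c y * UU y)) x = - ∫ x, dd i (dd i UU) x * (c x * (c x * UU x)) :=
    fun i => ibp i (dd_smooth i hU) hccU hccs
  simp_rw [e2]
  rw [Finset.sum_neg_distrib, ← integral_finsetSum _ fun i _ => int_cs (dd_smooth i (dd_smooth i hU)).continuous hccU.continuous hccs,
    ← integral_neg, ← integral_const_mul]
  refine integral_congr_ae (Eventually.of_forall fun x => ?_)
  beta_reduce
  rw [← Finset.sum_mul]
  have := UU_lap x
  unfold lap at this
  linear_combination (-(c x ^ 2)) * this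

noncomputable def bmp (n : ℕ) : ContDiffBump (0 : EE n) := ⟨1, 2, one_pos, one_lt_two⟩

noncomputable def ch (k : ℕ) (x : EE n) : ℝ := bmp n ((1 / ((k:ℝ) + 1)) • x)

theorem ch_smooth (k : ℕ) : ContDiff ℝ (⊤ : ℕ∞) (ch (n := n) k) :=
  (bmp n).contDiff.comp (contDiff_id.const_smul _)

theorem ch_nonneg (k : ℕ) (x : EE n) : 0 ≤ ch k x := (bmp n).nonneg
theorem ch_le_one (k : ℕ) (x : EE n) : ch k x ≤ 1 := (bmp n).le_one

theorem ch_supp (k : ℕ) : HasCompactSupport (ch (n := n) k) := by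
  have h := (bmp n).hasCompactSupport
  exact h.comp_homeomorph (Homeomorph.smulOfNeZero (1 / ((k:ℝ) + 1)) (by positivity))

theorem ch_zero (k : ℕ) : ch k (0 : EE n) = 1 := by
  unfold ch
  exact (bmp n).one_of_mem_closedBall (by simp [bmp])

theorem ch_ev (x : EE n) : ∀ᶠ k in atTop, ch k x = 1 := by
  obtain ⟨N, hN⟩ := exists_nat_ge ‖x‖
  filter_upwards [eventually_ge_atTop N] with k hk
  refine (bmp n).one_of_mem_closedBall ?_
  have hk' : (N:ℝ) ≤ k := by exact_mod_cast hk
  rw [mem_closedBall_zero_iff, norm_smul, Real.norm_of_nonneg (by positivity)]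
  change _ ≤ (1:ℝ)
  rw [one_div_mul_eq_div, div_le_one (by positivity)]
  linarith

theorem ch_fderiv : ∃ C : ℝ, ∀ (k : ℕ) (x : EE n), ‖fderiv ℝ (ch k) x‖ ^ 2 ≤ C / ((k:ℝ) + 1) ^ 2 ∧ ‖fderiv ℝ (ch k) x‖ ^ 2 ≤ C * ww x := by
  have hb : ContDiff ℝ (⊤ : ℕ∞) (bmp n) := (bmp n).contDiff
  have hs := (bmp n).hasCompactSupport
  obtain ⟨C, hC⟩ := (hs.fderiv ℝ).exists_bound_of_continuous (hb.continuous_fderiv (by simp))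
  have hC0 : 0 ≤ C := (norm_nonneg _).trans (hC 0)
  have e : ∀ (k : ℕ) (x : EE n), ‖fderiv ℝ (ch k) x‖ = 1 / ((k:ℝ) + 1) * ‖fderiv ℝ (bmp n) ((1 / ((k:ℝ) + 1)) • x)‖ := by
    intro k x
    have h1 : HasFDerivAt (fun x : EE n => (1 / ((k:ℝ) + 1)) • x) ((1 / ((k:ℝ) + 1)) • ContinuousLinearMap.id ℝ (EE n)) x :=
      ((1 / ((k:ℝ) + 1)) • ContinuousLinearMap.id ℝ (EE n)).hasFDerivAt
    have h2 : HasFDerivAt (ch k) _ x := ((hb.differentiable (by simp) _).hasFDerivAt).comp x h1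
    rw [h2.fderiv, ContinuousLinearMap.comp_smul, norm_smul, Real.norm_of_nonneg (by positivity), ContinuousLinearMap.comp_id]
  have b1 : ∀ (k : ℕ) (x : EE n), ‖fderiv ℝ (ch k) x‖ ^ 2 ≤ C ^ 2 / ((k:ℝ) + 1) ^ 2 := by
    intro k x
    rw [e, ← div_pow]
    refine pow_le_pow_left₀ (by positivity) ?_ 2
    rw [one_div_mul_eq_div]
    gcongr
    exact hC _
  refine ⟨5 * C ^ 2, fun k x => ⟨(b1 k x).trans ?_, ?_⟩⟩
  · gcongr; nlinarith [sq_nonneg C]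
  by_cases hx : ‖x‖ ≤ 2 * (k + 1)
  · refine (b1 k x).trans ?_
    have hk : (0:ℝ) ≤ k := k.cast_nonneg
    unfold ww
    rw [div_le_iff₀ (by positivity), ← div_eq_mul_inv, div_mul_eq_mul_div, le_div_iff₀ (by positivity)]
    have : ‖x‖ ^ 2 ≤ (2 * (k + 1)) ^ 2 := pow_le_pow_left₀ (norm_nonneg _) hx 2
    have h2 : 1 + ‖x‖ ^ 2 ≤ 5 * ((k:ℝ) + 1) ^ 2 := by nlinarith
    calc C ^ 2 * (1 + ‖x‖ ^ 2) ≤ C ^ 2 * (5 * ((k:ℝ) + 1) ^ 2) := by gcongr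
      _ = _ := by ring
  · have : fderiv ℝ (bmp n) ((1 / ((k:ℝ) + 1)) • x) = 0 := by
      by_contra hne
      have h1 := support_fderiv_subset ℝ (show (1 / ((k:ℝ) + 1)) • x ∈ Function.support (fderiv ℝ (bmp n)) from hne)
      rw [(bmp n).tsupport_eq, mem_closedBall_zero_iff, norm_smul, Real.norm_of_nonneg (by positivity), one_div_mul_eq_div,
        div_le_iff₀ (by positivity)] at h1
      exact hx h1
    rw [e, this]
    have := ww_pos x
    simp; positivity

theorem energy_lim (hn : 3 ≤ n) :
    Tendsto (fun k => ∫ x : EE n, ‖fderiv ℝ (fun y => ch k y * UU y) x‖ ^ 2) atTop (𝓝 (n * (n - 2) * ∫ x : EE n, ww x ^ (n:ℝ))) := by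
  have hn' : (3:ℝ) ≤ n := by exact_mod_cast hn
  simp_rw [fun k => energy_cut (ch_smooth (n := n) k) (ch_supp k)]
  rw [← add_zero (n * (n - 2) * ∫ x : EE n, ww x ^ (n:ℝ) : ℝ)]
  refine Tendsto.add (Tendsto.const_mul _ ?_) ?_
  · refine tendsto_integral_of_dominated_convergence (fun x => ww x ^ (n:ℝ)) ?_ (ww_rpow_int (by linarith)) ?_ ?_
    · intro k
      exact (((ch_smooth k).continuous.pow 2).mul (ww_cont.rpow_const fun x => Or.inl (ww_pos x).ne')).aestronglyMeasurable
    · intro k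
      refine Eventually.of_forall fun x => ?_
      have := Real.rpow_pos_of_pos (ww_pos x) (n:ℝ)
      rw [Real.norm_of_nonneg (by positivity)]
      exact mul_le_of_le_one_left this.le (pow_le_one₀ (ch_nonneg _ _) (ch_le_one _ _))
    · refine Eventually.of_forall fun x => ?_
      refine tendsto_const_nhds.congr' ?_
      filter_upwards [ch_ev x] with k hk
      rw [hk]; ring
  · obtain ⟨C, hC⟩ := ch_fderiv (n := n)
    rw [← integral_zero (EE n) ℝ]
    have eU : ∀ x : EE n, UU x ^ 2 = ww x ^ ((n:ℝ) - 2) := fun x => by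
      rw [UU_eq, ← Real.rpow_natCast, ← Real.rpow_mul (ww_pos x).le]; congr 1; push_cast; ring
    refine tendsto_integral_of_dominated_convergence (fun x => C * ww x ^ ((n:ℝ) - 1)) ?_ ((ww_rpow_int (by linarith)).const_mul C) ?_ ?_
    · intro k
      exact ((UU_smooth.continuous.pow 2).mul (((ch_smooth k).continuous_fderiv (by simp)).norm.pow 2)).aestronglyMeasurable
    · intro k
      refine Eventually.of_forall fun x => ?_
      rw [Real.norm_of_nonneg (by positivity), eU]
      have := Real.rpow_pos_of_pos (ww_pos x) ((n:ℝ) - 2)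
      calc ww x ^ ((n:ℝ) - 2) * ‖fderiv ℝ (ch k) x‖ ^ 2 ≤ ww x ^ ((n:ℝ) - 2) * (C * ww x) := by
            gcongr; exact (hC k x).2
        _ = C * (ww x ^ ((n:ℝ) - 2) * ww x) := by ring
        _ = _ := by rw [← Real.rpow_add_one (ww_pos x).ne']; congr 2; ring
    · refine Eventually.of_forall fun x => ?_
      have h1 : Tendsto (fun k : ℕ => UU x ^ 2 * (C / ((k:ℝ) + 1) ^ 2)) atTop (𝓝 (UU x ^ 2 * (C * 0 ^ 2))) := by
        refine Tendsto.const_mul _ ?_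
        have := ((tendsto_one_div_add_atTop_nhds_zero_nat (𝕜 := ℝ)).pow 2).const_mul C
        refine this.congr fun k => ?_
        rw [div_pow, one_pow, mul_one_div]
      have e0 : UU x ^ 2 * (C * 0 ^ 2) = 0 := by ring
      rw [e0] at h1
      refine squeeze_zero (fun k => by positivity) (fun k => ?_) h1
      have := (hC k x).1
      gcongr

end HLS

namespace HLS
open EuclideanGeometry Set Filter Topology
variable {n : ℕ}

theorem bridge_l [NeZero n] (μ : ℝ) (f : EE n → ℝ) :
    ∫⁻ x, ∫⁻ y, ENNReal.ofReal (|f x| * |f y| / ‖x - y‖ ^ μ) =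
      QQ μ (fun x => ENNReal.ofReal |f x|) (fun x => ENNReal.ofReal |f x|) := by
  rw [QQ]
  refine lintegral_congr fun x => lintegral_congr_ae ?_
  filter_upwards [ae_ne x] with y hy
  rw [← kr_ofReal μ hy.symm, kr_eq μ hy.symm, ← ENNReal.ofReal_mul (by positivity), ← ENNReal.ofReal_mul (by positivity),
    Real.rpow_neg (norm_nonneg _), div_eq_mul_inv]

theorem bridge_r [NeZero n] {μ : ℝ} (hμ : 0 < μ) (hμn : μ < n) {f : EE n → ℝ} (hf : Continuous f) (hfc : HasCompactSupport f)
    (hf0 : ∀ x, 0 ≤ f x) :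
    ∫ x, ∫ y, f x * f y / ‖x - y‖ ^ μ =
      (QQ μ (fun x => ENNReal.ofReal |f x|) (fun x => ENNReal.ofReal |f x|)).toReal := by
  have hi := Br_integrable hμ hμn hf hfc hf hfc
  rw [← Br_of_nonneg hf hf hf0 hf0, Br, Measure.volume_eq_prod, integral_prod _ hi]
  refine integral_congr_ae (Eventually.of_forall fun x => integral_congr_ae ?_)
  filter_upwards [ae_ne x] with y hy
  rw [kr_eq μ hy.symm, Real.rpow_neg (norm_nonneg _), div_eq_mul_inv]

theorem QQ_ne_zero [NeZero n] {μ : ℝ} (hμ : 0 < μ) {f : EE n → ℝ} (hf : Continuous f) (hne : f ≠ 0) :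
    QQ μ (fun x => ENNReal.ofReal |f x|) (fun x => ENNReal.ofReal |f x|) ≠ 0 := by
  intro h
  have hm := hf.measurable
  have mk := measurable_kap (n := n) μ
  apply hne
  refine (hf.ae_eq_iff_eq (volume : Measure (EE n)) (continuous_const (y := (0:ℝ)))).1 ?_
  change f =ᵐ[volume] 0
  rw [QQ, lintegral_eq_zero_iff (Measurable.lintegral_prod_right' (f := fun q : EE n × EE n =>
    ENNReal.ofReal |f q.1| * ENNReal.ofReal |f q.2| * kap μ q.1 q.2) (by fun_prop))] at h
  have key : ∀ x, f x ≠ 0 → (∫⁻ y, ENNReal.ofReal |f x| * ENNReal.ofReal |f y| * kap μ x y) = 0 → f =ᵐ[volume] 0 := by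
    intro x hx h0
    have := mk1 μ x
    rw [lintegral_eq_zero_iff (by fun_prop)] at h0
    filter_upwards [h0] with y hy
    simp only [Pi.zero_apply, mul_eq_zero, ENNReal.ofReal_eq_zero] at hy
    rcases hy with (hy | hy) | hy
    · exact absurd (abs_nonpos_iff.1 hy) hx
    · exact abs_nonpos_iff.1 hy
    · exfalso
      unfold kap at hy
      rw [ENNReal.rpow_eq_zero_iff] at hy
      rcases hy with ⟨_, h⟩ | ⟨h, _⟩
      · linarith
      · exact ENNReal.ofReal_ne_top h
  by_cases hc : ∃ x, f x ≠ 0 ∧ (∫⁻ y, ENNReal.ofReal |f x| * ENNReal.ofReal |f y| * kap μ x y) = 0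
  · obtain ⟨x, h1, h2⟩ := hc
    exact key x h1 h2
  · push Not at hc
    filter_upwards [h] with x hx
    by_contra hx0
    exact hc x hx0 hx

/-- sharp HLS constant -/
noncomputable def CC (n : ℕ) (μ : ℝ) : ℝ := (ka n μ).toReal * (II n).toReal ^ (μ / n - 1 : ℝ)

theorem ka_pos [NeZero n] {μ : ℝ} : ka n μ ≠ 0 := by
  rw [ka_eq]
  intro h
  have := measurable_ww (n := n)
  rw [lintegral_eq_zero_iff (by fun_prop)] at h
  have h2 : ∀ᵐ x : EE n, False := by
    filter_upwards [h, ae_ne (0 : EE n)] with x hx h0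
    have : 0 < ‖x‖ := norm_pos_iff.2 h0
    simp only [Pi.zero_apply] at hx
    rw [ENNReal.ofReal_rpow_of_pos (ww_pos x), ENNReal.ofReal_rpow_of_pos (by positivity), mul_eq_zero,
      ENNReal.ofReal_eq_zero, ENNReal.ofReal_eq_zero] at hx
    have h1 := Real.rpow_pos_of_pos (ww_pos x) (n - μ / 2)
    have h2 : 0 < (‖x‖ ^ 2) ^ (-(μ / 2)) := by positivity
    rcases hx with hx | hx <;> linarith
  simp at h2
  exact NeZero.ne (volume : Measure (EE n)) h2

theorem CC_pos [NeZero n] {μ : ℝ} (hμ : 0 < μ) (hμn : μ < n) : 0 < CC n μ :=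
  mul_pos (ENNReal.toReal_pos ka_pos (ka_lt_top hμ hμn).ne) (Real.rpow_pos_of_pos (ENNReal.toReal_pos II_pos II_lt_top.ne) _)

/-- real form of sharp HLS -/
theorem hls_real [NeZero n] {μ p : ℝ} (hμ : 0 < μ) (hμn : μ < n) (hp : p = 2 * n / (2 * n - μ))
    {f : EE n → ℝ≥0∞} (hf : Measurable f) (hf1 : ∫⁻ x, f x ^ p ≠ ⊤) :
    QQ μ f f ≤ ENNReal.ofReal (CC n μ) * (∫⁻ x, f x ^ p) ^ (2 / p) ∧
    (QQ μ f f).toReal ≤ CC n μ * (∫⁻ x, f x ^ p).toReal ^ (2 / p) := by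
  have hn0 : (0:ℝ) < n := by linarith
  have hp0 : 0 < p := by rw [hp]; apply div_pos <;> linarith
  have h := hls hμ hμn hp hf hf1
  have hI := II_lt_top (n := n)
  have h1 : QQ μ f f ≤ ENNReal.ofReal (CC n μ) * (∫⁻ x, f x ^ p) ^ (2 / p) := by
    rw [← ENNReal.mul_le_mul_iff_right II_pos hI.ne]
    refine h.trans (le_of_eq ?_)
    have hI0 := ENNReal.toReal_pos (II_pos (n := n)) hI.ne
    rw [CC, ENNReal.ofReal_mul ENNReal.toReal_nonneg, ENNReal.ofReal_toReal (ka_lt_top hμ hμn).ne,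
      ← ENNReal.ofReal_rpow_of_pos hI0, ENNReal.ofReal_toReal hI.ne, ENNReal.rpow_sub _ _ II_pos hI.ne, ENNReal.rpow_one]
    have : II n * (II n ^ (μ / n) / II n) = II n ^ (μ / n) := ENNReal.mul_div_cancel II_pos hI.ne
    calc ka n μ * II n ^ (μ / n) * (∫⁻ x, f x ^ p) ^ (2 / p) = ka n μ * (II n * (II n ^ (μ / n) / II n)) * (∫⁻ x, f x ^ p) ^ (2 / p) := by rw [this]
      _ = _ := by ring
  refine ⟨h1, ?_⟩
  have h2 : (∫⁻ x, f x ^ p) ^ (2 / p) ≠ ⊤ := ENNReal.rpow_ne_top_of_nonneg (by positivity) hf1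
  have := ENNReal.toReal_mono (ENNReal.mul_ne_top ENNReal.ofReal_ne_top h2) h1
  rwa [ENNReal.toReal_mul, ENNReal.toReal_ofReal (CC_pos hμ hμn).le, ← ENNReal.toReal_rpow] at this

theorem sup_eq [NeZero n] {μ : ℝ} (hμ : 0 < μ) (hμn : μ < n) :
    sSup {t : ℝ | ∃ f : EuclideanSpace ℝ (Fin n) → ℝ,
          f ≠ 0 ∧ MemLp f (ENNReal.ofReal (2 * n / (2 * (n : ℝ) - μ))) volume ∧
          t = (∫⁻ x, ∫⁻ y, ENNReal.ofReal (|f x| * |f y| / ‖x - y‖ ^ μ)).toReal /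
              ((eLpNorm f (ENNReal.ofReal (2 * n / (2 * (n : ℝ) - μ))) volume).toReal) ^ 2} = CC n μ := by
  have hn0 : (0:ℝ) < n := by linarith
  set p : ℝ := 2 * n / (2 * (n : ℝ) - μ) with hp
  have hd : 0 < 2 * (n:ℝ) - μ := by linarith
  have hp0 : 0 < p := by rw [hp]; positivity
  have hpt : (ENNReal.ofReal p).toReal = p := ENNReal.toReal_ofReal hp0.le
  have hp1 : ENNReal.ofReal p ≠ 0 := by simp [hp0]
  have hI0 := ENNReal.toReal_pos (II_pos (n := n)) II_lt_top.ne
  have enorm : ∀ f : EE n → ℝ, ((eLpNorm f (ENNReal.ofReal p) volume).toReal) ^ 2 =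
      (∫⁻ x, ENNReal.ofReal |f x| ^ p).toReal ^ (2 / p) := by
    intro f
    rw [eLpNorm_eq_lintegral_rpow_enorm_toReal hp1 ENNReal.ofReal_ne_top, hpt, ← ENNReal.toReal_rpow, ← Real.rpow_natCast,
      ← Real.rpow_mul ENNReal.toReal_nonneg]
    simp only [Real.enorm_eq_ofReal_abs]
    congr 1; push_cast; ring
  refine IsGreatest.csSup_eq ⟨?_, ?_⟩
  · have hcont : Continuous (fun x : EE n => ww x ^ ((n:ℝ) - μ / 2)) := ww_cont.rpow_const fun x => Or.inl (ww_pos x).ne'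
    have hpos : ∀ x : EE n, 0 < ww x ^ ((n:ℝ) - μ / 2) := fun x => Real.rpow_pos_of_pos (ww_pos x) _
    have hpα : (n - μ / 2) * p = n := by rw [hp, mul_div_assoc', div_eq_iff hd.ne']; ring
    have hhe : (fun x : EE n => ENNReal.ofReal |ww x ^ ((n:ℝ) - μ / 2)|) = hh μ := by
      funext x
      rw [abs_of_pos (hpos x), hh, ENNReal.ofReal_rpow_of_pos (ww_pos x)]
    have hl : ∫⁻ x : EE n, ENNReal.ofReal |ww x ^ ((n:ℝ) - μ / 2)| ^ p = II n := by
      rw [← lint_hh hpα, ← hhe]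
    refine ⟨fun x => ww x ^ ((n:ℝ) - μ / 2), ?_, ?_, ?_⟩
    · intro h
      have := congrFun h 0
      exact (hpos 0).ne' this
    · refine ⟨hcont.aestronglyMeasurable, ?_⟩
      rw [eLpNorm_lt_top_iff_lintegral_rpow_enorm_lt_top hp1 ENNReal.ofReal_ne_top, hpt]
      simp only [Real.enorm_eq_ofReal_abs]
      rw [hl]; exact II_lt_top
    · rw [bridge_l, enorm, hl, hhe, QQ_hh hμ, ENNReal.toReal_mul, CC]
      rw [eq_div_iff (Real.rpow_pos_of_pos hI0 _).ne', mul_assoc, ← Real.rpow_add hI0, mul_comm]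
      congr 1
      have : (μ / n - 1 + 2 / p : ℝ) = 1 := by rw [hp]; field_simp; ring
      rw [this, Real.rpow_one]
  · rintro t ⟨f, -, hf, rfl⟩
    rw [bridge_l, enorm]
    obtain ⟨g, hg, hfg⟩ := hf.1
    have hgm := hg.measurable
    have e1 : QQ μ (fun x => ENNReal.ofReal |f x|) (fun x => ENNReal.ofReal |f x|) = QQ μ (fun x => ENNReal.ofReal |g x|) (fun x => ENNReal.ofReal |g x|) := by
      unfold QQ
      refine lintegral_congr_ae ?_
      filter_upwards [hfg] with x hx
      refine lintegral_congr_ae ?_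
      filter_upwards [hfg] with y hy
      rw [hx, hy]
    have e2 : ∫⁻ x, ENNReal.ofReal |f x| ^ p = ∫⁻ x, ENNReal.ofReal |g x| ^ p := by
      refine lintegral_congr_ae ?_
      filter_upwards [hfg] with x hx
      rw [hx]
    have hfin : ∫⁻ x, ENNReal.ofReal |g x| ^ p ≠ ⊤ := by
      have := (eLpNorm_lt_top_iff_lintegral_rpow_enorm_lt_top hp1 ENNReal.ofReal_ne_top).1 hf.2
      rw [hpt] at this
      simp only [Real.enorm_eq_ofReal_abs] at this
      rw [← e2]; exact this.ne
    rw [e1, e2]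
    have h := (hls_real hμ hμn hp (f := fun x => ENNReal.ofReal |g x|) (by fun_prop) hfin).2
    exact div_le_of_le_mul₀ (by positivity) (CC_pos hμ hμn).le h

end HLS

namespace HLS
open EuclideanGeometry Set Filter Topology
variable {n : ℕ}

theorem QQ_prod (μ : ℝ) {f : EE n → ℝ≥0∞} (hf : Measurable f) :
    QQ μ f f = ∫⁻ q : EE n × EE n, f q.1 * f q.2 * kap μ q.1 q.2 := by
  have := measurable_kap (n := n) μ
  rw [QQ, Measure.volume_eq_prod, lintegral_prod _ (by fun_prop)]

theorem QQ_lim [NeZero n] (hn : 3 ≤ n) {μ : ℝ} (hμ : 0 < μ) (hμn : μ < n) :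
    Tendsto (fun k => QQ μ (fun x : EE n => ENNReal.ofReal |(|ch k x * UU x| ^ ((2 * n - μ) / (n - 2) : ℝ))|)
      (fun x => ENNReal.ofReal |(|ch k x * UU x| ^ ((2 * n - μ) / (n - 2) : ℝ))|)) atTop (𝓝 (II n * ka n μ)) := by
  have hn' : (3:ℝ) ≤ n := by exact_mod_cast hn
  have hn2 : (0:ℝ) < n - 2 := by linarith
  have hq : 0 < (2 * n - μ) / (n - 2 : ℝ) := div_pos (by linarith) hn2
  set q := (2 * n - μ) / (n - 2 : ℝ) with hqd
  have hUq : ∀ x : EE n, ENNReal.ofReal (UU x ^ q) = hh μ x := fun x => by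
    rw [UU_eq, hh, ENNReal.ofReal_rpow_of_pos (ww_pos x), ← Real.rpow_mul (ww_pos x).le]
    congr 2; rw [hqd]; field_simp
  have hm : ∀ k, Measurable (fun x : EE n => ENNReal.ofReal |(|ch k x * UU x| ^ q)|) := fun k => by
    have h1 := (ch_smooth (n := n) k).continuous.measurable
    have h2 := (UU_smooth (n := n)).continuous.measurable
    fun_prop
  have hle : ∀ k (x : EE n), ENNReal.ofReal |(|ch k x * UU x| ^ q)| ≤ hh μ x := fun k x => by
    rw [← hUq, abs_of_nonneg (by positivity)]
    refine ENNReal.ofReal_le_ofReal (Real.rpow_le_rpow (abs_nonneg _) ?_ hq.le)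
    rw [abs_of_nonneg (mul_nonneg (ch_nonneg _ _) (UU_pos x).le)]
    exact mul_le_of_le_one_left (UU_pos x).le (ch_le_one _ _)
  have hev : ∀ x : EE n, ∀ᶠ k in atTop, ENNReal.ofReal |(|ch k x * UU x| ^ q)| = hh μ x := fun x => by
    filter_upwards [ch_ev x] with k hk
    rw [hk, one_mul, abs_of_pos (UU_pos x), abs_of_pos (Real.rpow_pos_of_pos (UU_pos x) _), hUq]
  have mk := measurable_kap (n := n) μ
  rw [← QQ_hh hμ, QQ_prod μ (measurable_hh μ)]
  simp_rw [fun k => QQ_prod μ (hm k)]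
  refine tendsto_lintegral_of_dominated_convergence (fun q : EE n × EE n => hh μ q.1 * hh μ q.2 * kap μ q.1 q.2) ?_ ?_ ?_ ?_
  · intro k
    have := hm k
    exact (((hm k).comp measurable_fst).mul ((hm k).comp measurable_snd)).mul mk
  · intro k
    refine Eventually.of_forall fun q => ?_
    exact mul_le_mul' (mul_le_mul' (hle _ _) (hle _ _)) le_rfl
  · rw [← QQ_prod μ (measurable_hh μ), QQ_hh hμ]
    exact (ENNReal.mul_lt_top II_lt_top (ka_lt_top hμ hμn)).ne
  · refine Eventually.of_forall fun q => ?_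
    refine tendsto_const_nhds.congr' ?_
    filter_upwards [hev q.1, hev q.2] with k h1 h2
    rw [h1, h2]

theorem II_real [NeZero n] : ∫ x : EE n, ww x ^ (n:ℝ) = (II n).toReal := by
  have hn0 : (0:ℝ) < n := by exact_mod_cast Nat.pos_of_ne_zero (NeZero.ne n)
  rw [integral_eq_lintegral_of_nonneg_ae (Eventually.of_forall fun x => (Real.rpow_pos_of_pos (ww_pos x) _).le)
    (ww_cont.rpow_const fun x => Or.inl (ww_pos x).ne').aestronglyMeasurable]
  congr 1
  unfold II
  refine lintegral_congr fun x => ?_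
  rw [ENNReal.ofReal_rpow_of_pos (ww_pos x)]

theorem P_pos {u : EE n → ℝ} (hu : Continuous u) (huc : HasCompactSupport u) (hne : u ≠ 0) {r : ℝ} (hr : 0 < r) :
    0 < ∫ x, |u x| ^ r := by
  obtain ⟨h1, h2⟩ := rpow_cs hu huc hr
  obtain ⟨x, hx⟩ := Function.ne_iff.1 hne
  refine h1.integral_pos_of_hasCompactSupport_nonneg_nonzero h2 (fun x => by positivity) (x := x) ?_
  have : 0 < |u x| := abs_pos.2 hx
  positivity

end HLS

open HLS Filter Topology in
theorem final_aux (n : ℕ) (hn : 3 ≤ n) (μ : ℝ)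
    (hμ0 : 0 < μ) (hμn : μ < n) :
    sInf {t : ℝ | ∃ u : EuclideanSpace ℝ (Fin n) → ℝ,
        ContDiff ℝ (⊤ : ℕ∞) u ∧ HasCompactSupport u ∧ u ≠ 0 ∧
        t = (∫ x, ‖fderiv ℝ u x‖ ^ 2) /
            (∫ x, |u x| ^ (2 * (n : ℝ) / ((n : ℝ) - 2))) ^ (((n : ℝ) - 2) / (n : ℝ))} =
      (sSup {t : ℝ | ∃ f : EuclideanSpace ℝ (Fin n) → ℝ,
          f ≠ 0 ∧ MemLp f (ENNReal.ofReal (2 * n / (2 * (n : ℝ) - μ))) volume ∧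
          t = (∫⁻ x, ∫⁻ y, ENNReal.ofReal (|f x| * |f y| / ‖x - y‖ ^ μ)).toReal /
              ((eLpNorm f (ENNReal.ofReal (2 * n / (2 * (n : ℝ) - μ))) volume).toReal) ^ 2}) ^
        (((n : ℝ) - 2) / (2 * (n : ℝ) - μ)) *
      sInf {t : ℝ | ∃ u : EuclideanSpace ℝ (Fin n) → ℝ,
        ContDiff ℝ (⊤ : ℕ∞) u ∧ HasCompactSupport u ∧ u ≠ 0 ∧
        t = (∫ x, ‖fderiv ℝ u x‖ ^ 2) /
            (∫ x, ∫ y, |u x| ^ ((2 * (n : ℝ) - μ) / ((n : ℝ) - 2)) *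
                |u y| ^ ((2 * (n : ℝ) - μ) / ((n : ℝ) - 2)) / ‖x - y‖ ^ μ) ^
              (((n : ℝ) - 2) / (2 * (n : ℝ) - μ))} := by
  have : NeZero n := ⟨by omega⟩
  have hn' : (3:ℝ) ≤ n := by exact_mod_cast hn
  have hn2 : (0:ℝ) < n - 2 := by linarith
  have hn0 : (0:ℝ) < n := by linarith
  have hd : 0 < 2 * (n:ℝ) - μ := by linarith
  rw [sup_eq hμ0 hμn]
  set A : Set ℝ := {t : ℝ | ∃ u : EuclideanSpace ℝ (Fin n) → ℝ,
        ContDiff ℝ (⊤ : ℕ∞) u ∧ HasCompactSupport u ∧ u ≠ 0 ∧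
        t = (∫ x, ‖fderiv ℝ u x‖ ^ 2) /
            (∫ x, |u x| ^ (2 * (n : ℝ) / ((n : ℝ) - 2))) ^ (((n : ℝ) - 2) / (n : ℝ))} with hA
  set B : Set ℝ := {t : ℝ | ∃ u : EuclideanSpace ℝ (Fin n) → ℝ,
        ContDiff ℝ (⊤ : ℕ∞) u ∧ HasCompactSupport u ∧ u ≠ 0 ∧
        t = (∫ x, ‖fderiv ℝ u x‖ ^ 2) /
            (∫ x, ∫ y, |u x| ^ ((2 * (n : ℝ) - μ) / ((n : ℝ) - 2)) *
                |u y| ^ ((2 * (n : ℝ) - μ) / ((n : ℝ) - 2)) / ‖x - y‖ ^ μ) ^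
              (((n : ℝ) - 2) / (2 * (n : ℝ) - μ))} with hB
  set κ : ℝ := ((n : ℝ) - 2) / (2 * (n : ℝ) - μ) with hκ
  set q : ℝ := (2 * (n : ℝ) - μ) / ((n : ℝ) - 2) with hq
  have hκ0 : 0 < κ := by positivity
  have hq0 : 0 < q := by positivity
  have hC := CC_pos (n := n) hμ0 hμn
  set C := CC n μ with hCd
  set I := (II n).toReal with hI
  have hI0 : 0 < I := ENNReal.toReal_pos II_pos II_lt_top.ne
  -- test functions
  set uk : ℕ → EE n → ℝ := fun k y => ch k y * UU y with huk
  have uks : ∀ k, ContDiff ℝ (⊤ : ℕ∞) (uk k) := fun k => (ch_smooth k).mul UU_smooth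
  have ukc : ∀ k, HasCompactSupport (uk k) := fun k => (ch_supp k).mul_right
  have ukn : ∀ k, uk k ≠ 0 := fun k h => by
    have := congrFun h 0
    simp only [huk, ch_zero, one_mul, Pi.zero_apply] at this
    exact (UU_pos 0).ne' this
  have hAne : A.Nonempty := ⟨_, uk 0, uks 0, ukc 0, ukn 0, rfl⟩
  have hBne : B.Nonempty := ⟨_, uk 0, uks 0, ukc 0, ukn 0, rfl⟩
  have hBr : ∀ u : EE n → ℝ, Continuous u → HasCompactSupport u →
      ∫ x, ∫ y, |u x| ^ q * |u y| ^ q / ‖x - y‖ ^ μ =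
      (QQ μ (fun x => ENNReal.ofReal |(|u x| ^ q)|) (fun x => ENNReal.ofReal |(|u x| ^ q)|)).toReal := by
    intro u hu huc
    obtain ⟨h1, h2⟩ := rpow_cs hu huc hq0
    exact bridge_r hμ0 hμn h1 h2 fun x => by positivity
  have hB0 : ∀ t ∈ B, 0 ≤ t := by
    rintro t ⟨u, hu, huc, -, rfl⟩
    refine div_nonneg (integral_nonneg fun x => by positivity) (Real.rpow_nonneg ?_ _)
    exact integral_nonneg fun x => integral_nonneg fun y => by positivity
  have hA0 : ∀ t ∈ A, 0 ≤ t := by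
    rintro t ⟨u, hu, huc, -, rfl⟩
    exact div_nonneg (integral_nonneg fun x => by positivity)
      (Real.rpow_nonneg (integral_nonneg fun x => by positivity) _)
  -- step 1
  have s1 : n * (n - 2) * I ^ (2 / n : ℝ) ≤ sInf A := by
    refine le_csInf hAne ?_
    rintro t ⟨u, hu, huc, hne, rfl⟩
    have hP := P_pos hu.continuous huc hne (r := 2 * (n : ℝ) / ((n : ℝ) - 2)) (by positivity)
    rw [le_div_iff₀ (Real.rpow_pos_of_pos hP _)]
    exact sob hn hu huc
  -- step 2
  have s2 : sInf A ≤ C ^ κ * sInf B := by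
    have hCk : 0 < C ^ κ := Real.rpow_pos_of_pos hC _
    rw [mul_comm, ← div_le_iff₀ hCk]
    refine le_csInf hBne ?_
    rintro t ⟨u, hu, huc, hne, rfl⟩
    rw [div_le_iff₀ hCk]
    have hP := P_pos hu.continuous huc hne (r := 2 * (n : ℝ) / ((n : ℝ) - 2)) (by positivity)
    refine (csInf_le ⟨0, fun t ht => hA0 t ht⟩ ⟨u, hu, huc, hne, rfl⟩).trans ?_
    set P := ∫ x, |u x| ^ (2 * (n : ℝ) / ((n : ℝ) - 2)) with hPd
    obtain ⟨h1, h2⟩ := rpow_cs hu.continuous huc hq0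
    have hfin := (QQ_fin hμ0 hμn h1 h2 h1 h2).ne
    have hne' : (fun x => |u x| ^ q) ≠ 0 := by
      obtain ⟨x, hx⟩ := Function.ne_iff.1 hne
      refine Function.ne_iff.2 ⟨x, ?_⟩
      exact (Real.rpow_pos_of_pos (abs_pos.2 hx) q).ne'
    have hQ0 := QQ_ne_zero hμ0 h1 hne'
    rw [hBr u hu.continuous huc]
    have hpow : ∫⁻ x, ENNReal.ofReal |(|u x| ^ q)| ^ (2 * n / (2 * n - μ) : ℝ) = ENNReal.ofReal P := by
      rw [hPd, ← rpow_lint hu.continuous huc (by positivity)]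
      refine lintegral_congr fun x => ?_
      rw [abs_of_nonneg (by positivity), ENNReal.ofReal_rpow_of_nonneg (by positivity) (by positivity),
        ← Real.rpow_mul (abs_nonneg _)]
      congr 2
      rw [hq]; field_simp
    have hH := (hls_real hμ0 hμn rfl (f := fun x => ENNReal.ofReal |(|u x| ^ q)|)
      (by have := h1.measurable; fun_prop) (by rw [hpow]; exact ENNReal.ofReal_ne_top)).2
    rw [hpow, ENNReal.toReal_ofReal hP.le] at hH
    set Q := (QQ μ (fun x => ENNReal.ofReal |(|u x| ^ q)|) (fun x => ENNReal.ofReal |(|u x| ^ q)|)).toReal with hQd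
    have hQp : 0 < Q := ENNReal.toReal_pos hQ0 hfin
    have hk : Q ^ κ ≤ C ^ κ * P ^ (((n:ℝ) - 2) / n) := by
      calc Q ^ κ ≤ (C * P ^ (2 / (2 * n / (2 * n - μ)) : ℝ)) ^ κ := Real.rpow_le_rpow hQp.le hH hκ0.le
        _ = _ := by
          rw [Real.mul_rpow hC.le (Real.rpow_nonneg hP.le _), ← Real.rpow_mul hP.le]
          congr 2
          rw [hκ]; field_simp
    have hE : 0 ≤ ∫ x, ‖fderiv ℝ u x‖ ^ 2 := integral_nonneg fun x => by positivity
    have hPk := Real.rpow_pos_of_pos hP (((n:ℝ) - 2) / n)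
    have hQk := Real.rpow_pos_of_pos hQp κ
    rw [div_mul_eq_mul_div, div_le_div_iff₀ hPk hQk, mul_assoc]
    exact mul_le_mul_of_nonneg_left hk hE
  -- step 3
  have s3 : C ^ κ * sInf B ≤ n * (n - 2) * I ^ (2 / n : ℝ) := by
    have hle : ∀ k, sInf B ≤ (∫ x, ‖fderiv ℝ (uk k) x‖ ^ 2) /
        (QQ μ (fun x => ENNReal.ofReal |(|uk k x| ^ q)|) (fun x => ENNReal.ofReal |(|uk k x| ^ q)|)).toReal ^ κ := by
      intro k
      rw [← hBr (uk k) (uks k).continuous (ukc k)]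
      exact csInf_le ⟨0, fun t ht => hB0 t ht⟩ ⟨uk k, uks k, ukc k, ukn k, rfl⟩
    set K := (ka n μ).toReal with hK
    have hkt := (ka_lt_top (n := n) hμ0 hμn).ne
    have hK0 : 0 < K := ENNReal.toReal_pos ka_pos hkt
    have hQl : Tendsto (fun k => (QQ μ (fun x => ENNReal.ofReal |(|uk k x| ^ q)|)
        (fun x => ENNReal.ofReal |(|uk k x| ^ q)|)).toReal) atTop (𝓝 (I * K)) := by
      rw [hI, hK, ← ENNReal.toReal_mul]
      exact (ENNReal.tendsto_toReal (ENNReal.mul_ne_top II_lt_top.ne hkt)).comp (QQ_lim hn hμ0 hμn)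
    have hEl := energy_lim hn
    rw [II_real] at hEl
    have hlim := hEl.div (hQl.rpow_const (p := κ) (Or.inr hκ0.le)) (Real.rpow_pos_of_pos (mul_pos hI0 hK0) κ).ne'
    have hfin := ge_of_tendsto' hlim hle
    refine (mul_le_mul_of_nonneg_left hfin (Real.rpow_nonneg hC.le κ)).trans (le_of_eq ?_)
    rw [hCd, CC, ← hK, ← hI, Real.mul_rpow hK0.le (Real.rpow_nonneg hI0.le _), Real.mul_rpow hI0.le hK0.le,
      ← Real.rpow_mul hI0.le]
    have hKk := Real.rpow_pos_of_pos hK0 κ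
    have hIk := Real.rpow_pos_of_pos hI0 κ
    have e : I ^ ((μ / n - 1) * κ) * I = I ^ (2 / n : ℝ) * I ^ κ := by
      rw [← Real.rpow_add_one hI0.ne', ← Real.rpow_add hI0]
      congr 1
      have h1 : κ * (2 * n - μ) = n - 2 := by rw [hκ]; exact div_mul_cancel₀ _ hd.ne'
      field_simp
      linear_combination (-1 : ℝ) * h1
    rw [mul_div_assoc', div_eq_iff (by positivity)]
    linear_combination (K ^ κ * n * (n - 2)) * e
  exact le_antisymm s2 (s3.trans s1)

/-- The relation `S = C(n,μ)^{(n-2)/(2n-μ)} · S_{H,L}` between the best Sobolev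
constant, the best constant in the Hardy–Littlewood–Sobolev inequality, and the
best constant `S_{H,L}` for the critical Choquard quotient. -/
theorem sobolev_eq_hls_const_mul_SHL (n : ℕ) (hn : 3 ≤ n) (μ : ℝ)
    (hμ0 : 0 < μ) (hμn : μ < n) :
    sInf {t : ℝ | ∃ u : EuclideanSpace ℝ (Fin n) → ℝ,
        ContDiff ℝ (⊤ : ℕ∞) u ∧ HasCompactSupport u ∧ u ≠ 0 ∧
        t = (∫ x, ‖fderiv ℝ u x‖ ^ 2) /
            (∫ x, |u x| ^ (2 * (n : ℝ) / ((n : ℝ) - 2))) ^ (((n : ℝ) - 2) / (n : ℝ))} =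
      (sSup {t : ℝ | ∃ f : EuclideanSpace ℝ (Fin n) → ℝ,
          f ≠ 0 ∧ MemLp f (ENNReal.ofReal (2 * n / (2 * (n : ℝ) - μ))) volume ∧
          t = (∫⁻ x, ∫⁻ y, ENNReal.ofReal (|f x| * |f y| / ‖x - y‖ ^ μ)).toReal /
              ((eLpNorm f (ENNReal.ofReal (2 * n / (2 * (n : ℝ) - μ))) volume).toReal) ^ 2}) ^
        (((n : ℝ) - 2) / (2 * (n : ℝ) - μ)) *
      sInf {t : ℝ | ∃ u : EuclideanSpace ℝ (Fin n) → ℝ,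
        ContDiff ℝ (⊤ : ℕ∞) u ∧ HasCompactSupport u ∧ u ≠ 0 ∧
        t = (∫ x, ‖fderiv ℝ u x‖ ^ 2) /
            (∫ x, ∫ y, |u x| ^ ((2 * (n : ℝ) - μ) / ((n : ℝ) - 2)) *
                |u y| ^ ((2 * (n : ℝ) - μ) / ((n : ℝ) - 2)) / ‖x - y‖ ^ μ) ^
              (((n : ℝ) - 2) / (2 * (n : ℝ) - μ))} :=
  final_aux n hn μ hμ0 hμn
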